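/- arXiv:1010.2380 — 2 statements merged into one kernel-verified Lean document; each statement's English description precedes it below -/
import Mathlib

section
/- Let G be a finite p-solvable group, let N be a normal p'-subgroup of G, and let θ ∈ Irr(N) be G-invariant. Then the character triple (G, N, θ) is isomorphic to a character triple (G*, N*, θ*) in which N* is a central p'-subgroup of G*. Moreover, for any such isomorphism: if χ ∈ Irr(G | θ) corresponds to χ* ∈ Irr(G* | θ*), then χ is a lift if and only if χ* is a lift; and if ψ ∈ Irr(G | θ) is a lift of φ ∈ IBr(G) and φ* = (ψ*)^o, then the number of lifts of φ equals the number of lifts of φ*. -/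
open scoped Classical

noncomputable section

/-- All prime divisors of `n` belong to the set of primes `σ`. -/
def IsPiNumber (σ : Set ℕ) (n : ℕ) : Prop :=
  ∀ q : ℕ, q.Prime → q ∣ n → q ∈ σ

/-- `g` is a `σ`-element: its order is a `σ`-number. -/
def IsPiElt (σ : Set ℕ) {G : Type} [Group G] (g : G) : Prop :=
  IsPiNumber σ (orderOf g)

/-- The `p`-part of a natural number. -/
def pPart (p n : ℕ) : ℕ := p ^ (n.factorization p)

/-- `χ` is the character of a finite-dimensional complex representation of `G`. -/
def IsCharacter (G : Type) [Group G] (χ : G → ℂ) : Prop :=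
  ∃ V : FDRep ℂ G, ∀ g, χ g = V.character g

/-- `χ` is an irreducible (ordinary, complex) character of `G`: a nonzero character
which is not the sum of two nonzero characters. -/
def IsIrrChar (G : Type) [Group G] (χ : G → ℂ) : Prop :=
  IsCharacter G χ ∧ χ ≠ 0 ∧
    ¬ ∃ χ₁ χ₂ : G → ℂ, IsCharacter G χ₁ ∧ χ₁ ≠ 0 ∧ IsCharacter G χ₂ ∧ χ₂ ≠ 0 ∧ χ = χ₁ + χ₂

/-- Restriction of a class function on `G` to a subgroup `H`. -/
def resChar {G : Type} [Group G] (H : Subgroup G) (χ : G → ℂ) : ↥H → ℂ :=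
  fun h => χ (h : G)

/-- Restriction of a class function between nested subgroups. -/
def resCharLe {G : Type} [Group G] {K H : Subgroup G} (hKH : K ≤ H) (χ : ↥H → ℂ) : ↥K → ℂ :=
  fun k => χ ⟨(k : G), hKH k.2⟩

/-- The induced class function from a subgroup `H` of `G`, given by the usual
induction formula. -/
def indChar {G : Type} [Group G] [Fintype G] (H : Subgroup G) (ψ : ↥H → ℂ) : G → ℂ :=
  fun g => (Nat.card ↥H : ℂ)⁻¹ *
    ∑ x : G, if h : x * g * x⁻¹ ∈ H then ψ ⟨x * g * x⁻¹, h⟩ else 0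

/-- Induction of a class function between nested subgroups. -/
def indCharLe {G : Type} [Group G] [Fintype G] {K H : Subgroup G} (_ : K ≤ H)
    (ψ : ↥K → ℂ) : ↥H → ℂ :=
  fun x => (Nat.card ↥K : ℂ)⁻¹ *
    ∑ y : ↥H, if h : (y : G) * (x : G) * (y : G)⁻¹ ∈ K then ψ ⟨(y : G) * (x : G) * (y : G)⁻¹, h⟩ else 0

/-- `θ` is an irreducible constituent of the class function `χ`. -/
def IsConstituent {G : Type} [Group G] (θ χ : G → ℂ) : Prop :=
  IsIrrChar G θ ∧ ∃ ξ : G → ℂ, (ξ = 0 ∨ IsCharacter G ξ) ∧ χ = θ + ξ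

/-- The restriction `χ^o` of a class function to the `σ`-elements of `G`
(extended by zero elsewhere). -/
def piRestrict (σ : Set ℕ) {G : Type} [Group G] (χ : G → ℂ) : G → ℂ :=
  fun g => if IsPiElt σ g then χ g else 0

/-- `φ` is a `σ`-partial character of `G`: the restriction to the `σ`-elements of an
ordinary character. -/
def IsPartialChar (σ : Set ℕ) (G : Type) [Group G] (φ : G → ℂ) : Prop :=
  ∃ χ : G → ℂ, IsCharacter G χ ∧ χ ≠ 0 ∧ φ = piRestrict σ χ

/-- `φ ∈ I_σ(G)`: an irreducible `σ`-partial character, i.e. one which is not the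
sum of two `σ`-partial characters. -/
def IsIPiChar (σ : Set ℕ) (G : Type) [Group G] (φ : G → ℂ) : Prop :=
  IsPartialChar σ G φ ∧
    ¬ ∃ φ₁ φ₂ : G → ℂ, IsPartialChar σ G φ₁ ∧ IsPartialChar σ G φ₂ ∧ φ = φ₁ + φ₂

/-- `φ ∈ IBr(G)` (at the prime `p`): irreducible Brauer characters are the irreducible
`p'`-partial characters, where the `p`-regular elements are the `{p}ᶜ`-elements. -/
def IsIBrChar (p : ℕ) (G : Type) [Group G] (φ : G → ℂ) : Prop :=
  IsIPiChar ({p}ᶜ) G φ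

/-- The restriction `χ^o` of `χ` to the `p`-regular elements of `G`. -/
def brRestrict (p : ℕ) {G : Type} [Group G] (χ : G → ℂ) : G → ℂ :=
  piRestrict ({p}ᶜ) χ

/-- `χ` is a lift of the `σ`-partial character `φ`. -/
def IsLiftOfPi (σ : Set ℕ) (G : Type) [Group G] (χ φ : G → ℂ) : Prop :=
  IsIrrChar G χ ∧ piRestrict σ χ = φ

/-- `χ` is a lift: `χ` is irreducible and `χ^o` is an irreducible `σ`-partial character. -/
def IsLiftPi (σ : Set ℕ) (G : Type) [Group G] (χ : G → ℂ) : Prop :=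
  IsIrrChar G χ ∧ IsIPiChar σ G (piRestrict σ χ)

/-- `H` is a subnormal subgroup of `G`. -/
def IsSubnormalSubgroup {G : Type} [Group G] (H : Subgroup G) : Prop :=
  ∃ (n : ℕ) (c : Fin (n + 1) → Subgroup G),
    c 0 = H ∧ c (Fin.last n) = ⊤ ∧
    ∀ i : Fin n, c i.castSucc ≤ c i.succ ∧ ((c i.castSucc).subgroupOf (c i.succ)).Normal

/-- The determinantal order `o(det θ)` of `θ` is a `σ`-number. -/
def HasPiDetOrder (σ : Set ℕ) (G : Type) [Group G] (θ : G → ℂ) : Prop :=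
  ∃ V : FDRep ℂ G, (∀ g, θ g = V.character g) ∧
    IsPiNumber σ (orderOf (fun g : G => LinearMap.det (V.ρ g)))

/-- `χ` is a `σ`-special character of `G`: `χ` is irreducible, `χ(1)` is a `σ`-number,
and for every subnormal subgroup `M` of `G`, every irreducible constituent of `χ_M`
has determinantal order a `σ`-number. -/
def IsPiSpecial (σ : Set ℕ) (G : Type) [Group G] (χ : G → ℂ) : Prop :=
  IsIrrChar G χ ∧ (∃ n : ℕ, χ 1 = (n : ℂ) ∧ IsPiNumber σ n) ∧
    ∀ M : Subgroup G, IsSubnormalSubgroup M →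
      ∀ θ : ↥M → ℂ, IsConstituent θ (resChar M χ) → HasPiDetOrder σ ↥M θ

/-- `χ` is `σ`-factored: `χ = αβ` with `α` `σ`-special and `β` `σ'`-special. -/
def IsPiFactored (σ : Set ℕ) (G : Type) [Group G] (χ : G → ℂ) : Prop :=
  ∃ α β : G → ℂ, IsPiSpecial σ G α ∧ IsPiSpecial σᶜ G β ∧ χ = α * β

/-- `G` is `σ`-separable: it has a subnormal series each of whose factors is a
`σ`-group or a `σ'`-group (equivalently, every composition factor is a `σ`-group or a
`σ'`-group). -/
def IsPiSeparable (σ : Set ℕ) (G : Type) [Group G] : Prop :=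
  ∃ (n : ℕ) (c : Fin (n + 1) → Subgroup G),
    c 0 = ⊥ ∧ c (Fin.last n) = ⊤ ∧
    ∀ i : Fin n, c i.castSucc ≤ c i.succ ∧ ((c i.castSucc).subgroupOf (c i.succ)).Normal ∧
      (IsPiNumber σ (Nat.card (↥(c i.succ) ⧸ (c i.castSucc).subgroupOf (c i.succ))) ∨
        IsPiNumber σᶜ (Nat.card (↥(c i.succ) ⧸ (c i.castSucc).subgroupOf (c i.succ))))

/-- `G` is `p`-solvable: every composition factor is a `p`-group or a `p'`-group. -/
def IsPSolvable (p : ℕ) (G : Type) [Group G] : Prop :=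
  IsPiSeparable {p} G

/-- The character `δ` of the subgroup `Q` is invariant under (conjugation by the
elements of) the subgroup `S`. -/
def InvariantUnder {G : Type} [Group G] (Q : Subgroup G) (δ : ↥Q → ℂ) (S : Subgroup G) : Prop :=
  ∀ g ∈ S, ∀ x : ↥Q, ∀ h : g * (x : G) * g⁻¹ ∈ Q, δ ⟨g * (x : G) * g⁻¹, h⟩ = δ x

/-- `(Q, δ)` is a vertex pair for `χ ∈ Irr(G)` (at the prime `p`): `Q` is a `p`-subgroup
of `G`, `δ ∈ Irr(Q)`, and there are a subgroup `U ≤ G` and an irreducible character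
`ψ = αβ` of `U` with `α` `p'`-special and `β` `p`-special, such that `ψ^G = χ`, `Q` is a
Sylow `p`-subgroup of `U`, and `β_Q = δ`. -/
def IsVertexPair (p : ℕ) {G : Type} [Group G] [Fintype G] (χ : G → ℂ)
    (Q : Subgroup G) (δ : ↥Q → ℂ) : Prop :=
  IsPGroup p ↥Q ∧ IsIrrChar ↥Q δ ∧
    ∃ (U : Subgroup G) (hQU : Q ≤ U) (α β : ↥U → ℂ),
      IsPiSpecial ({p}ᶜ) ↥U α ∧ IsPiSpecial {p} ↥U β ∧
      IsIrrChar ↥U (α * β) ∧ indChar U (α * β) = χ ∧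
      ¬ p ∣ (Q.subgroupOf U).index ∧
      ∀ x : ↥Q, δ x = β ⟨(x : G), hQU x.2⟩

/-- `(Q, δ)` is a generalized `σ`-vertex for `χ ∈ Irr(G)`: there are `U ≤ G` and an
irreducible `ψ = αβ ∈ Irr(U)` with `α` `σ`-special and `β` `σ'`-special such that
`ψ^G = χ`, `Q` is a Hall `σ'`-subgroup of `U` and `δ = β_Q`. -/
def IsGenPiVertex (σ : Set ℕ) {G : Type} [Group G] [Fintype G] (χ : G → ℂ)
    (Q : Subgroup G) (δ : ↥Q → ℂ) : Prop :=
  ∃ (U : Subgroup G) (hQU : Q ≤ U) (α β : ↥U → ℂ),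
    IsPiSpecial σ ↥U α ∧ IsPiSpecial σᶜ ↥U β ∧
    IsIrrChar ↥U (α * β) ∧ indChar U (α * β) = χ ∧
    IsPiNumber σᶜ (Nat.card ↥Q) ∧ IsPiNumber σ ((Q.subgroupOf U).index) ∧
    ∀ x : ↥Q, δ x = β ⟨(x : G), hQU x.2⟩

/-- The pair `(Q₂, δ₂)` is the conjugate of the pair `(Q₁, δ₁)` by the element `g`. -/
def IsConjPair {G : Type} [Group G] (g : G)
    (Q₁ : Subgroup G) (δ₁ : ↥Q₁ → ℂ) (Q₂ : Subgroup G) (δ₂ : ↥Q₂ → ℂ) : Prop :=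
  Q₂ = Subgroup.map (MulAut.conj g).toMonoidHom Q₁ ∧
    ∀ x : ↥Q₁, ∀ h : g * (x : G) * g⁻¹ ∈ Q₂, δ₂ ⟨g * (x : G) * g⁻¹, h⟩ = δ₁ x

/-- `Q` is a vertex (subgroup) of the irreducible `σ`-partial character `φ` of `G`:
`Q` is a Hall `σ'`-subgroup of a subgroup `U ≤ G` possessing an irreducible `σ`-partial
character `κ` of `σ`-degree with `κ^G = φ`. -/
def IsVertexSubgroup (σ : Set ℕ) {G : Type} [Group G] [Fintype G] (φ : G → ℂ)
    (Q : Subgroup G) : Prop :=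
  ∃ (U : Subgroup G) (κ : ↥U → ℂ), Q ≤ U ∧
    IsPiNumber σᶜ (Nat.card ↥Q) ∧ IsPiNumber σ ((Q.subgroupOf U).index) ∧
    IsIPiChar σ ↥U κ ∧ (∃ n : ℕ, κ 1 = (n : ℂ) ∧ IsPiNumber σ n) ∧
    indChar U κ = φ

/-- `θ ∈ I_σ(M)` is an irreducible constituent of the restriction `φ_M`. -/
def IsIPiConstituent (σ : Set ℕ) {G : Type} [Group G] (M : Subgroup G)
    (θ : ↥M → ℂ) (φ : G → ℂ) : Prop :=
  IsIPiChar σ ↥M θ ∧ ∃ ξ : ↥M → ℂ, (ξ = 0 ∨ IsPartialChar σ ↥M ξ) ∧ resChar M φ = θ + ξ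

/-- The subgroup of `G'` corresponding, under `τ : G/N ≃* G'/N'`, to an intermediate
subgroup `H` with `N ≤ H ≤ G`: the preimage in `G'` of `τ(H/N)`. -/
def corrSubgroup {G G' : Type} [Group G] [Group G'] (N : Subgroup G) [N.Normal]
    (N' : Subgroup G') [N'.Normal] (τ : (G ⧸ N) ≃* (G' ⧸ N')) (H : Subgroup G) :
    Subgroup G' :=
  ((H.map (QuotientGroup.mk' N)).map τ.toMonoidHom).comap (QuotientGroup.mk' N')

/-- The conjugate subgroup `H^g = gHg⁻¹`. -/
def conjSubgroup {G : Type} [Group G] (g : G) (H : Subgroup G) : Subgroup G :=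
  H.map (MulAut.conj g).toMonoidHom

lemma conjSubgroup_mem {G : Type} [Group G] {g : G} {H : Subgroup G}
    (x : ↥(conjSubgroup g H)) : g⁻¹ * (x : G) * g ∈ H := by
  obtain ⟨h, hh, hx⟩ := x.2
  simp only [MulEquiv.coe_toMonoidHom, MulAut.conj_apply] at hx
  have : g⁻¹ * (g * h * g⁻¹) * g = h := by group
  rw [← hx, this]
  exact hh

/-- The conjugate `χ^g` of a character `χ` of `H`, a character of `H^g`. -/
def conjChar {G : Type} [Group G] (g : G) {H : Subgroup G} (χ : ↥H → ℂ) :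
    ↥(conjSubgroup g H) → ℂ :=
  fun x => χ ⟨g⁻¹ * (x : G) * g, conjSubgroup_mem x⟩

/-- `χ ∈ Ch(H | θ)`: `χ` is a (possibly reducible) character of `H` all of whose
irreducible constituents lie over `θ ∈ Irr(N)`. -/
def IsCharOver {G : Type} [Group G] {N H : Subgroup G} (hNH : N ≤ H) (θ : ↥N → ℂ)
    (χ : ↥H → ℂ) : Prop :=
  IsCharacter ↥H χ ∧ ∀ ψ : ↥H → ℂ, IsConstituent ψ χ → IsConstituent θ (resCharLe hNH ψ)

/-- An isomorphism of character triples `(G, N, θ) → (G', N', θ')` in the sense of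
Isaacs, *Character Theory of Finite Groups*, Definition 11.23: a group isomorphism
`τ : G/N ≃* G'/N'` together with, for each intermediate subgroup `N ≤ H ≤ G` (with
corresponding subgroup `H* ≤ G'` the preimage of `τ(H/N)`), maps
`σ_H : Ch(H | θ) → Ch(H* | θ')` which are additive, restrict to bijections
`Irr(H | θ) → Irr(H* | θ')`, preserve the degree ratios `χ(1)/θ(1)`, and are compatible
with restriction, induction, conjugation, and multiplication by characters of `H/N`. -/
structure CharTripleIso
    (G : Type) [Group G] [Fintype G] (N : Subgroup G) [N.Normal] (θ : ↥N → ℂ)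
    (G' : Type) [Group G'] [Fintype G'] (N' : Subgroup G') [N'.Normal] (θ' : ↥N' → ℂ) :
    Type where
  τ : (G ⧸ N) ≃* (G' ⧸ N')
  map : ∀ H : Subgroup G, (↥H → ℂ) → (↥(corrSubgroup N N' τ H) → ℂ)
  le_corr : ∀ H : Subgroup G, N ≤ H → N' ≤ corrSubgroup N N' τ H
  corr_mono : ∀ ⦃K H : Subgroup G⦄, K ≤ H → corrSubgroup N N' τ K ≤ corrSubgroup N N' τ H
  /-- `σ_H` is a bijection from `Irr(H | θ)` onto `Irr(H* | θ')`. -/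
  bijOn : ∀ (H : Subgroup G) (hNH : N ≤ H),
    Set.BijOn (map H) {χ | IsIrrChar ↥H χ ∧ IsConstituent θ (resCharLe hNH χ)}
      {χ' | IsIrrChar ↥(corrSubgroup N N' τ H) χ' ∧
        IsConstituent θ' (resCharLe (le_corr H hNH) χ')}
  /-- `σ_H` is additive on `Ch(H | θ)`. -/
  map_add : ∀ (H : Subgroup G) (hNH : N ≤ H) (χ ψ : ↥H → ℂ),
    IsCharOver hNH θ χ → IsCharOver hNH θ ψ → map H (χ + ψ) = map H χ + map H ψ
  /-- `σ_H` preserves the degree ratios: `σ_H(χ)(1)/θ'(1) = χ(1)/θ(1)`. -/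
  deg_ratio : ∀ (H : Subgroup G) (hNH : N ≤ H) (χ : ↥H → ℂ),
    IsCharOver hNH θ χ → map H χ 1 * θ 1 = χ 1 * θ' 1
  /-- compatibility with restriction: `σ_H(χ)_{K*} = σ_K(χ_K)`. -/
  map_res : ∀ (K H : Subgroup G) (hNK : N ≤ K) (hKH : K ≤ H) (χ : ↥H → ℂ),
    IsCharOver (hNK.trans hKH) θ χ →
      map K (resCharLe hKH χ) = resCharLe (corr_mono hKH) (map H χ)
  /-- compatibility with induction: `σ_H(ψ^H) = σ_K(ψ)^{H*}`. -/
  map_ind : ∀ (K H : Subgroup G) (hNK : N ≤ K) (hKH : K ≤ H) (ψ : ↥K → ℂ),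
    IsCharOver hNK θ ψ →
      map H (indCharLe hKH ψ) = indCharLe (corr_mono hKH) (map K ψ)
  /-- compatibility with multiplication by characters `β` of `H/N`: if `β'` is the
  character of `H*/N'` corresponding to `β` under `τ`, then
  `σ_H(χβ) = σ_H(χ)β'`. -/
  map_mul : ∀ (H : Subgroup G) (hNH : N ≤ H) (χ β : ↥H → ℂ),
    IsCharOver hNH θ χ → IsCharacter ↥H β →
    (∀ (x : ↥H) (n : ↥N), β (x * ⟨(n : G), hNH n.2⟩) = β x) →
    ∀ β' : ↥(corrSubgroup N N' τ H) → ℂ,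
      (∀ (x : ↥H) (x' : ↥(corrSubgroup N N' τ H)),
        τ (QuotientGroup.mk (x : G)) = QuotientGroup.mk (x' : G') → β' x' = β x) →
      map H (χ * β) = map H χ * β'
  /-- compatibility with conjugation: `σ_{H^g}(χ^g) = σ_H(χ)^{g'}` whenever
  `τ(gN) = g'N'`. -/
  map_conj : ∀ (H : Subgroup G) (hNH : N ≤ H) (χ : ↥H → ℂ), IsCharOver hNH θ χ →
    ∀ (g : G) (g' : G'), τ (QuotientGroup.mk g) = QuotientGroup.mk g' →
    ∀ (x : ↥(corrSubgroup N N' τ (conjSubgroup g H)))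
      (hx : g'⁻¹ * (x : G') * g' ∈ corrSubgroup N N' τ H),
      map (conjSubgroup g H) (conjChar g χ) x = map H χ ⟨g'⁻¹ * (x : G') * g', hx⟩

/-- `χ' ∈ Irr(G')` corresponds to `χ ∈ Irr(G)` under the character triple isomorphism
`iso`, i.e. `χ' = σ_G(χ)` (note that the subgroup of `G'` corresponding to `G` is all
of `G'`). -/
def TopCorresponds {G : Type} [Group G] [Fintype G] {N : Subgroup G} [N.Normal]
    {θ : ↥N → ℂ} {G' : Type} [Group G'] [Fintype G'] {N' : Subgroup G'} [N'.Normal]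
    {θ' : ↥N' → ℂ} (iso : CharTripleIso G N θ G' N' θ') (χ : G → ℂ) (χ' : G' → ℂ) :
    Prop :=
  ∀ (x : G') (hx : x ∈ corrSubgroup N N' iso.τ ⊤),
    χ' x = iso.map ⊤ (fun h : ↥(⊤ : Subgroup G) => χ (h : G)) ⟨x, hx⟩

/-- A replacement of the character triple `(G, N, θ)` by an isomorphic character triple
`(G', N', θ')` in which `N'` is a central `p'`-subgroup of `G'`. -/
structure CentralPPrimeReplacement (p : ℕ) (G : Type) [Group G] [Fintype G]
    (N : Subgroup G) [N.Normal] (θ : ↥N → ℂ) : Type 1 where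
  G' : Type
  [grp : Group G']
  [fin : Fintype G']
  N' : Subgroup G'
  [normal' : N'.Normal]
  central : N' ≤ Subgroup.center G'
  pprime : IsPiNumber ({p}ᶜ) (Nat.card ↥N')
  θ' : ↥N' → ℂ
  irr' : IsIrrChar ↥N' θ'
  inv' : InvariantUnder N' θ' ⊤
  iso : CharTripleIso G N θ G' N' θ'

attribute [instance] CentralPPrimeReplacement.grp CentralPPrimeReplacement.fin
  CentralPPrimeReplacement.normal'

lemma isCharacter_character {G V : Type} [Group G] [AddCommGroup V] [Module ℂ V]
    [FiniteDimensional ℂ V] (ρ : Representation ℂ G V) : IsCharacter G ρ.character :=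
  ⟨FDRep.of ρ, fun _ => rfl⟩

lemma IsCharacter.exists_rep {G : Type} [Group G] {χ : G → ℂ} (h : IsCharacter G χ) :
    ∃ (V : Type) (_ : AddCommGroup V) (_ : Module ℂ V) (_ : FiniteDimensional ℂ V)
      (ρ : Representation ℂ G V), χ = ρ.character := by
  obtain ⟨V, hV⟩ := h
  exact ⟨V, inferInstance, inferInstance, inferInstance, V.ρ, funext hV⟩

namespace IsCharacter

variable {G H : Type} [Group G] [Group H] {χ ψ : G → ℂ}

lemma add (hχ : IsCharacter G χ) (hψ : IsCharacter G ψ) : IsCharacter G (χ + ψ) := by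
  obtain ⟨V, _, _, _, ρ, rfl⟩ := hχ.exists_rep
  obtain ⟨W, _, _, _, σ, rfl⟩ := hψ.exists_rep
  convert isCharacter_character (ρ.prod σ) using 1
  ext g
  exact (LinearMap.trace_prodMap' (ρ g) (σ g)).symm

lemma mul (hχ : IsCharacter G χ) (hψ : IsCharacter G ψ) : IsCharacter G (χ * ψ) := by
  obtain ⟨V, _, _, _, ρ, rfl⟩ := hχ.exists_rep
  obtain ⟨W, _, _, _, σ, rfl⟩ := hψ.exists_rep
  rw [← Representation.char_tensor]
  exact isCharacter_character _

lemma dual (hχ : IsCharacter G χ) : IsCharacter G (fun g => χ g⁻¹) := by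
  obtain ⟨V, _, _, _, ρ, rfl⟩ := hχ.exists_rep
  simp_rw [← Representation.char_dual]
  exact isCharacter_character _

lemma comp (hχ : IsCharacter G χ) (f : H →* G) : IsCharacter H (χ ∘ f) := by
  obtain ⟨V, _, _, _, ρ, rfl⟩ := hχ.exists_rep
  exact isCharacter_character (MonoidHom.comp ρ f : Representation ℂ H V)

lemma zero : IsCharacter G (0 : G → ℂ) := by
  convert isCharacter_character (Representation.trivial ℂ G PUnit) using 1
  ext g
  simp [Representation.character, Representation.trivial,
    Module.finrank_zero_of_subsingleton (R := ℂ) (M := PUnit)]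

lemma map_mul_comm (hχ : IsCharacter G χ) (g h : G) : χ (g * h) = χ (h * g) := by
  obtain ⟨V, _, _, _, ρ, rfl⟩ := hχ.exists_rep
  exact ρ.char_mul_comm h g

lemma exists_nat (hχ : IsCharacter G χ) : ∃ n : ℕ, χ 1 = n ∧ (n = 0 → χ = 0) := by
  obtain ⟨V, _, _, _, ρ, rfl⟩ := hχ.exists_rep
  refine ⟨_, ρ.char_one, fun h => ?_⟩
  have := Module.finrank_zero_iff.mp h
  ext g
  have : ρ g = 0 := Subsingleton.elim _ _
  simp [Representation.character, this]

lemma eq_zero_of_apply_one (hχ : IsCharacter G χ) (h : χ 1 = 0) : χ = 0 := by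
  obtain ⟨n, hn, h0⟩ := hχ.exists_nat
  exact h0 (by rw [h] at hn; exact_mod_cast hn.symm)

lemma ne_zero_of_apply_one_eq_one (hχ : IsCharacter G χ) (h : χ 1 = 1) (g : G) : χ g ≠ 0 := by
  obtain ⟨V, _, _, _, ρ, rfl⟩ := hχ.exists_rep
  rw [ρ.char_one] at h
  have h1 : Module.finrank ℂ V = 1 := by exact_mod_cast h
  obtain ⟨c, hc, -⟩ := LinearMap.existsUnique_eq_smul_id_of_finrank_eq_one h1 (ρ g)
  have hg : ρ.character g = c := by
    rw [Representation.character, hc]; simp [h1]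
  rw [hg]
  rintro rfl
  have h2 : ρ g * ρ g⁻¹ = 1 := by rw [← map_mul]; simp
  rw [hc] at h2
  have : Nontrivial V := Module.nontrivial_of_finrank_eq_succ h1
  simp at h2

end IsCharacter

lemma isIrrChar_of_apply_one_eq_one {G : Type} [Group G] {χ : G → ℂ} (hχ : IsCharacter G χ)
    (h : χ 1 = 1) : IsIrrChar G χ := by
  refine ⟨hχ, ?_, ?_⟩
  · rintro rfl
    simp at h
  rintro ⟨χ₁, χ₂, h₁, n₁, h₂, n₂, rfl⟩
  obtain ⟨a, ha, ha'⟩ := h₁.exists_nat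
  obtain ⟨b, hb, hb'⟩ := h₂.exists_nat
  simp only [Pi.add_apply, ha, hb] at h
  have : a + b = 1 := by exact_mod_cast h
  have : a ≠ 0 := fun h => n₁ (ha' h)
  have : b ≠ 0 := fun h => n₂ (hb' h)
  omega

lemma isIrrChar_of_monoidHom {G : Type} [Group G] (f : G →* ℂ) : IsIrrChar G f := by
  refine isIrrChar_of_apply_one_eq_one ?_ (map_one f)
  convert isCharacter_character (V := ℂ)
    (((Algebra.lmul ℂ ℂ : ℂ →ₐ[ℂ] Module.End ℂ ℂ) : ℂ →* Module.End ℂ ℂ).comp f) using 1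
  ext g
  simp only [Representation.character, MonoidHom.comp_apply]
  rw [LinearMap.trace_eq_matrix_trace ℂ (Module.Basis.singleton Unit ℂ)]
  simp [Matrix.trace, LinearMap.toMatrix_apply]

/-- The average of a complex-valued function over a finite type. -/
def avg {A : Type} (F : A → ℂ) : ℂ := (Nat.card A : ℂ)⁻¹ * ∑ᶠ a, F a

lemma avg_eq {A : Type} [Fintype A] (F : A → ℂ) : avg F = (Nat.card A : ℂ)⁻¹ * ∑ a, F a := by
  rw [avg, finsum_eq_sum_of_fintype]

lemma avg_equiv {A B : Type} (e : A ≃ B) (F : B → ℂ) : avg (fun a => F (e a)) = avg F := by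
  rw [avg, avg, Nat.card_congr e, finsum_comp_equiv e]

lemma avg_add {A : Type} [Finite A] (F F' : A → ℂ) :
    avg (fun a => F a + F' a) = avg F + avg F' := by
  have := Fintype.ofFinite A
  simp [avg_eq, Finset.sum_add_distrib, mul_add]

lemma avg_mul_left {A : Type} [Finite A] (c : ℂ) (F : A → ℂ) :
    avg (fun a => c * F a) = c * avg F := by
  have := Fintype.ofFinite A
  simp only [avg_eq, ← Finset.mul_sum]; ring

lemma avg_mul_right {A : Type} [Finite A] (c : ℂ) (F : A → ℂ) :
    avg (fun a => F a * c) = avg F * c := by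
  simp_rw [mul_comm _ c, avg_mul_left]

lemma avg_const {A : Type} [Finite A] [Nonempty A] (c : ℂ) : avg (fun _ : A => c) = c := by
  have := Fintype.ofFinite A
  simp [avg_eq, Nat.card_eq_fintype_card]

lemma avg_zero {A : Type} : avg (fun _ : A => (0 : ℂ)) = 0 := by
  simp [avg]

lemma avg_prod {A B : Type} [Finite A] [Finite B] (F : A → B → ℂ) :
    avg (fun p : A × B => F p.1 p.2) = avg (fun a => avg (F a)) := by
  have := Fintype.ofFinite A
  have := Fintype.ofFinite B
  simp only [avg_eq, Fintype.sum_prod_type, ← Finset.mul_sum]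
  simp [mul_assoc, mul_comm]

lemma avg_comm {A B : Type} [Finite A] [Finite B] (F : A → B → ℂ) :
    avg (fun a => avg (F a)) = avg (fun b => avg fun a => F a b) := by
  rw [← avg_prod, ← avg_prod, ← avg_equiv (Equiv.prodComm A B)]
  rfl

/-- A finite group is, as a set, the product of a quotient and the kernel. -/
def prodKerEquiv {A B : Type} [Group A] [Group B] (f : A →* B) (hf : Function.Surjective f) :
    B × f.ker ≃ A where
  toFun p := Function.surjInv hf p.1 * p.2
  invFun a := (f a, ⟨(Function.surjInv hf (f a))⁻¹ * a, by
    simp [MonoidHom.mem_ker, Function.surjInv_eq hf]⟩)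
  left_inv p := by
    obtain ⟨b, k, hk⟩ := p
    have : f (Function.surjInv hf b * k) = b := by
      simp [Function.surjInv_eq hf, MonoidHom.mem_ker.mp hk]
    ext <;> simp [this]
  right_inv a := by simp

lemma avg_fiber {A B : Type} [Group A] [Group B] [Finite A] (f : A →* B)
    (hf : Function.Surjective f) (F : A → ℂ) :
    avg F = avg (fun b => avg fun k : f.ker => F (Function.surjInv hf b * k)) := by
  have := Finite.of_surjective f hf
  rw [← avg_prod (fun b (k : f.ker) => F (Function.surjInv hf b * k)),
    ← avg_equiv (prodKerEquiv f hf)]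
  rfl

lemma avg_comp {A B : Type} [Group A] [Group B] [Finite A] (f : A →* B)
    (hf : Function.Surjective f) (F : B → ℂ) : avg (fun a => F (f a)) = avg F := by
  rw [avg_fiber f hf]
  congr 1
  ext b
  rw [← avg_const (A := f.ker) (F b)]
  congr 1
  ext k
  simp [Function.surjInv_eq hf, MonoidHom.mem_ker.mp k.2]

/-- The inner product of class functions. -/
def charInner {G : Type} [Group G] (χ ψ : G → ℂ) : ℂ := avg fun g => χ g * ψ g⁻¹

section Inner
variable {G : Type} [Group G] [Finite G] {χ χ' ψ ψ' : G → ℂ}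

lemma charInner_add_left (χ χ' ψ : G → ℂ) :
    charInner (χ + χ') ψ = charInner χ ψ + charInner χ' ψ := by
  simp [charInner, ← avg_add, add_mul]

lemma charInner_add_right (χ ψ ψ' : G → ℂ) :
    charInner χ (ψ + ψ') = charInner χ ψ + charInner χ ψ' := by
  simp [charInner, ← avg_add, mul_add]

omit [Finite G] in
lemma charInner_zero_left (ψ : G → ℂ) : charInner 0 ψ = 0 := by
  simp [charInner, avg_zero]

lemma charInner_smul_left (c : ℂ) (χ ψ : G → ℂ) :
    charInner (c • χ) ψ = c * charInner χ ψ := by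
  simp [charInner, ← avg_mul_left, mul_assoc]

omit [Finite G] in
lemma charInner_comp {A : Type} [Group A] [Finite A] (f : A →* G) (hf : Function.Surjective f)
    (χ ψ : G → ℂ) : charInner (χ ∘ f) (ψ ∘ f) = charInner χ ψ := by
  simp only [charInner, Function.comp_apply, map_inv]
  exact avg_comp f hf (fun g => χ g * ψ g⁻¹)

lemma charInner_nat (hχ : IsCharacter G χ) (hψ : IsCharacter G ψ) :
    ∃ n : ℕ, charInner χ ψ = n := by
  have := Fintype.ofFinite G
  obtain ⟨V, _, _, _, ρ, rfl⟩ := hχ.exists_rep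
  obtain ⟨W, _, _, _, σ, rfl⟩ := hψ.exists_rep
  have : Invertible (Nat.card G : ℂ) := invertibleOfNonzero (by simp)
  exact ⟨_, by rw [charInner, avg_eq, Representation.card_inv_mul_sum_char_mul_char_eq_finrank]⟩

lemma charInner_self_nat (hχ : IsCharacter G χ) (h0 : χ ≠ 0) :
    ∃ n : ℕ, charInner χ χ = n ∧ 1 ≤ n := by
  have := Fintype.ofFinite G
  obtain ⟨V, _, _, _, ρ, rfl⟩ := hχ.exists_rep
  have : Invertible (Nat.card G : ℂ) := invertibleOfNonzero (by simp)
  refine ⟨_, by rw [charInner, avg_eq, Representation.card_inv_mul_sum_char_mul_char_eq_finrank], ?_⟩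
  have : Nontrivial V := by
    by_contra h
    rw [not_nontrivial_iff_subsingleton] at h
    exact h0 (hχ.eq_zero_of_apply_one (by simp [Module.finrank_zero_of_subsingleton]))
  have : Nontrivial (ρ.IntertwiningMap ρ) := by
    obtain ⟨v, hv⟩ := exists_ne (0 : V)
    exact ⟨⟨0, .id ρ, fun h => hv (by simpa using (DFunLike.congr_fun h v).symm)⟩⟩
  have : FiniteDimensional ℂ (ρ.IntertwiningMap ρ) :=
    (Representation.invariantsEquivIntertwiningMap ρ ρ).finiteDimensional
  exact Module.finrank_pos

lemma IsIrrChar.exists_irrep (hχ : IsIrrChar G χ) :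
    ∃ (V : Type) (_ : AddCommGroup V) (_ : Module ℂ V) (_ : FiniteDimensional ℂ V)
      (ρ : Representation ℂ G V), ρ.IsIrreducible ∧ χ = ρ.character := by
  obtain ⟨h, h0, hirr⟩ := hχ
  obtain ⟨V, _, _, _, ρ, rfl⟩ := h.exists_rep
  refine ⟨V, _, _, inferInstance, ρ, ?_, rfl⟩
  have hV : Nontrivial V := by
    by_contra h'
    rw [not_nontrivial_iff_subsingleton] at h'
    exact h0 (h.eq_zero_of_apply_one (by simp [Module.finrank_zero_of_subsingleton]))
  have : NeZero (Nat.card G : ℂ) := ⟨Nat.cast_ne_zero.mpr Nat.card_pos.ne'⟩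
  refine { exists_pair_ne := ⟨⊥, ⊤, fun h => ?_⟩, eq_bot_or_eq_top := fun W => ?_ }
  · obtain ⟨v, hv⟩ := exists_ne (0 : V)
    have : v ∈ (⊥ : Subrepresentation ρ).toSubmodule := by rw [h]; trivial
    exact hv ((Submodule.mem_bot ℂ).mp this)
  obtain ⟨W', hW⟩ := exists_isCompl W
  have hc : IsCompl W.toSubmodule W'.toSubmodule := by
    constructor
    · rw [disjoint_iff, ← Subrepresentation.toSubmodule_inf, hW.inf_eq_bot]; rfl
    · rw [codisjoint_iff, ← Subrepresentation.toSubmodule_sup, hW.sup_eq_top]; rfl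
  have hsum : ρ.character = W.toRepresentation.character + W'.toRepresentation.character := by
    ext g
    simp only [Representation.character, Pi.add_apply]
    rw [← LinearMap.trace_prodMap', ← LinearMap.trace_conj' _
      (Submodule.prodEquivOfIsCompl _ _ hc)]
    congr 1
    ext v
    obtain ⟨w, rfl⟩ := (Submodule.prodEquivOfIsCompl _ _ hc).surjective v
    simp [LinearEquiv.conj_apply, Subrepresentation.toRepresentation]
  have key : ∀ U : Subrepresentation ρ, U.toRepresentation.character = 0 → U = ⊥ := by
    intro U hU
    have := congr_fun hU 1
    rw [Representation.char_one, Pi.zero_apply] at this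
    have : Module.finrank ℂ U.toSubmodule = 0 := by exact_mod_cast this
    exact Subrepresentation.toSubmodule_injective (Submodule.finrank_eq_zero.mp this)
  by_contra! hne
  exact hirr ⟨_, _, isCharacter_character _, fun h => hne.1 (key _ h), isCharacter_character _,
    fun h => hne.2 (by have := hW.sup_eq_top; rwa [key _ h, sup_bot_eq] at this), hsum⟩

lemma IsIrrChar.charInner_eq (hχ : IsIrrChar G χ) (hψ : IsIrrChar G ψ) :
    charInner χ ψ = if χ = ψ then 1 else 0 := by
  have := Fintype.ofFinite G
  obtain ⟨V, _, _, _, ρ, _, rfl⟩ := hχ.exists_irrep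
  obtain ⟨W, _, _, _, σ, _, rfl⟩ := hψ.exists_irrep
  have : Invertible (Nat.card G : ℂ) := invertibleOfNonzero (by simp)
  have h1 := Representation.char_orthonormal ρ σ
  rw [charInner, avg_eq, h1]
  by_cases h : Nonempty (σ.Equiv ρ)
  · rw [if_pos h, if_pos (Representation.char_iso h.some).symm]
  · rw [if_neg h, if_neg]
    intro he
    rw [if_neg h, he, Representation.char_orthonormal σ σ, if_pos ⟨.refl σ⟩] at h1
    simp at h1

lemma IsIrrChar.charInner_self (hχ : IsIrrChar G χ) : charInner χ χ = 1 := by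
  simp [hχ.charInner_eq hχ]

lemma isIrrChar_iff : IsIrrChar G χ ↔ IsCharacter G χ ∧ charInner χ χ = 1 := by
  refine ⟨fun h => ⟨h.1, h.charInner_self⟩, fun ⟨h, h1⟩ => ⟨h, ?_, ?_⟩⟩
  · rintro rfl
    simp [charInner_zero_left] at h1
  rintro ⟨χ₁, χ₂, h₁, n₁, h₂, n₂, rfl⟩
  obtain ⟨a, ha, ha'⟩ := charInner_self_nat h₁ n₁
  obtain ⟨b, hb, hb'⟩ := charInner_self_nat h₂ n₂
  obtain ⟨c, hc⟩ := charInner_nat h₁ h₂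
  obtain ⟨d, hd⟩ := charInner_nat h₂ h₁
  rw [charInner_add_left, charInner_add_right, charInner_add_right, ha, hb, hc, hd] at h1
  have : a + c + (d + b) = 1 := by exact_mod_cast h1
  omega

omit [Finite G] in
lemma IsCharacter.exists_multiset (hχ : IsCharacter G χ) :
    ∃ s : Multiset (G → ℂ), (∀ ψ ∈ s, IsIrrChar G ψ) ∧ χ = s.sum := by
  obtain ⟨n, hn, -⟩ := hχ.exists_nat
  induction n using Nat.strong_induction_on generalizing χ with
  | _ n ih =>
    by_cases h0 : χ = 0
    · exact ⟨0, by simp, by simpa using h0⟩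
    by_cases hirr : IsIrrChar G χ
    · exact ⟨{χ}, by simpa using hirr, by simp⟩
    simp only [IsIrrChar, hχ, h0, ne_eq, not_false_eq_true, true_and, not_not] at hirr
    obtain ⟨χ₁, χ₂, h₁, n₁, h₂, n₂, rfl⟩ := hirr
    obtain ⟨a, ha, ha'⟩ := h₁.exists_nat
    obtain ⟨b, hb, hb'⟩ := h₂.exists_nat
    simp only [Pi.add_apply, ha, hb] at hn
    have h3 : a + b = n := by exact_mod_cast hn
    have h4 : a ≠ 0 := fun h => n₁ (ha' h)
    have h5 : b ≠ 0 := fun h => n₂ (hb' h)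
    obtain ⟨s, hs, rfl⟩ := ih a (by omega) h₁ ha
    obtain ⟨t, ht, rfl⟩ := ih b (by omega) h₂ hb
    refine ⟨s + t, ?_, by simp⟩
    intro ψ hψ
    rcases Multiset.mem_add.mp hψ with h | h
    exacts [hs _ h, ht _ h]

omit [Finite G] in
lemma isCharacter_multiset_sum (s : Multiset (G → ℂ)) (hs : ∀ ψ ∈ s, IsCharacter G ψ) :
    IsCharacter G s.sum := by
  induction s using Multiset.induction_on with
  | empty => simpa using IsCharacter.zero
  | cons a s ih =>
    rw [Multiset.sum_cons]
    exact (hs a (by simp)).add (ih fun ψ hψ => hs ψ (by simp [hψ]))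

lemma charInner_multiset_sum_eq_zero (s : Multiset (G → ℂ)) (hs : ∀ χ ∈ s, charInner χ ψ = 0) :
    charInner s.sum ψ = 0 := by
  induction s using Multiset.induction_on with
  | empty => simpa using charInner_zero_left ψ
  | cons a s ih =>
    rw [Multiset.sum_cons, charInner_add_left, hs a (by simp),
      ih fun ψ hψ => hs ψ (by simp [hψ]), add_zero]

omit [Finite G] in
lemma isConstituent_of_mem {s : Multiset (G → ℂ)} (hs : ∀ ψ ∈ s, IsIrrChar G ψ) (hψ : ψ ∈ s) :
    IsConstituent ψ s.sum := by
  obtain ⟨t, rfl⟩ := Multiset.exists_cons_of_mem hψ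
  refine ⟨hs _ hψ, t.sum, .inr (isCharacter_multiset_sum t fun ψ h => (hs ψ ?_).1), by simp⟩
  simp [h]

lemma isConstituent_iff (hχ : IsCharacter G χ) (hψ : IsIrrChar G ψ) :
    IsConstituent ψ χ ↔ charInner χ ψ ≠ 0 := by
  constructor
  · rintro ⟨-, ξ, hξ, rfl⟩
    have hξ' : IsCharacter G ξ := by
      rcases hξ with rfl | h
      exacts [.zero, h]
    obtain ⟨n, hn⟩ := charInner_nat hξ' hψ.1
    rw [charInner_add_left, hψ.charInner_self, hn]
    norm_cast
    omega
  · intro h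
    obtain ⟨s, hs, rfl⟩ := hχ.exists_multiset
    refine isConstituent_of_mem hs ?_
    by_contra hmem
    refine h (charInner_multiset_sum_eq_zero s fun χ hχ => ?_)
    rw [(hs χ hχ).charInner_eq hψ, if_neg]
    rintro rfl
    exact hmem hχ

/-- A summand of a multiple of an irreducible character is again a multiple of it. -/
lemma exists_smul_of_add_eq_smul {θ : G → ℂ} (hθ : IsIrrChar G θ) (hχ : IsCharacter G χ)
    (hψ : IsCharacter G ψ) {c : ℂ} (h : χ + ψ = c • θ) : ∃ d : ℂ, χ = d • θ := by
  obtain ⟨s, hs, rfl⟩ := hχ.exists_multiset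
  have key : ∀ η ∈ s, η = θ := by
    intro η hη
    by_contra hne
    obtain ⟨t, rfl⟩ := Multiset.exists_cons_of_mem hη
    have ht : IsCharacter G t.sum := isCharacter_multiset_sum t fun ψ h => (hs ψ (by simp [h])).1
    have hη := hs η hη
    obtain ⟨m, hm⟩ := charInner_nat ht hη.1
    obtain ⟨n, hn⟩ := charInner_nat hψ hη.1
    have := congr_arg (charInner · η) h
    simp only [Multiset.sum_cons, charInner_add_left, charInner_smul_left, hη.charInner_self, hm,
      hn, hθ.charInner_eq hη, if_neg (Ne.symm hne), mul_zero] at this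
    norm_cast at this
    omega
  refine ⟨s.card, ?_⟩
  rw [Multiset.eq_replicate_card.mpr key, Multiset.sum_replicate, Multiset.card_replicate]
  ext; simp

lemma smul_of_charInner (hχ : IsCharacter G χ) {θ : G → ℂ} (hθ : IsIrrChar G θ) {c : ℂ}
    (h : χ = c • θ) : (IsConstituent θ χ ↔ c ≠ 0) := by
  rw [isConstituent_iff hχ hθ, h, charInner_smul_left, hθ.charInner_self, mul_one]

end Inner

lemma Representation.IsIrreducible.exists_eq_smul_one {G V : Type} [Group G] [AddCommGroup V]
    [Module ℂ V] [FiniteDimensional ℂ V] (ρ : Representation ℂ G V) [ρ.IsIrreducible]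
    (f : Module.End ℂ V) (hf : ∀ g, f * ρ g = ρ g * f) : ∃ c : ℂ, f = c • 1 := by
  obtain ⟨c, hc⟩ := (Representation.IsIrreducible.algebraMap_intertwiningMap_bijective_of_isAlgClosed
    (k := ℂ) (ρ := ρ)).2 ⟨f, fun g => hf g⟩
  refine ⟨c, ?_⟩
  ext v
  exact (DFunLike.congr_fun hc v).symm

/-- A central element acts by a scalar on an irreducible character. -/
lemma IsIrrChar.exists_apply_mul_central {G : Type} [Group G] [Finite G] {χ : G → ℂ}
    (hχ : IsIrrChar G χ) {z : G} (hz : ∀ g, z * g = g * z) : ∃ c : ℂ, ∀ g, χ (g * z) = χ g * c := by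
  obtain ⟨V, _, _, _, ρ, _, rfl⟩ := hχ.exists_irrep
  obtain ⟨c, hc⟩ := Representation.IsIrreducible.exists_eq_smul_one ρ (ρ z)
    fun g => by rw [← map_mul, ← map_mul, hz]
  refine ⟨c, fun g => ?_⟩
  simp [Representation.character, hc, mul_comm]

lemma IsIrrChar.apply_one_of_comm {G : Type} [Group G] [Finite G] {χ : G → ℂ}
    (hχ : IsIrrChar G χ) (h : ∀ g g' : G, g * g' = g' * g) : χ 1 = 1 := by
  obtain ⟨V, _, _, _, ρ, _, rfl⟩ := hχ.exists_irrep
  have : IsMulCommutative G := ⟨⟨h⟩⟩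
  rw [ρ.char_one, Representation.IsIrreducible.finrank_eq_one_of_isMulCommutative ρ, Nat.cast_one]

lemma IsIrrChar.apply_one_ne_zero {G : Type} [Group G] {χ : G → ℂ}
    (hχ : IsIrrChar G χ) : χ 1 ≠ 0 := fun h => hχ.2.1 (hχ.1.eq_zero_of_apply_one h)

/-- The average of `F` over a fibre of `f`. -/
def push {A B : Type} [Group A] [Group B] (f : A →* B) (F : A → ℂ) (b : B) : ℂ :=
  if h : ∃ a, f a = b then avg fun k : f.ker => F (h.choose * k) else 0

section Push
variable {A B : Type} [Group A] [Group B] (f : A →* B)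

lemma push_apply (F : A → ℂ) (a : A) : push f F (f a) = avg fun k : f.ker => F (a * k) := by
  have h : ∃ a', f a' = f a := ⟨a, rfl⟩
  rw [push, dif_pos h]
  have hk : a⁻¹ * h.choose ∈ f.ker := by
    simp [MonoidHom.mem_ker, h.choose_spec]
  rw [← avg_equiv (Equiv.mulLeft (⟨_, hk⟩ : f.ker)) fun k : f.ker => F (a * k)]
  simp [mul_assoc]

lemma push_add [Finite A] (F F' : A → ℂ) : push f (F + F') = push f F + push f F' := by
  ext b
  simp only [push, Pi.add_apply]
  split_ifs
  · rw [← avg_add]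
  · simp

lemma push_mul_comp [Finite A] (F : A → ℂ) (F' : B → ℂ) :
    push f (F * F' ∘ f) = push f F * F' := by
  ext b
  simp only [push, Pi.mul_apply]
  split_ifs with h
  · rw [← avg_mul_right]
    congr 1
    ext k
    simp [h.choose_spec, MonoidHom.mem_ker.mp k.2]
  · simp

lemma avg_push [Finite A] (hf : Function.Surjective f) (F : A → ℂ) : avg (push f F) = avg F := by
  rw [avg_fiber f hf]
  congr 1
  ext b
  conv_lhs => rw [← Function.surjInv_eq hf b]
  rw [push_apply]

lemma charInner_push [Finite A] (hf : Function.Surjective f) (F : A → ℂ) (F' : B → ℂ) :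
    charInner (push f F) F' = charInner F (F' ∘ f) := by
  rw [charInner, charInner, ← avg_push f hf]
  congr 1
  ext b
  have := push_mul_comp f F (fun b => F' b⁻¹)
  replace this := congr_fun this b
  simp only [Pi.mul_apply] at this
  rw [← this]
  congr 1
  ext a
  simp

/-- The average of a character over the fibres of a surjection is a character. -/
lemma IsCharacter.push [Finite A] {F : A → ℂ} (hF : IsCharacter A F)
    (hf : Function.Surjective f) : IsCharacter B (push f F) := by
  obtain ⟨V, _, _, _, ρ, rfl⟩ := hF.exists_rep
  have := Fintype.ofFinite f.ker
  have : Invertible (Fintype.card f.ker : ℂ) :=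
    invertibleOfNonzero (Nat.cast_ne_zero.mpr Fintype.card_ne_zero)
  have key := (isCharacter_character (ρ.quotientToInvariants f.ker)).comp
    (QuotientGroup.quotientKerEquivOfSurjective f hf).symm.toMonoidHom
  convert key using 1
  ext b
  obtain ⟨a, rfl⟩ := hf b
  have h1 : (QuotientGroup.quotientKerEquivOfSurjective f hf).symm (f a) = a := by
    rw [MulEquiv.symm_apply_eq]; rfl
  simp only [Function.comp_apply, MulEquiv.toMonoidHom_eq_coe, MonoidHom.coe_coe, h1, push_apply]
  let P := Representation.averageMap (MonoidHom.comp ρ f.ker.subtype : Representation ℂ f.ker V)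
  have hP : P = (Fintype.card f.ker : ℂ)⁻¹ • ∑ k : f.ker, ρ k := by
    simp [P, GroupAlgebra.average, Representation.asAlgebraHom_def]
  have hmem : ∀ x, (ρ a * P) x ∈
      Representation.invariants (MonoidHom.comp ρ f.ker.subtype) := fun x =>
    Representation.le_comap_invariants ρ f.ker a (Representation.averageMap_invariant _ x)
  have h2 := LinearMap.trace_restrict_eq_of_forall_mem _ _ hmem
  have h3 : (ρ a * P).restrict (fun x _ => hmem x) = ρ.quotientToInvariants f.ker (a : A ⧸ f.ker) := by
    ext x
    show ρ a (P x) = ρ a x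
    rw [Representation.averageMap_id _ _ x.2]
  rw [h3] at h2
  rw [Representation.character, h2, hP, avg_eq, Nat.card_eq_fintype_card]
  simp [Representation.character, Finset.mul_sum]

end Push

lemma IsConstituent.exists_add {G : Type} [Group G] {χ ψ : G → ℂ} (h : IsConstituent ψ χ) :
    ∃ ξ, IsCharacter G ξ ∧ χ = ψ + ξ := by
  obtain ⟨-, ξ, rfl | hξ, rfl⟩ := h
  exacts [⟨0, .zero, rfl⟩, ⟨ξ, hξ, rfl⟩]

lemma IsCharacter.exists_constituent {G : Type} [Group G] {χ : G → ℂ} (hχ : IsCharacter G χ)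
    (h0 : χ ≠ 0) : ∃ ψ, IsConstituent ψ χ := by
  obtain ⟨s, hs, rfl⟩ := hχ.exists_multiset
  have : s ≠ 0 := by rintro rfl; exact h0 rfl
  obtain ⟨ψ, hψ⟩ := Multiset.exists_mem_of_ne_zero this
  exact ⟨ψ, isConstituent_of_mem hs hψ⟩

lemma IsConstituent.eq_of_irr {G : Type} [Group G] {χ ψ : G → ℂ} (hχ : IsIrrChar G χ)
    (h : IsConstituent ψ χ) : ψ = χ := by
  obtain ⟨ξ, hξ, rfl⟩ := h.exists_add
  by_cases h0 : ξ = 0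
  · simp [h0]
  · exact (hχ.2.2 ⟨ψ, ξ, h.1.1, h.1.2.1, hξ, h0, rfl⟩).elim

/-- An irreducible character over a linear character `θ` of a central subgroup. -/
lemma IsIrrChar.apply_mul_of_central {C M : Type} [Group C] [Finite C] [Group M] [Finite M]
    (i : M →* C) (hi : ∀ m c, i m * c = c * i m) {χ : C → ℂ} (hχ : IsIrrChar C χ) {θ : M → ℂ}
    (hθ : IsConstituent θ (χ ∘ i)) (c : C) (m : M) : χ (c * i m) = χ c * θ m := by
  choose l hl using fun m => hχ.exists_apply_mul_central (hi m)
  have h1 := hχ.apply_one_ne_zero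
  let L : M →* ℂ :=
    { toFun := l
      map_one' := by
        have := hl 1 1
        rw [map_one, mul_one] at this
        exact (mul_left_cancel₀ h1 (by rw [← this, mul_one]))
      map_mul' := fun x y => by
        have := hl (x * y) 1
        rw [map_mul, ← mul_assoc, hl y, hl x] at this
        exact (mul_left_cancel₀ h1 (by rw [← this, mul_assoc])) }
  have hL : χ ∘ i = χ 1 • (L : M → ℂ) := by
    ext m
    simpa [L] using hl m 1
  have h2 := (isConstituent_iff (hχ.1.comp i) hθ.1).mp hθ
  rw [hL, charInner_smul_left, (isIrrChar_of_monoidHom L).charInner_eq hθ.1] at h2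
  have h3 : (L : M → ℂ) = θ := by
    by_contra h
    simp [h] at h2
  rw [hl, ← h3]; rfl

/-- The data of a finite group `A` mapping onto `B` and `C`, with `b.ker` the image of `M` and
`a.ker` central and mapping onto the image of `M'`, together with a character `τ` of `A` which
restricts to `θ` on `M` and to (a multiple of the inverse of) `θ'` on `a.ker`. -/
structure TripleCtx (A B C M M' : Type) [Group A] [Group B] [Group C] [Group M] [Group M'] where
  a : A →* B
  b : A →* C
  ι : M →* A
  i' : M' →* C
  τ : A → ℂ
  θ : M → ℂ
  θ' : M' → ℂ
  ha : Function.Surjective a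
  hb : Function.Surjective b
  hτ : IsCharacter A τ
  irr : IsIrrChar M θ
  irr' : IsIrrChar M' θ'
  central : ∀ z, a z = 1 → ∀ γ, z * γ = γ * z
  ker_b : ∀ γ, b γ = 1 ↔ ∃ m, ι m = γ
  lift : ∀ m', ∃ z, a z = 1 ∧ b z = i' m'
  drop : ∀ z, a z = 1 → ∃ m', b z = i' m'
  θ_eq : ∀ m, τ (ι m) = θ m
  θ'_eq : ∀ m' z, a z = 1 → b z = i' m' → ∀ γ, θ' m' * τ (γ * z) = τ γ
  orth : ∀ γ, avg (fun m => τ (γ * ι m) * τ (γ * ι m)⁻¹) = 1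

namespace TripleCtx
variable {A B C M M' : Type} [Group A] [Group B] [Group C] [Group M] [Group M']
  (X : TripleCtx A B C M M')

/-- The inclusion of `M` in `B`. -/
def i : M →* B := X.a.comp X.ι

/-- The correspondence from class functions on `B` to class functions on `C`. -/
def D (χ : B → ℂ) : C → ℂ := push X.b (fun γ => χ (X.a γ) * X.τ γ⁻¹)

/-- The correspondence from class functions on `C` to class functions on `B`. -/
def E (χ : C → ℂ) : B → ℂ := push X.a (fun γ => χ (X.b γ) * X.τ γ)

/-- `χ` is a class function of `C` lying over `θ'`. -/
def Over (χ : C → ℂ) : Prop := ∀ c m', χ (c * X.i' m') = χ c * X.θ' m'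

lemma τ_one_ne : X.τ 1 ≠ 0 := by
  rw [← map_one X.ι, X.θ_eq]
  exact X.irr.apply_one_ne_zero

lemma θ'_one : X.θ' 1 = 1 := by
  have := X.θ'_eq 1 1 (map_one _) (by simp) 1
  exact mul_right_cancel₀ X.τ_one_ne (by simpa using this)

variable [Finite A] [Finite B] [Finite C] [Finite M] [Finite M']

omit [Finite A] [Finite B] [Finite C] [Finite M'] in
lemma D_apply (χ : B → ℂ) (γ : A) :
    X.D χ (X.b γ) = avg fun m => χ (X.a γ * X.i m) * X.τ (γ * X.ι m)⁻¹ := by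
  rw [D, push_apply]
  let f : M →* X.b.ker := X.ι.codRestrict X.b.ker fun m => (X.ker_b _).mpr ⟨m, rfl⟩
  have hf : Function.Surjective f := fun ⟨k, hk⟩ => by
    obtain ⟨m, hm⟩ := (X.ker_b k).mp hk
    exact ⟨m, Subtype.ext hm⟩
  rw [← avg_comp f hf]
  simp only [map_mul]
  rfl

omit [Finite B] [Finite C] [Finite M] [Finite M'] in
lemma D_add (χ ψ : B → ℂ) : X.D (χ + ψ) = X.D χ + X.D ψ := by
  rw [D, D, D, ← push_add]
  congr 1
  ext; simp [add_mul]

omit [Finite B] [Finite C] [Finite M] [Finite M'] in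
lemma E_add (χ ψ : C → ℂ) : X.E (χ + ψ) = X.E χ + X.E ψ := by
  rw [E, E, E, ← push_add]
  congr 1
  ext; simp [add_mul]

omit [Finite B] [Finite C] [Finite M] [Finite M'] in
lemma D_isCharacter {χ : B → ℂ} (h : IsCharacter B χ) : IsCharacter C (X.D χ) :=
  ((h.comp X.a).mul X.hτ.dual).push X.b X.hb

omit [Finite B] [Finite C] [Finite M] [Finite M'] in
lemma E_isCharacter {χ : C → ℂ} (h : IsCharacter C χ) : IsCharacter B (X.E χ) :=
  ((h.comp X.b).mul X.hτ).push X.a X.ha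

omit [Finite B] [Finite C] [Finite M] [Finite M'] in
lemma E_apply {χ : C → ℂ} (h : X.Over χ) (γ : A) : X.E χ (X.a γ) = χ (X.b γ) * X.τ γ := by
  rw [E, push_apply, ← avg_const (A := X.a.ker) (χ (X.b γ) * X.τ γ)]
  congr 1
  ext ⟨z, hz⟩
  obtain ⟨m', hm⟩ := X.drop z hz
  rw [map_mul, hm, h, mul_assoc, X.θ'_eq m' z hz hm]

omit [Finite B] [Finite C] [Finite M'] in
lemma D_E {χ : C → ℂ} (h : X.Over χ) : X.D (X.E χ) = χ := by
  ext c
  obtain ⟨γ, rfl⟩ := X.hb c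
  rw [D_apply, ← mul_one (χ _), ← X.orth γ, ← avg_mul_left]
  congr 1
  ext m
  rw [i, MonoidHom.comp_apply, ← map_mul, X.E_apply h, map_mul, (X.ker_b (X.ι m)).mpr ⟨m, rfl⟩]
  simp [mul_assoc]

omit [Finite A] [Finite B] [Finite C] [Finite M'] in
lemma D_over (χ : B → ℂ) : X.Over (X.D χ) := by
  intro c m'
  obtain ⟨γ, rfl⟩ := X.hb c
  obtain ⟨z, hz, hzm⟩ := X.lift m'
  rw [← hzm, ← map_mul, D_apply, D_apply, ← avg_mul_right]
  congr 1
  ext m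
  have h1 : X.τ (γ * z * X.ι m)⁻¹ = X.θ' m' * X.τ (γ * X.ι m)⁻¹ := by
    have := X.θ'_eq m' z hz hzm (γ * z * X.ι m)⁻¹
    rw [← this]
    congr 2
    rw [← X.central z hz γ, mul_assoc]
    simp
  rw [h1, map_mul, hz, mul_one]
  ring

omit [Finite B] [Finite C] [Finite M] [Finite M'] in
lemma charInner_D (χ : B → ℂ) {ψ : C → ℂ} (h : X.Over ψ) :
    charInner (X.D χ) ψ = charInner χ (X.E ψ) := by
  rw [D, charInner_push X.b X.hb, ← charInner_comp X.a X.ha]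
  simp only [charInner, Function.comp_apply, X.E_apply h]
  congr 1
  ext γ
  ring

omit [Finite A] [Finite B] [Finite C] [Finite M'] in
lemma D_one (χ : B → ℂ) : X.D χ 1 = charInner (χ ∘ X.i) X.θ := by
  rw [← map_one X.b, D_apply, charInner]
  congr 1
  ext m
  simp [← X.θ_eq]

omit [Finite B] [Finite M'] in
lemma E_irr {χ : C → ℂ} (hχ : IsIrrChar C χ) (h : X.Over χ) : IsIrrChar B (X.E χ) := by
  have : Finite B := Finite.of_surjective _ X.ha
  rw [isIrrChar_iff, ← X.charInner_D _ h, X.D_E h]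
  exact ⟨X.E_isCharacter hχ.1, hχ.charInner_self⟩

omit [Finite A] [Finite B] [Finite C] [Finite M] [Finite M'] in
lemma central' (m' : M') (c : C) : X.i' m' * c = c * X.i' m' := by
  obtain ⟨z, hz, hm⟩ := X.lift m'
  obtain ⟨γ, rfl⟩ := X.hb c
  rw [← hm, ← map_mul, X.central z hz, map_mul]

omit [Finite A] [Finite B] [Finite M] in
lemma over_of_constituent {χ ψ : C → ℂ} (hχ : IsCharacter C χ) (h : X.Over χ)
    (hψ : IsConstituent ψ χ) : X.Over ψ := by
  obtain ⟨ξ, hξ, rfl⟩ := hψ.exists_add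
  have h1 : ψ ∘ X.i' + ξ ∘ X.i' = (ψ + ξ) 1 • X.θ' := by
    ext m'
    simpa using h 1 m'
  obtain ⟨d, hd⟩ := exists_smul_of_add_eq_smul X.irr' (hψ.1.1.comp _) (hξ.comp _) h1
  refine hψ.1.apply_mul_of_central X.i' X.central'
    ((smul_of_charInner (hψ.1.1.comp _) X.irr' hd).mpr ?_)
  rintro rfl
  have := congr_fun hd 1
  simp [hψ.1.apply_one_ne_zero] at this

lemma irr_of_D_ne {χ : B → ℂ} (hχ : IsIrrChar B χ) (h : X.D χ ≠ 0) :
    IsIrrChar C (X.D χ) ∧ X.E (X.D χ) = χ := by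
  have hc := X.D_isCharacter hχ.1
  obtain ⟨ψ, hψ⟩ := hc.exists_constituent h
  have ho := X.over_of_constituent hc (X.D_over χ) hψ
  have h1 := (isConstituent_iff hc hψ.1).mp hψ
  rw [X.charInner_D _ ho, hχ.charInner_eq (X.E_irr hψ.1 ho)] at h1
  have h2 : χ = X.E ψ := by
    by_contra h
    simp [h] at h1
  rw [h2, X.D_E ho]
  exact ⟨hψ.1, rfl⟩

omit [Finite A] [Finite B] [Finite C] [Finite M'] in
lemma D_one_ne {χ : B → ℂ} (hχ : IsCharacter B χ) :
    X.D χ 1 ≠ 0 ↔ IsConstituent X.θ (χ ∘ X.i) := by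
  rw [D_one, isConstituent_iff (hχ.comp _) X.irr]

lemma D_irr {χ : B → ℂ} (hχ : IsIrrChar B χ) (h : IsConstituent X.θ (χ ∘ X.i)) :
    IsIrrChar C (X.D χ) ∧ X.E (X.D χ) = χ :=
  X.irr_of_D_ne hχ fun h0 => (X.D_one_ne hχ.1).mpr h (by rw [h0]; rfl)

lemma E_D {χ : B → ℂ} (hχ : IsCharacter B χ)
    (h : ∀ ψ, IsConstituent ψ χ → IsConstituent X.θ (ψ ∘ X.i)) : X.E (X.D χ) = χ := by
  obtain ⟨s, hs, rfl⟩ := hχ.exists_multiset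
  replace h : ∀ ψ ∈ s, X.E (X.D ψ) = ψ := fun ψ hψ =>
    (X.D_irr (hs ψ hψ) (h ψ (isConstituent_of_mem hs hψ))).2
  clear hχ hs
  induction s using Multiset.induction_on with
  | empty =>
    have h0 : X.D 0 = 0 := by simpa using X.D_add 0 0
    have h1 : X.E 0 = 0 := by simpa using X.E_add 0 0
    rw [Multiset.sum_zero, h0, h1]
  | cons a s ih =>
    rw [Multiset.sum_cons, D_add, E_add, h a (by simp), ih fun ψ hψ => h ψ (by simp [hψ])]

lemma D_mul_eq {χ : B → ℂ} (hχ : IsCharacter B χ)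
    (h : ∀ ψ, IsConstituent ψ χ → IsConstituent X.θ (ψ ∘ X.i)) (γ : A) :
    X.D χ (X.b γ) * X.τ γ = χ (X.a γ) := by
  conv_rhs => rw [← X.E_D hχ h]
  rw [X.E_apply (X.D_over χ)]

lemma restrict_eq {χ : B → ℂ} (hχ : IsCharacter B χ)
    (h : ∀ ψ, IsConstituent ψ χ → IsConstituent X.θ (ψ ∘ X.i)) :
    χ ∘ X.i = X.D χ 1 • X.θ := by
  ext m
  have := X.D_mul_eq hχ h (X.ι m)
  rw [(X.ker_b (X.ι m)).mpr ⟨m, rfl⟩, X.θ_eq] at this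
  exact this.symm

lemma D_one_mul {χ : B → ℂ} (hχ : IsCharacter B χ)
    (h : ∀ ψ, IsConstituent ψ χ → IsConstituent X.θ (ψ ∘ X.i)) :
    X.D χ 1 * X.θ 1 = χ 1 := by
  simpa using (congr_fun (X.restrict_eq hχ h) 1).symm

omit [Finite A] [Finite B] [Finite M] in
lemma over_of_irr {χ : C → ℂ} (hχ : IsIrrChar C χ) (h : IsConstituent X.θ' (χ ∘ X.i')) :
    X.Over χ := hχ.apply_mul_of_central X.i' X.central' h

omit [Finite B] [Finite C] [Finite M'] in
lemma E_constituent {χ : C → ℂ} (hχ : IsIrrChar C χ) (h : X.Over χ) :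
    IsConstituent X.θ (X.E χ ∘ X.i) := by
  rw [← X.D_one_ne (X.E_isCharacter hχ.1), X.D_E h]
  exact hχ.apply_one_ne_zero

lemma bijOn : Set.BijOn X.D {χ | IsIrrChar B χ ∧ IsConstituent X.θ (χ ∘ X.i)}
    {χ | IsIrrChar C χ ∧ IsConstituent X.θ' (χ ∘ X.i')} := by
  refine ⟨fun χ ⟨hχ, h⟩ => ?_, fun χ ⟨hχ, h⟩ ψ ⟨hψ, h'⟩ he => ?_, fun χ ⟨hχ, h⟩ => ?_⟩
  · have h1 := (X.D_irr hχ h).1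
    refine ⟨h1, (smul_of_charInner (c := X.D χ 1) (h1.1.comp _) X.irr' ?_).mpr
      h1.apply_one_ne_zero⟩
    ext m'
    simpa using X.D_over χ 1 m'
  · rw [← (X.D_irr hχ h).2, he, (X.D_irr hψ h').2]
  · have ho := X.over_of_irr hχ h
    exact ⟨X.E χ, ⟨X.E_irr hχ ho, X.E_constituent hχ ho⟩, X.D_E ho⟩

/-- If `C` is abelian, all characters of `B` over `θ` are products of a fixed extension of `θ`
and characters of the quotient. -/
lemma exists_extension (hC : ∀ c c' : C, c * c' = c' * c) {χ₀ : B → ℂ} (h₀ : IsIrrChar B χ₀)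
    (hχ₀ : IsConstituent X.θ (χ₀ ∘ X.i)) :
    ∃ η, IsIrrChar B η ∧ IsConstituent X.θ (η ∘ X.i) ∧ η 1 = X.θ 1 ∧
      (∀ x, ∃ m, η (x * X.i m) ≠ 0) ∧
      ∀ χ, IsCharacter B χ → (∀ ψ, IsConstituent ψ χ → IsConstituent X.θ (ψ ∘ X.i)) →
        ∃ β, IsCharacter B β ∧ (∀ x m, β (x * X.i m) = β x) ∧ χ = η * β := by
  set l := X.D χ₀
  have hl : IsIrrChar C l := (X.D_irr h₀ hχ₀).1
  have ho : X.Over l := X.D_over χ₀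
  have l1 : l 1 = 1 := hl.apply_one_of_comm hC
  have lne := hl.1.ne_zero_of_apply_one_eq_one l1
  have linv : ∀ c, l c * l c⁻¹ = 1 := fun c => by
    obtain ⟨d, hd⟩ := hl.exists_apply_mul_central (hC c)
    have h1 := hd 1
    have h2 := hd c⁻¹
    rw [inv_mul_cancel, l1] at h2
    rw [one_mul, l1, one_mul] at h1
    rw [h1, h2, mul_comm]
  have hη1 : X.E l 1 = X.θ 1 := by
    rw [← map_one X.a, X.E_apply ho, map_one, l1, one_mul, ← X.θ_eq, map_one]
  refine ⟨X.E l, X.E_irr hl ho, X.E_constituent hl ho, hη1, fun x => ?_, fun χ hχ h => ?_⟩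
  · obtain ⟨γ, rfl⟩ := X.ha x
    by_contra! hx
    have h1 : ∀ m, X.τ (γ * X.ι m) = 0 := fun m => by
      have := hx m
      rw [i, MonoidHom.comp_apply, ← map_mul, X.E_apply ho] at this
      exact (mul_eq_zero.mp this).resolve_left (lne _)
    have := X.orth γ
    simp [h1, avg_zero] at this
  · have key : ∀ γ, push X.a (fun γ => X.D χ (X.b γ) * l (X.b γ)⁻¹) (X.a γ) =
        X.D χ (X.b γ) * l (X.b γ)⁻¹ := fun γ => by
      rw [push_apply, ← avg_const (A := X.a.ker) (X.D χ (X.b γ) * l (X.b γ)⁻¹)]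
      congr 1
      ext ⟨z, hz⟩
      obtain ⟨m', hm⟩ := X.drop z hz
      refine mul_right_cancel₀ (lne (X.b γ * X.i' m')) ?_
      rw [map_mul, hm, mul_assoc, mul_comm (l _), linv, X.D_over, ho, mul_one, mul_assoc,
        ← mul_assoc (l _⁻¹), mul_comm (l _⁻¹), linv, one_mul]
    refine ⟨_, ((((X.D_isCharacter hχ).comp X.b).mul (hl.1.dual.comp X.b)).push X.a X.ha),
      fun x m => ?_, ?_⟩
    · obtain ⟨γ, rfl⟩ := X.ha x
      rw [i, MonoidHom.comp_apply, ← map_mul]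
      refine (key _).trans (Eq.trans ?_ (key _).symm)
      rw [map_mul, (X.ker_b (X.ι m)).mpr ⟨m, rfl⟩, mul_one]
    · ext x
      obtain ⟨γ, rfl⟩ := X.ha x
      refine Eq.trans ?_ (congr_arg (X.E l (X.a γ) * ·) (key γ)).symm
      rw [X.E_apply ho, ← X.D_mul_eq hχ h]
      linear_combination -(X.D χ (X.b γ) * X.τ γ) * linv (X.b γ)

end TripleCtx

/-- A character whose restriction is a multiple of `θ` lies over `θ`. -/
lemma constituent_of_restrict_eq {B M : Type} [Group B] [Group M] [Finite M] (i : M →* B)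
    {θ : M → ℂ} (hθ : IsIrrChar M θ) {χ : B → ℂ} {c : ℂ} (h : χ ∘ i = c • θ)
    {ψ : B → ℂ} (hψ : IsConstituent ψ χ) : IsConstituent θ (ψ ∘ i) := by
  obtain ⟨ξ, hξ, rfl⟩ := hψ.exists_add
  obtain ⟨d, hd⟩ := exists_smul_of_add_eq_smul hθ (hψ.1.1.comp i) (hξ.comp i) h
  refine (smul_of_charInner (hψ.1.1.comp i) hθ hd).mpr ?_
  rintro rfl
  have := congr_fun hd 1
  simp [hψ.1.apply_one_ne_zero] at this

/-- A finite group `Γ` covering both `G` and `G'` and relating the triples `(G, N, θ)` and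
`(G', N', θ')`. -/
structure CentralCover (Γ G : Type) [Group Γ] [Group G] (N : Subgroup G) [N.Normal] (θ : ↥N → ℂ)
    (G' : Type) [Group G'] (N' : Subgroup G') [N'.Normal] (θ' : ↥N' → ℂ) where
  a : Γ →* G
  b : Γ →* G'
  ι : ↥N →* Γ
  τ : Γ → ℂ
  ha : Function.Surjective a
  hb : Function.Surjective b
  hτ : IsCharacter Γ τ
  irr : IsIrrChar ↥N θ
  irr' : IsIrrChar ↥N' θ'
  central : ∀ z, a z = 1 → ∀ γ, z * γ = γ * z
  a_ι : ∀ m, a (ι m) = m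
  ker_b : ∀ γ, b γ = 1 ↔ ∃ m, ι m = γ
  mem_N' : ∀ g', g' ∈ N' ↔ ∃ z, a z = 1 ∧ b z = g'
  θ_eq : ∀ m, τ (ι m) = θ m
  θ'_eq : ∀ (m' : ↥N') z, a z = 1 → b z = m' → ∀ γ, θ' m' * τ (γ * z) = τ γ
  orth : ∀ γ, avg (fun m => τ (γ * ι m) * τ (γ * ι m)⁻¹) = 1

/-- Extension by zero of a function on a subgroup. -/
def extZero {G : Type} [Group G] {H : Subgroup G} (χ : ↥H → ℂ) (g : G) : ℂ :=
  if h : g ∈ H then χ ⟨g, h⟩ else 0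

lemma extZero_of_mem {G : Type} [Group G] {H : Subgroup G} (χ : ↥H → ℂ) {g : G} (h : g ∈ H) :
    extZero χ g = χ ⟨g, h⟩ := dif_pos h

lemma extZero_of_notMem {G : Type} [Group G] {H : Subgroup G} (χ : ↥H → ℂ) {g : G} (h : g ∉ H) :
    extZero χ g = 0 := dif_neg h

namespace CentralCover

variable {Γ G : Type} [Group Γ] [Group G] {N : Subgroup G} [N.Normal] {θ : ↥N → ℂ}
    {G' : Type} [Group G'] {N' : Subgroup G'} [N'.Normal] {θ' : ↥N' → ℂ}
    (X : CentralCover Γ G N θ G' N' θ')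

lemma a_mem_iff (γ : Γ) : X.a γ ∈ N ↔ X.b γ ∈ N' := by
  constructor
  · intro h
    refine (X.mem_N' _).mpr ⟨γ * (X.ι ⟨_, h⟩)⁻¹, by simp [X.a_ι], ?_⟩
    rw [map_mul, map_inv, (X.ker_b (X.ι _)).mpr ⟨_, rfl⟩, inv_one, mul_one]
  · intro h
    obtain ⟨z, hz, hzb⟩ := (X.mem_N' _).mp h
    obtain ⟨m, hm⟩ := (X.ker_b (γ * z⁻¹)).mp (by simp [hzb])
    have := congr_arg X.a hm
    rw [X.a_ι, map_mul, map_inv, hz, inv_one, mul_one] at this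
    rw [← this]
    exact m.2

/-- The isomorphism of quotients induced by a central cover. -/
def quotEquiv : (G ⧸ N) ≃* (G' ⧸ N') :=
  (QuotientGroup.quotientKerEquivOfSurjective ((QuotientGroup.mk' N).comp X.a)
    ((QuotientGroup.mk'_surjective N).comp X.ha)).symm.trans
  ((QuotientGroup.quotientMulEquivOfEq (by
    ext γ
    simp [MonoidHom.mem_ker, X.a_mem_iff])).trans
  (QuotientGroup.quotientKerEquivOfSurjective ((QuotientGroup.mk' N').comp X.b)
    ((QuotientGroup.mk'_surjective N').comp X.hb)))

lemma quotEquiv_apply (γ : Γ) : X.quotEquiv (X.a γ : G ⧸ N) = (X.b γ : G' ⧸ N') := by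
  have : (QuotientGroup.quotientKerEquivOfSurjective ((QuotientGroup.mk' N).comp X.a)
    ((QuotientGroup.mk'_surjective N).comp X.ha)).symm (X.a γ : G ⧸ N) = (γ : Γ ⧸ _) := by
    rw [MulEquiv.symm_apply_eq]; rfl
  simp only [quotEquiv, MulEquiv.trans_apply, this]
  rfl

/-- The subgroup of `G'` corresponding to a subgroup of `G`. -/
abbrev corr (H : Subgroup G) : Subgroup G' := corrSubgroup N N' X.quotEquiv H

lemma mem_corr_of_mem {H : Subgroup G} {γ : Γ} (h : X.a γ ∈ H) : X.b γ ∈ X.corr H :=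
  ⟨_, ⟨_, h, rfl⟩, X.quotEquiv_apply γ⟩

lemma mem_corr_iff {H : Subgroup G} (hNH : N ≤ H) {γ : Γ} : X.b γ ∈ X.corr H ↔ X.a γ ∈ H := by
  refine ⟨?_, X.mem_corr_of_mem⟩
  rintro ⟨_, ⟨h, hh, rfl⟩, hq⟩
  have : X.quotEquiv (h : G ⧸ N) = X.quotEquiv (X.a γ : G ⧸ N) := by
    rw [quotEquiv_apply]; exact hq
  have h2 := QuotientGroup.eq.mp (X.quotEquiv.injective this)
  simpa using H.mul_mem hh (hNH h2)

lemma exists_of_quotEquiv_eq {g : G} {g' : G'} (h : X.quotEquiv (g : G ⧸ N) = (g' : G' ⧸ N')) :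
    ∃ δ, X.a δ = g ∧ X.b δ = g' := by
  obtain ⟨δ, rfl⟩ := X.ha g
  rw [X.quotEquiv_apply] at h
  obtain ⟨z, hz, hzb⟩ := (X.mem_N' _).mp (QuotientGroup.eq.mp h)
  exact ⟨δ * z, by simp [hz], by simp [hzb]⟩

/-- The restriction of `a` to the preimage of `H`. -/
def aRes (H : Subgroup G) : ↥(H.comap X.a) →* ↥H := X.a.subgroupComap H

/-- The restriction of `b` to the preimage of `H`. -/
def bRes (H : Subgroup G) : ↥(H.comap X.a) →* ↥(X.corr H) :=
  (X.b.comp (H.comap X.a).subtype).codRestrict _ fun γ => X.mem_corr_of_mem γ.2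

/-- The context relating `H` to the corresponding subgroup. -/
def ctx (H : Subgroup G) (hNH : N ≤ H) :
    TripleCtx ↥(H.comap X.a) ↥H ↥(X.corr H) ↥N ↥N' where
  a := X.aRes H
  b := X.bRes H
  ι := X.ι.codRestrict _ fun m => by
    rw [Subgroup.mem_comap, X.a_ι]; exact hNH m.2
  i' := Subgroup.inclusion fun x hx => by
    obtain ⟨z, hz, rfl⟩ := (X.mem_N' x).mp hx
    exact X.mem_corr_of_mem (by rw [hz]; exact one_mem _)
  τ := fun γ => X.τ γ
  θ := θ
  θ' := θ'
  ha := fun ⟨h, hh⟩ => by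
    obtain ⟨γ, rfl⟩ := X.ha h
    exact ⟨⟨γ, hh⟩, rfl⟩
  hb := fun ⟨h, hh⟩ => by
    obtain ⟨γ, rfl⟩ := X.hb h
    exact ⟨⟨γ, (X.mem_corr_iff hNH).mp hh⟩, rfl⟩
  hτ := X.hτ.comp (H.comap X.a).subtype
  irr := X.irr
  irr' := X.irr'
  central := fun z hz γ => Subtype.ext (X.central z (congr_arg Subtype.val hz) γ)
  ker_b := fun γ => by
    have h1 : X.bRes H γ = 1 ↔ X.b γ = 1 := Subtype.ext_iff
    rw [h1, X.ker_b]
    exact exists_congr fun m => by rw [Subtype.ext_iff]; rfl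
  lift := fun m' => by
    obtain ⟨z, hz, hzm⟩ := (X.mem_N' m').mp m'.2
    exact ⟨⟨z, by rw [Subgroup.mem_comap, hz]; exact one_mem _⟩, Subtype.ext hz, Subtype.ext hzm⟩
  drop := fun z hz => ⟨⟨X.b z, (X.mem_N' _).mpr ⟨z, congr_arg Subtype.val hz, rfl⟩⟩, rfl⟩
  θ_eq := X.θ_eq
  θ'_eq := fun m' z hz hzm γ =>
    X.θ'_eq m' z (congr_arg Subtype.val hz) (congr_arg Subtype.val hzm) γ
  orth := fun γ => X.orth γ

/-- The map on class functions of the character triple isomorphism. -/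
def map (H : Subgroup G) (χ : ↥H → ℂ) : ↥(X.corr H) → ℂ :=
  push (X.bRes H) (fun γ => χ (X.aRes H γ) * X.τ (γ : Γ)⁻¹)

/-- The common form of all the maps of the character triple isomorphism. -/
def transfer (F : G → ℂ) (γ : Γ) : ℂ := avg fun m : ↥N => F (X.a γ * m) * X.τ (γ * X.ι m)⁻¹

variable {X} in
lemma transfer_congr {F F' : G → ℂ} {γ : Γ} (h : ∀ m : ↥N, F (X.a γ * m) = F' (X.a γ * m)) :
    X.transfer F γ = X.transfer F' γ := by
  simp [transfer, h]

lemma map_apply [Finite N] {H : Subgroup G} (hNH : N ≤ H) (χ : ↥H → ℂ) {γ : Γ}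
    (h : X.b γ ∈ X.corr H) : X.map H χ ⟨X.b γ, h⟩ = X.transfer (extZero χ) γ := by
  have h1 := (X.mem_corr_iff hNH).mp h
  have := (X.ctx H hNH).D_apply χ ⟨γ, h1⟩
  refine this.trans ?_
  rw [transfer]
  congr 1
  ext m
  have h2 : X.a γ * m ∈ H := H.mul_mem h1 (hNH m.2)
  rw [extZero_of_mem χ h2]
  congr 2
  exact Subtype.ext (congr_arg (X.a γ * ·) (X.a_ι m))

lemma extZero_map [Finite N] {H : Subgroup G} (hNH : N ≤ H) (χ : ↥H → ℂ) (γ : Γ) :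
    extZero (X.map H χ) (X.b γ) = X.transfer (extZero χ) γ := by
  by_cases h : X.b γ ∈ X.corr H
  · rw [extZero_of_mem _ h, X.map_apply hNH]
  · rw [extZero_of_notMem _ h, transfer, ← avg_zero (A := ↥N)]
    congr 1
    ext m
    rw [extZero_of_notMem, zero_mul]
    intro h2
    exact h ((X.mem_corr_iff hNH).mpr (by simpa using H.mul_mem h2 (H.inv_mem (hNH m.2))))

lemma ι_conjNormal (δ : Γ) (m : ↥N) :
    X.ι (MulAut.conjNormal (X.a δ) m) = δ * X.ι m * δ⁻¹ := by
  obtain ⟨m₁, hm⟩ := (X.ker_b (δ * X.ι m * δ⁻¹)).mp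
    (by simp [(X.ker_b (X.ι m)).mpr ⟨m, rfl⟩])
  rw [← hm]
  congr 1
  ext
  rw [← X.a_ι m₁, hm]
  simp [X.a_ι]

lemma transfer_conj (F : G → ℂ) (γ δ : Γ) :
    X.transfer F (δ * γ * δ⁻¹) = X.transfer (fun g => F (X.a δ * g * (X.a δ)⁻¹)) γ := by
  rw [transfer, ← avg_equiv (MulAut.conjNormal (X.a δ) : ↥N ≃* ↥N).toEquiv, transfer]
  congr 1
  ext m
  simp only [MulEquiv.toEquiv_eq_coe, EquivLike.coe_coe, X.ι_conjNormal, map_mul, map_inv,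
    MulAut.conjNormal_apply]
  rw [show (δ * γ * δ⁻¹ * (δ * X.ι m * δ⁻¹))⁻¹ = δ * ((γ * X.ι m)⁻¹ * δ⁻¹) by group,
    X.hτ.map_mul_comm, inv_mul_cancel_right]
  congr 2
  group

lemma indCharLe_eq_avg [Fintype G] {K H : Subgroup G} (hKH : K ≤ H) (ψ : ↥K → ℂ) (x : ↥H) :
    indCharLe hKH ψ x = ((K.relIndex H : ℕ) : ℂ) *
      avg fun y : ↥H => extZero ψ ((y : G) * x * (y : G)⁻¹) := by
  have h1 : (Nat.card ↥K : ℂ) ≠ 0 := Nat.cast_ne_zero.mpr Nat.card_pos.ne'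
  have h2 : (Nat.card ↥H : ℂ) ≠ 0 := Nat.cast_ne_zero.mpr Nat.card_pos.ne'
  have h3 : ((K.relIndex H : ℕ) : ℂ) * Nat.card ↥K = Nat.card ↥H := by
    have := Subgroup.relIndex_mul_relIndex ⊥ K H bot_le hKH
    rw [Subgroup.relIndex_bot_left, Subgroup.relIndex_bot_left] at this
    rw [mul_comm]
    exact_mod_cast this
  rw [avg_eq, ← mul_assoc, indCharLe, ← h3]
  congr 1
  have h4 : ((K.relIndex H : ℕ) : ℂ) ≠ 0 := by
    intro h; rw [h, zero_mul] at h3; exact h2 h3.symm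
  field_simp

lemma relIndex_corr [Finite Γ] [Finite G] [Finite G'] {K H : Subgroup G} (hNK : N ≤ K)
    (hKH : K ≤ H) : (X.corr K).relIndex (X.corr H) = K.relIndex H := by
  have h1 : ∀ L : Subgroup G, N ≤ L → (X.corr L).comap X.b = L.comap X.a := fun L hL => by
    ext γ
    exact X.mem_corr_iff hL
  have h2 : X.corr H = (H.comap X.a).map X.b := by
    rw [← h1 H (hNK.trans hKH), Subgroup.map_comap_eq_self_of_surjective X.hb]
  have h3 : H = (H.comap X.a).map X.a := by
    rw [Subgroup.map_comap_eq_self_of_surjective X.ha]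
  rw [h2, ← Subgroup.relIndex_comap, h1 K hNK]
  conv_rhs => rw [h3]
  rw [← Subgroup.relIndex_comap]

lemma corr_mono {K H : Subgroup G} (h : K ≤ H) : X.corr K ≤ X.corr H :=
  Subgroup.comap_mono (Subgroup.map_mono (Subgroup.map_mono h))

lemma ctx_i (H : Subgroup G) (hNH : N ≤ H) (ψ : ↥H → ℂ) :
    ψ ∘ (X.ctx H hNH).i = resCharLe hNH ψ := by
  ext m
  exact congr_arg ψ (Subtype.ext (X.a_ι m))

/-- The character triple isomorphism of a central cover. -/
def iso [Finite Γ] [Fintype G] [Fintype G'] : CharTripleIso G N θ G' N' θ' where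
  τ := X.quotEquiv
  map := X.map
  le_corr H hNH := fun x hx => by
    obtain ⟨z, hz, rfl⟩ := (X.mem_N' x).mp hx
    exact X.mem_corr_of_mem (by rw [hz]; exact one_mem _)
  corr_mono _ _ h := X.corr_mono h
  bijOn H hNH := by
    have h := (X.ctx H hNH).bijOn
    simp only [X.ctx_i] at h
    exact h
  map_add H hNH χ ψ _ _ := (X.ctx H hNH).D_add χ ψ
  deg_ratio H hNH χ hχ := by
    have h1 := (X.ctx H hNH).D_one_mul hχ.1 fun ψ hψ => by
      rw [X.ctx_i]
      exact hχ.2 ψ hψ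
    have h2 : θ' 1 = 1 := (X.ctx H hNH).θ'_one
    rw [h2, mul_one]
    exact h1
  map_res K H hNK hKH χ _ := by
    ext ⟨x, hx⟩
    obtain ⟨γ, rfl⟩ := X.hb x
    rw [X.map_apply hNK]
    refine Eq.trans ?_ (X.map_apply (hNK.trans hKH) χ _).symm
    refine transfer_congr fun m => ?_
    have h1 : X.a γ * m ∈ K := K.mul_mem ((X.mem_corr_iff hNK).mp hx) (hNK m.2)
    rw [extZero_of_mem _ h1, extZero_of_mem _ (hKH h1)]
    rfl
  map_ind K H hNK hKH ψ _ := by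
    have hNH := hNK.trans hKH
    ext ⟨x, hx⟩
    obtain ⟨γ, rfl⟩ := X.hb x
    have hγ := (X.mem_corr_iff hNH).mp hx
    rw [X.map_apply hNH]
    refine Eq.trans ?_ (indCharLe_eq_avg (X.corr_mono hKH) (X.map K ψ) ⟨X.b γ, hx⟩).symm
    rw [X.relIndex_corr hNK hKH,
      ← avg_comp (X.bRes H) (X.ctx H hNH).hb]
    have h1 : ∀ δ : ↥(H.comap X.a),
        extZero (X.map K ψ) ((X.bRes H δ : G') * X.b γ * (X.bRes H δ : G')⁻¹) =
          avg fun m : ↥N => extZero ψ (X.a δ * (X.a γ * m) * (X.a δ)⁻¹) * X.τ (γ * X.ι m)⁻¹ := by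
      intro δ
      have := X.extZero_map hNK ψ (δ * γ * (δ : Γ)⁻¹)
      rw [X.transfer_conj, map_mul, map_mul, map_inv] at this
      exact this
    simp only [h1]
    rw [avg_comm, ← avg_mul_left, transfer]
    congr 1
    ext m
    have h2 : X.a γ * m ∈ H := H.mul_mem hγ (hNH m.2)
    rw [extZero_of_mem _ h2, indCharLe_eq_avg, avg_mul_right, ← mul_assoc,
      ← avg_comp (X.aRes H) (X.ctx H hNH).ha]
    rfl
  map_mul H hNH χ β hχ _ hβ β' hβ' := by
    ext ⟨x, hx⟩
    obtain ⟨γ, rfl⟩ := X.hb x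
    have hγ := (X.mem_corr_iff hNH).mp hx
    rw [Pi.mul_apply, X.map_apply hNH, X.map_apply hNH,
      hβ' ⟨X.a γ, hγ⟩ ⟨X.b γ, hx⟩ (X.quotEquiv_apply γ), transfer, transfer, ← avg_mul_right]
    congr 1
    ext m
    have h2 : X.a γ * m ∈ H := H.mul_mem hγ (hNH m.2)
    have h3 : β ⟨X.a γ * m, h2⟩ = β ⟨X.a γ, hγ⟩ := hβ ⟨X.a γ, hγ⟩ m
    rw [extZero_of_mem _ h2, extZero_of_mem _ h2, Pi.mul_apply, h3]
    ring
  map_conj H hNH χ _ g g' hg x hx := by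
    obtain ⟨δ, rfl, rfl⟩ := X.exists_of_quotEquiv_eq hg
    obtain ⟨x, hx'⟩ := x
    obtain ⟨γ, rfl⟩ := X.hb x
    have hN : N ≤ conjSubgroup (X.a δ) H := fun n hn =>
      ⟨(X.a δ)⁻¹ * n * X.a δ, hNH (by simpa using Subgroup.Normal.conj_mem ‹_› n hn (X.a δ)⁻¹),
        by simp [mul_assoc]⟩
    have h1 : (X.b δ)⁻¹ * X.b γ * X.b δ = X.b (δ⁻¹ * γ * δ) := by simp
    rw [X.map_apply hN]
    simp only [h1]
    rw [X.map_apply hNH]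
    have h2 := X.transfer_conj (extZero χ) γ δ⁻¹
    rw [inv_inv] at h2
    rw [h2]
    refine transfer_congr fun m => ?_
    rw [map_inv, inv_inv]
    have h3 : ∀ u, u ∈ conjSubgroup (X.a δ) H ↔ (X.a δ)⁻¹ * u * X.a δ ∈ H := fun u =>
      ⟨fun h => conjSubgroup_mem ⟨u, h⟩, fun h => ⟨_, h, by simp [mul_assoc]⟩⟩
    by_cases h4 : X.a γ * m ∈ conjSubgroup (X.a δ) H
    · rw [extZero_of_mem _ h4, extZero_of_mem _ ((h3 _).mp h4)]
      rfl
    · rw [extZero_of_notMem _ h4, extZero_of_notMem _ (fun h => h4 ((h3 _).mpr h))]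

end CentralCover

lemma Representation.IsIrreducible.finrank_ne_zero {M V : Type} [Group M] [AddCommGroup V]
    [Module ℂ V] [FiniteDimensional ℂ V] (ρ : Representation ℂ M V) [ρ.IsIrreducible] :
    (Module.finrank ℂ V : ℂ) ≠ 0 := by
  intro h
  have h1 : Module.finrank ℂ V = 0 := by exact_mod_cast h
  have := Module.finrank_zero_iff.mp h1
  have h2 := Representation.IsIrreducible.finrank_intertwiningMap_self (k := ℂ) (ρ := ρ)
  have : Subsingleton (Representation.IntertwiningMap ρ ρ) :=
    ⟨fun f g => Representation.IntertwiningMap.ext (by ext x; exact Subsingleton.elim _ _)⟩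
  rw [Module.finrank_zero_of_subsingleton] at h2
  exact zero_ne_one h2

section Irreducible
variable {M V : Type} [Group M] [AddCommGroup V] [Module ℂ V] [FiniteDimensional ℂ V]
    (ρ : Representation ℂ M V) [ρ.IsIrreducible]

lemma Representation.IsIrreducible.eq_trace_smul_one {f : Module.End ℂ V}
    (hf : ∀ g, f * ρ g = ρ g * f) :
    f = (LinearMap.trace ℂ V f / Module.finrank ℂ V) • 1 := by
  obtain ⟨c, rfl⟩ := exists_eq_smul_one ρ f hf
  rw [map_smul, LinearMap.trace_one, smul_eq_mul, mul_div_cancel_right₀ _ (finrank_ne_zero ρ)]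

lemma Representation.IsIrreducible.sum_conj [Fintype M] (B : Module.End ℂ V) :
    ∑ x, ρ x * B * ρ x⁻¹ =
      (Fintype.card M * LinearMap.trace ℂ V B / Module.finrank ℂ V) • (1 : Module.End ℂ V) := by
  rw [eq_trace_smul_one ρ (f := ∑ x, ρ x * B * ρ x⁻¹)]
  · congr 2
    rw [map_sum]
    have : ∀ x, LinearMap.trace ℂ V (ρ x * B * ρ x⁻¹) = LinearMap.trace ℂ V B := fun x => by
      rw [LinearMap.trace_mul_comm, ← mul_assoc, ← map_mul, inv_mul_cancel, map_one, one_mul]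
    simp [this]
  · intro g
    rw [Finset.sum_mul, Finset.mul_sum,
      ← Equiv.sum_comp (Equiv.mulLeft g) fun x => ρ x * B * ρ x⁻¹ * ρ g]
    refine Finset.sum_congr rfl fun x _ => ?_
    simp only [Equiv.coe_mulLeft, mul_inv_rev, map_mul, mul_assoc]
    rw [← map_mul ρ g⁻¹ g, inv_mul_cancel, map_one, mul_one]

lemma Representation.IsIrreducible.sum_commutator [Fintype M] :
    ∑ h, ∑ g, ρ (g * h * g⁻¹ * h⁻¹) =
      ((Fintype.card M : ℂ) / Module.finrank ℂ V) ^ 2 • (1 : Module.End ℂ V) := by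
  have h0 := finrank_ne_zero ρ
  simp only [map_mul, ← Finset.sum_mul, sum_conj]
  rw [eq_trace_smul_one ρ
    (f := ∑ h, (Fintype.card M * LinearMap.trace ℂ V (ρ h) / Module.finrank ℂ V) •
      (1 : Module.End ℂ V) * ρ h⁻¹)]
  · congr 1
    have : Invertible (Nat.card M : ℂ) := invertibleOfNonzero (Nat.cast_ne_zero.mpr Nat.card_pos.ne')
    have h1 := Representation.char_orthonormal ρ ρ
    rw [if_pos ⟨Representation.Equiv.refl ρ⟩, inv_mul_eq_one₀ (by simp)] at h1
    simp only [Representation.character] at h1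
    have h2 : ∀ h, LinearMap.trace ℂ V
        ((Fintype.card M * LinearMap.trace ℂ V (ρ h) / Module.finrank ℂ V) • 1 * ρ h⁻¹) =
        Fintype.card M / Module.finrank ℂ V *
          (LinearMap.trace ℂ V (ρ h) * LinearMap.trace ℂ V (ρ h⁻¹)) := fun h => by
      rw [smul_mul_assoc, one_mul, map_smul, smul_eq_mul]
      ring
    rw [map_sum]
    simp only [h2]
    rw [← Finset.mul_sum, ← h1, Nat.card_eq_fintype_card]
    ring
  · intro g
    rw [Finset.sum_mul, Finset.mul_sum, ← (MulAut.conj g).toEquiv.sum_comp]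
    refine Finset.sum_congr rfl fun x _ => ?_
    have h1 : LinearMap.trace ℂ V (ρ (g * x * g⁻¹)) = LinearMap.trace ℂ V (ρ x) := by
      exact ρ.char_conj x g
    simp only [MulEquiv.toEquiv_eq_coe, EquivLike.coe_coe, MulAut.conj_apply, h1, mul_inv_rev,
      inv_inv, smul_mul_assoc, one_mul, mul_smul_comm, ← map_mul]
    simp [mul_assoc]

end Irreducible

lemma Representation.IsIrreducible.finrank_dvd_card {M V : Type} [Group M] [Fintype M]
    [AddCommGroup V] [Module ℂ V] [FiniteDimensional ℂ V] (ρ : Representation ℂ M V)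
    [ρ.IsIrreducible] : Module.finrank ℂ V ∣ Fintype.card M := by
  have h0 := finrank_ne_zero ρ
  have h0' : Module.finrank ℂ V ≠ 0 := fun h => h0 (by rw [h, Nat.cast_zero])
  have : Nontrivial V := Module.nontrivial_of_finrank_pos (R := ℂ) (Nat.pos_of_ne_zero h0')
  have h1 : ∀ a : MonoidAlgebra ℤ M, IsIntegral ℤ (MonoidAlgebra.lift ℤ (Module.End ℂ V) M ρ a) :=
    fun a => (Algebra.IsIntegral.isIntegral (R := ℤ) a).map _
  have h2 := h1 (∑ h, ∑ g, MonoidAlgebra.of ℤ M (g * h * g⁻¹ * h⁻¹))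
  simp only [map_sum, MonoidAlgebra.lift_of] at h2
  rw [sum_commutator, ← Algebra.algebraMap_eq_smul_one,
    isIntegral_algebraMap_iff (FaithfulSMul.algebraMap_injective ℂ (Module.End ℂ V))] at h2
  have h3 : ((Fintype.card M : ℂ) / Module.finrank ℂ V) ^ 2 =
      algebraMap ℚ ℂ (((Fintype.card M : ℚ) / Module.finrank ℂ V) ^ 2) := by simp
  rw [h3, isIntegral_algebraMap_iff (algebraMap ℚ ℂ).injective] at h2
  obtain ⟨y, hy⟩ := IsIntegrallyClosed.isIntegral_iff.mp h2
  have h4 : (y : ℚ) * Module.finrank ℂ V ^ 2 = Fintype.card M ^ 2 := by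
    have : (y : ℚ) = _ := hy
    rw [this]
    have : (Module.finrank ℂ V : ℚ) ≠ 0 := Nat.cast_ne_zero.mpr h0'
    field_simp
  have h5 : y * (Module.finrank ℂ V : ℤ) ^ 2 = (Fintype.card M : ℤ) ^ 2 := by exact_mod_cast h4
  have h6 : (Module.finrank ℂ V : ℤ) ∣ Fintype.card M :=
    (Int.pow_dvd_pow_iff two_ne_zero).mp ⟨y, by rw [← h5, mul_comm]⟩
  exact_mod_cast h6

lemma exists_centralCover_of_extension {Γ G : Type} [Group Γ] [Group G] {N : Subgroup G}
    [N.Normal] {θ : ↥N → ℂ} (a : Γ →* G) (ι : ↥N →* Γ) (τ : Γ → ℂ) (c : a.ker →* ℂ)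
    (ha : Function.Surjective a) (hτ : IsCharacter Γ τ) (irr : IsIrrChar ↥N θ)
    (central : ∀ z, a z = 1 → ∀ γ, z * γ = γ * z) (a_ι : ∀ m, a (ι m) = m)
    (hc : ∀ (z : a.ker) γ, τ (γ * z) = c z * τ γ)
    (hι : ι.range.Normal)
    (θ_eq : ∀ m, τ (ι m) = θ m)
    (orth : ∀ γ, avg (fun m => τ (γ * ι m) * τ (γ * ι m)⁻¹) = 1) :
    ∃ (θ' : ↥(a.ker.map (QuotientGroup.mk' ι.range)) → ℂ)
      (_ : (a.ker.map (QuotientGroup.mk' ι.range)).Normal),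
      Nonempty (CentralCover Γ G N θ (Γ ⧸ ι.range) (a.ker.map (QuotientGroup.mk' ι.range)) θ') := by
  let e : a.ker ≃* ↥(a.ker.map (QuotientGroup.mk' ι.range)) :=
    MulEquiv.ofBijective ((QuotientGroup.mk' ι.range).subgroupMap a.ker) ⟨by
      rw [injective_iff_map_eq_one]
      rintro ⟨z, hz⟩ h
      have h1 : (z : Γ ⧸ ι.range) = 1 := congr_arg Subtype.val h
      obtain ⟨m, rfl⟩ := (QuotientGroup.eq_one_iff z).mp h1
      have h2 : (m : G) = 1 := by rw [← a_ι]; exact hz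
      have h3 : m = 1 := Subtype.ext h2
      simp [h3], (QuotientGroup.mk' ι.range).subgroupMap_surjective a.ker⟩
  have hN : (a.ker.map (QuotientGroup.mk' ι.range)).Normal :=
    Subgroup.Normal.map inferInstance _ (QuotientGroup.mk'_surjective _)
  refine ⟨fun x => c (e.symm x⁻¹), hN, ⟨{
    a := a
    b := QuotientGroup.mk' ι.range
    ι := ι
    τ := τ
    ha := ha
    hb := QuotientGroup.mk'_surjective _
    hτ := hτ
    irr := irr
    irr' := isIrrChar_of_apply_one_eq_one
      (isIrrChar_of_monoidHom (c.comp e.symm.toMonoidHom)).1.dual (by simp)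
    central := central
    a_ι := a_ι
    ker_b := fun γ => QuotientGroup.eq_one_iff γ
    mem_N' := fun g' => Iff.rfl
    θ_eq := θ_eq
    θ'_eq := fun m' z hz hzm γ => ?_
    orth := orth }⟩⟩
  have h1 : m' = e ⟨z, hz⟩ := Subtype.ext hzm.symm
  rw [hc ⟨z, hz⟩, h1, ← map_inv, MulEquiv.symm_apply_apply, ← mul_assoc, ← map_mul,
    inv_mul_cancel, map_one, one_mul]

section CoverGroup
variable {G V : Type} [Group G] {N : Subgroup G} [N.Normal] [AddCommGroup V] [Module ℂ V]
  (ρ : Representation ℂ ↥N V)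

/-- The group of pairs `(g, A)`, where the operator `A` implements the conjugation by `g` on `ρ`
and has determinant a root of unity of order dividing `|N|`. -/
def coverGroup : Subgroup (G × (Module.End ℂ V)ˣ) where
  carrier := {p | (∀ x : ↥N, (p.2 : Module.End ℂ V) * ρ x = ρ (MulAut.conjNormal p.1 x) * p.2) ∧
    LinearMap.det (p.2 : Module.End ℂ V) ^ Nat.card ↥N = 1}
  one_mem' := by simp
  mul_mem' := by
    rintro ⟨g, A⟩ ⟨h, B⟩ ⟨hA, hA'⟩ ⟨hB, hB'⟩
    refine ⟨fun x => ?_, ?_⟩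
    · simp only at hA hB
      simp only [Prod.mk_mul_mk, Units.val_mul, map_mul, MulAut.mul_apply]
      rw [mul_assoc, hB, ← mul_assoc, hA, mul_assoc]
    · simp only at hA' hB'
      simp only [Prod.mk_mul_mk, Units.val_mul, map_mul, mul_pow, hA', hB', mul_one]
  inv_mem' := by
    rintro ⟨g, A⟩ ⟨hA, hA'⟩
    refine ⟨fun x => ?_, ?_⟩
    · simp only at hA
      simp only [Prod.inv_mk]
      rw [Units.inv_mul_eq_iff_eq_mul, ← mul_assoc, hA, mul_assoc, Units.mul_inv, mul_one,
        ← MulAut.mul_apply, ← map_mul, mul_inv_cancel, map_one, MulAut.one_apply]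
    · simp only at hA'
      have : LinearMap.det (A : Module.End ℂ V) * LinearMap.det ((A⁻¹ : _ˣ) : Module.End ℂ V) = 1 := by
        rw [← map_mul, Units.mul_inv, map_one]
      simp only [Prod.inv_mk]
      calc _ = (LinearMap.det (A : Module.End ℂ V) *
            LinearMap.det ((A⁻¹ : _ˣ) : Module.End ℂ V)) ^ Nat.card ↥N := by
              rw [mul_pow, hA', one_mul]
        _ = 1 := by rw [this, one_pow]

/-- The projection of `coverGroup ρ` to `G`. -/
def coverFst : coverGroup ρ →* G := (MonoidHom.fst _ _).comp (coverGroup ρ).subtype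

/-- The tautological representation of `coverGroup ρ`. -/
def coverRep : Representation ℂ (coverGroup ρ) V :=
  (Units.coeHom _).comp ((MonoidHom.snd _ _).comp (coverGroup ρ).subtype)

/-- The embedding of `N` in `coverGroup ρ`. -/
def coverIncl [Finite N] : ↥N →* coverGroup ρ :=
  (N.subtype.prod ρ.asGroupHom).codRestrict _ fun x => by
    refine ⟨fun y => ?_, ?_⟩
    · simp only [MonoidHom.prod_apply, Representation.asGroupHom_apply, ← map_mul]
      congr 1
      ext
      simp
    · simp only [MonoidHom.prod_apply, Representation.asGroupHom_apply]
      rw [← map_pow, ← map_pow, pow_card_eq_one', map_one, map_one]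

lemma coverFst_incl [Finite N] (m : ↥N) : coverFst ρ (coverIncl ρ m) = m := rfl

lemma coverRep_incl [Finite N] (m : ↥N) : coverRep ρ (coverIncl ρ m) = ρ m := rfl

lemma coverGroup_ext {γ δ : coverGroup ρ} (h : coverFst ρ γ = coverFst ρ δ)
    (h' : coverRep ρ γ = coverRep ρ δ) : γ = δ :=
  Subtype.ext (Prod.ext h (Units.ext h'))

lemma coverRep_mul (γ : coverGroup ρ) (x : ↥N) :
    coverRep ρ γ * ρ x = ρ (MulAut.conjNormal (coverFst ρ γ) x) * coverRep ρ γ := γ.2.1 x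

lemma coverIncl_conj [Finite N] (γ : coverGroup ρ) (x : ↥N) :
    γ * coverIncl ρ x * γ⁻¹ = coverIncl ρ (MulAut.conjNormal (coverFst ρ γ) x) := by
  rw [mul_inv_eq_iff_eq_mul]
  refine coverGroup_ext ρ ?_ ?_
  · simp [coverFst_incl]
  · rw [map_mul, map_mul, coverRep_incl, coverRep_incl, coverRep_mul]

lemma coverIncl_range_normal [Finite N] : (coverIncl ρ).range.Normal := by
  refine ⟨?_⟩
  rintro _ ⟨x, rfl⟩ γ
  exact ⟨_, (coverIncl_conj ρ γ x).symm⟩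

variable [FiniteDimensional ℂ V] [ρ.IsIrreducible]

lemma coverRep_of_ker {γ : coverGroup ρ} (h : coverFst ρ γ = 1) :
    coverRep ρ γ = (LinearMap.trace ℂ V (coverRep ρ γ) / Module.finrank ℂ V) • 1 := by
  refine Representation.IsIrreducible.eq_trace_smul_one ρ fun x => ?_
  rw [coverRep_mul, h, map_one, MulAut.one_apply]

/-- The scalar by which an element of the kernel acts. -/
def coverScalar : (coverFst ρ).ker →* ℂ where
  toFun z := LinearMap.trace ℂ V (coverRep ρ z) / Module.finrank ℂ V
  map_one' := by
    simp [Representation.IsIrreducible.finrank_ne_zero ρ]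
  map_mul' z w := by
    rw [Subgroup.coe_mul, map_mul, coverRep_of_ker ρ z.2, coverRep_of_ker ρ w.2]
    have := Representation.IsIrreducible.finrank_ne_zero ρ
    simp [this]
    ring

lemma coverRep_eq_scalar (z : (coverFst ρ).ker) : coverRep ρ z = coverScalar ρ z • 1 :=
  coverRep_of_ker ρ z.2

lemma coverScalar_injective : Function.Injective (coverScalar ρ) := by
  intro z w h
  refine Subtype.ext (coverGroup_ext ρ (Eq.trans z.2 (Eq.symm w.2)) ?_)
  rw [coverRep_eq_scalar, coverRep_eq_scalar, h]

lemma cover_central {z : coverGroup ρ} (hz : coverFst ρ z = 1) (γ : coverGroup ρ) :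
    z * γ = γ * z := by
  refine coverGroup_ext ρ (by simp [hz]) ?_
  rw [map_mul, map_mul, coverRep_of_ker ρ hz]
  simp

lemma coverScalar_pow (z : (coverFst ρ).ker) :
    coverScalar ρ z ^ (Module.finrank ℂ V * Nat.card ↥N) = 1 := by
  have h1 : LinearMap.det (coverRep ρ z) ^ Nat.card ↥N = 1 := (z : coverGroup ρ).2.2
  rw [coverRep_eq_scalar, LinearMap.det_smul, map_one, mul_one, ← pow_mul] at h1
  exact h1

lemma coverFst_ker_pow (z : (coverFst ρ).ker) : z ^ (Module.finrank ℂ V * Nat.card ↥N) = 1 :=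
  coverScalar_injective ρ (by rw [map_pow, coverScalar_pow, map_one])

lemma coverFst_surjective [Finite N] (inv : InvariantUnder N ρ.character ⊤) :
    Function.Surjective (coverFst ρ) := by
  intro g
  have := Fintype.ofFinite N
  have h0 := Representation.IsIrreducible.finrank_ne_zero ρ
  let ρ' : Representation ℂ ↥N V := MonoidHom.comp ρ (MulAut.conjNormal g⁻¹ : ↥N ≃* ↥N).toMonoidHom
  have hchar : ∀ x, ρ'.character x = ρ.character x := fun x =>
    inv g⁻¹ trivial x (MulAut.conjNormal g⁻¹ x).2
  have : Invertible (Nat.card ↥N : ℂ) := invertibleOfNonzero (Nat.cast_ne_zero.mpr Nat.card_pos.ne')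
  have h1 := Representation.card_inv_mul_sum_char_mul_char_eq_finrank ρ' ρ
  have h2 := Representation.card_inv_mul_sum_char_mul_char_eq_finrank ρ ρ
  simp only [hchar] at h1
  rw [h1, Representation.IsIrreducible.finrank_intertwiningMap_self] at h2
  have h3 : Module.finrank ℂ (Representation.IntertwiningMap ρ' ρ) = 1 := by exact_mod_cast h2
  have : Nontrivial (Representation.IntertwiningMap ρ' ρ) :=
    Module.nontrivial_of_finrank_pos (R := ℂ) (by omega)
  obtain ⟨f, hf⟩ := exists_ne (0 : Representation.IntertwiningMap ρ' ρ)
  have hsurj := (Representation.IsIrreducible.surjective_or_eq_zero f).resolve_right hf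
  obtain ⟨T, hT⟩ := (LinearMap.isUnit_iff_range_eq_top (f.toLinearMap : Module.End ℂ V)).mpr
    (LinearMap.range_eq_top.mpr hsurj)
  have hdet : LinearMap.det (T : Module.End ℂ V) ≠ 0 :=
    (T.isUnit.map (LinearMap.det : Module.End ℂ V →* ℂ)).ne_zero
  obtain ⟨c, hc⟩ := IsAlgClosed.exists_pow_nat_eq (LinearMap.det (T : Module.End ℂ V))⁻¹
    (n := Module.finrank ℂ V) (Nat.pos_of_ne_zero fun h => h0 (by rw [h, Nat.cast_zero]))
  have hc0 : c ≠ 0 := by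
    rintro rfl
    rw [zero_pow (fun h => h0 (by rw [h, Nat.cast_zero]))] at hc
    exact inv_ne_zero hdet hc.symm
  let A : (Module.End ℂ V)ˣ := Units.map (algebraMap ℂ (Module.End ℂ V)).toMonoidHom (Units.mk0 c hc0) * T
  have hA : (A : Module.End ℂ V) = c • (T : Module.End ℂ V) := by
    simp [A, Algebra.algebraMap_eq_smul_one]
  refine ⟨⟨(g, A), fun x => ?_, ?_⟩, rfl⟩
  · simp only
    rw [hA, smul_mul_assoc, mul_smul_comm, hT]
    congr 1
    have := f.isIntertwining' (MulAut.conjNormal g x)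
    have h4 : ρ' (MulAut.conjNormal g x) = ρ x := by
      change ρ (MulAut.conjNormal g⁻¹ (MulAut.conjNormal g x)) = ρ x
      rw [← MulAut.mul_apply, ← map_mul, inv_mul_cancel, map_one, MulAut.one_apply]
    rw [h4] at this
    exact this
  · simp only
    rw [hA, LinearMap.det_smul, hc, inv_mul_cancel₀ hdet, one_pow]

lemma coverGroup_finite [Finite G] (inv : InvariantUnder N ρ.character ⊤) :
    Finite (coverGroup ρ) := by
  have h0 : Module.finrank ℂ V * Nat.card ↥N ≠ 0 :=
    mul_ne_zero (fun h => Representation.IsIrreducible.finrank_ne_zero ρ (by rw [h, Nat.cast_zero]))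
      Nat.card_pos.ne'
  have : NeZero (Module.finrank ℂ V * Nat.card ↥N) := ⟨h0⟩
  have : Finite (coverFst ρ).ker :=
    Finite.of_injective (fun z => rootsOfUnity.mkOfPowEq (coverScalar ρ z) (coverScalar_pow ρ z))
      fun z w h => coverScalar_injective ρ (by
        have := congr_arg (fun u : rootsOfUnity _ ℂ => ((u : ℂˣ) : ℂ)) h
        simpa using this)
  exact Finite.of_equiv _ (prodKerEquiv (coverFst ρ) (coverFst_surjective ρ inv))

lemma cover_orth [Finite N] (γ : coverGroup ρ) :
    avg (fun m => (coverRep ρ).character (γ * coverIncl ρ m) *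
      (coverRep ρ).character (γ * coverIncl ρ m)⁻¹) = 1 := by
  have := Fintype.ofFinite N
  have h0 := Representation.IsIrreducible.finrank_ne_zero ρ
  have h1 : ∀ m, (coverRep ρ).character (γ * coverIncl ρ m) *
      (coverRep ρ).character (γ * coverIncl ρ m)⁻¹ = LinearMap.trace ℂ (V →ₗ[ℂ] V)
        ((coverRep ρ).linHom (coverRep ρ) (γ * coverIncl ρ m)) := fun m => by
    rw [mul_comm, ← Representation.char_linHom]
    rfl
  simp only [h1]
  rw [avg_eq, ← map_sum]
  have h2 : ∑ m, (coverRep ρ).linHom (coverRep ρ) (γ * coverIncl ρ m) =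
      ((Fintype.card N : ℂ) / Module.finrank ℂ V) •
        (LinearMap.trace ℂ V).smulRight (1 : Module.End ℂ V) := by
    ext1 B
    have h3 : ∀ m, (coverRep ρ).linHom (coverRep ρ) (γ * coverIncl ρ m) B =
        coverRep ρ γ * (ρ m * B * ρ m⁻¹) * coverRep ρ γ⁻¹ := fun m => by
      rw [Representation.linHom_apply, mul_inv_rev, map_mul, map_mul, ← map_inv, coverRep_incl,
        coverRep_incl]
      rfl
    rw [LinearMap.sum_apply]
    simp only [h3]
    rw [← Finset.sum_mul, ← Finset.mul_sum, Representation.IsIrreducible.sum_conj]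
    rw [mul_smul_comm, smul_mul_assoc, mul_one, ← map_mul, mul_inv_cancel, map_one]
    simp only [LinearMap.smul_apply, LinearMap.smulRight_apply, smul_smul]
    congr 1
    ring
  rw [h2, map_smul, LinearMap.trace_smulRight, LinearMap.trace_one, Nat.card_eq_fintype_card]
  have h4 : (Fintype.card N : ℂ) ≠ 0 := Nat.cast_ne_zero.mpr Fintype.card_ne_zero
  rw [smul_eq_mul]
  field_simp

end CoverGroup

theorem exists_centralCover {G : Type} [Group G] [Finite G] {N : Subgroup G} [N.Normal]
    {θ : ↥N → ℂ} (irr : IsIrrChar ↥N θ) (inv : InvariantUnder N θ ⊤) :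
    ∃ (Γ : Type) (_ : Group Γ) (_ : Finite Γ) (G' : Type) (_ : Group G') (_ : Finite G')
      (N' : Subgroup G') (_ : N'.Normal) (θ' : ↥N' → ℂ),
      N' ≤ Subgroup.center G' ∧ (∀ q : ℕ, q.Prime → q ∣ Nat.card ↥N' → q ∣ Nat.card ↥N) ∧
      Nonempty (CentralCover Γ G N θ G' N' θ') := by
  obtain ⟨V, _, _, _, ρ, _, rfl⟩ := irr.exists_irrep
  have := Fintype.ofFinite N
  have hfin := coverGroup_finite ρ inv
  have hn := coverIncl_range_normal ρ
  obtain ⟨θ', hN', hX⟩ := exists_centralCover_of_extension (coverFst ρ) (coverIncl ρ)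
    (coverRep ρ).character (coverScalar ρ) (coverFst_surjective ρ inv) (isCharacter_character _)
    irr (fun z hz γ => cover_central ρ hz γ) (coverFst_incl ρ)
    (fun z γ => by
      rw [Representation.character, map_mul, coverRep_eq_scalar, mul_smul_comm, mul_one, map_smul]
      rfl)
    hn (fun m => rfl) (cover_orth ρ)
  refine ⟨coverGroup ρ, inferInstance, hfin, coverGroup ρ ⧸ (coverIncl ρ).range, inferInstance,
    inferInstance, (coverFst ρ).ker.map (QuotientGroup.mk' (coverIncl ρ).range), hN', θ', ?_, ?_,
    hX⟩
  · rintro _ ⟨z, hz, rfl⟩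
    rw [Subgroup.mem_center_iff]
    intro g
    obtain ⟨γ, rfl⟩ := QuotientGroup.mk'_surjective _ g
    rw [← map_mul, ← map_mul, cover_central ρ hz]
  · intro q hq hdvd
    have := Fact.mk hq
    obtain ⟨⟨_, z, hz, rfl⟩, hx⟩ := exists_prime_orderOf_dvd_card' q hdvd
    have h1 : q ∣ Module.finrank ℂ V * Nat.card ↥N := by
      rw [← hx]
      refine orderOf_dvd_of_pow_eq_one (Subtype.ext ?_)
      have h2 : z ^ (Module.finrank ℂ V * Nat.card ↥N) = 1 :=
        congr_arg Subtype.val (coverFst_ker_pow ρ ⟨z, hz⟩)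
      simp only [Subgroup.coe_pow, ← map_pow, h2, map_one, Subgroup.coe_one]
    rcases hq.dvd_mul.mp h1 with h | h
    · rw [Nat.card_eq_fintype_card]
      exact h.trans (Representation.IsIrreducible.finrank_dvd_card ρ)
    · exact h

lemma IsIrrChar.comp_equiv {A B : Type} [Group A] [Group B] [Finite A] (e : A ≃* B) {χ : B → ℂ}
    (hχ : IsIrrChar B χ) : IsIrrChar A (χ ∘ e) := by
  have := Finite.of_equiv A e.toEquiv
  rw [isIrrChar_iff] at hχ ⊢
  exact ⟨hχ.1.comp e.toMonoidHom, by
    rw [← hχ.2]; exact charInner_comp e.toMonoidHom e.surjective χ χ⟩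

/-- `χ` is a character of `G` whose restriction to `N` is a multiple of `θ`. -/
def IsCharAbove {G : Type} [Group G] {N : Subgroup G} (θ : ↥N → ℂ) (χ : G → ℂ) : Prop :=
  IsCharacter G χ ∧ ∃ c : ℂ, resChar N χ = c • θ

section Above
variable {G : Type} [Group G] [Finite G] {N : Subgroup G} {θ : ↥N → ℂ} {χ ψ : G → ℂ}

lemma IsCharAbove.isConstituent (hθ : IsIrrChar ↥N θ) (h : IsCharAbove θ χ) (h0 : χ 1 ≠ 0) :
    IsConstituent θ (resChar N χ) := by
  obtain ⟨c, hc⟩ := h.2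
  refine (smul_of_charInner (h.1.comp N.subtype) hθ hc).mpr ?_
  rintro rfl
  have := congr_fun hc 1
  rw [zero_smul] at this
  exact h0 this

omit [Finite G] in
lemma IsCharAbove.add (h : IsCharAbove θ χ) (h' : IsCharAbove θ ψ) : IsCharAbove θ (χ + ψ) := by
  obtain ⟨c, hc⟩ := h.2
  obtain ⟨d, hd⟩ := h'.2
  exact ⟨h.1.add h'.1, c + d, by rw [add_smul, ← hc, ← hd]; rfl⟩

omit [Finite G] in
lemma IsCharAbove.zero : IsCharAbove θ (0 : G → ℂ) :=
  ⟨.zero, 0, by rw [zero_smul]; rfl⟩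

lemma IsCharAbove.of_add (hθ : IsIrrChar ↥N θ) (hχ : IsCharacter G χ) (hψ : IsCharacter G ψ)
    {c : ℂ} (h : resChar N (χ + ψ) = c • θ) : IsCharAbove θ χ :=
  ⟨hχ, exists_smul_of_add_eq_smul hθ (hχ.comp N.subtype) (hψ.comp N.subtype) h⟩

/-- Induction principle: characters above `θ` are sums of irreducible characters above `θ`. -/
lemma IsCharAbove.induction (hθ : IsIrrChar ↥N θ) {P : (G → ℂ) → Prop} (h0 : P 0)
    (hadd : ∀ χ ψ, IsIrrChar G χ → IsCharAbove θ χ → IsCharAbove θ ψ → P ψ → P (χ + ψ))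
    (h : IsCharAbove θ χ) : P χ := by
  obtain ⟨s, hs, rfl⟩ := h.1.exists_multiset
  induction s using Multiset.induction_on with
  | empty => simpa using h0
  | cons χ s ih =>
    have hs' : ∀ ψ ∈ s, IsIrrChar G ψ := fun ψ hψ => hs ψ (Multiset.mem_cons_of_mem hψ)
    have h1 := hs χ (Multiset.mem_cons_self χ s)
    have h2 : IsCharacter G s.sum := isCharacter_multiset_sum s fun ψ hψ => (hs' ψ hψ).1
    obtain ⟨c, hc⟩ := h.2
    rw [Multiset.sum_cons] at hc ⊢
    have h3 := IsCharAbove.of_add hθ h2 h1.1 (by rw [add_comm]; exact hc)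
    exact hadd _ _ h1 (.of_add hθ h1.1 h2 hc) h3 (ih hs' h3)

/-- An irreducible character lying over an invariant character lies above it. -/
lemma IsIrrChar.isCharAbove [N.Normal] (hinv : InvariantUnder N θ ⊤) (hχ : IsIrrChar G χ)
    (h : IsConstituent θ (resChar N χ)) : IsCharAbove θ χ := by
  obtain ⟨Γ, _, _, G', _, _, N', _, θ', -, -, ⟨X⟩⟩ := exists_centralCover h.1 hinv
  have h0 : IsIrrChar ↥(⊤ : Subgroup G) (χ ∘ Subgroup.topEquiv) := hχ.comp_equiv Subgroup.topEquiv
  have h1 := (X.ctx ⊤ le_top).restrict_eq h0.1 fun ψ hψ => by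
    rw [hψ.eq_of_irr h0, X.ctx_i]
    exact h
  rw [X.ctx_i] at h1
  exact ⟨hχ.1, _, h1⟩

/-- A character above `θ` restricts to a character over `θ`. -/
lemma IsCharAbove.isCharOver (hθ : IsIrrChar ↥N θ) (h : IsCharAbove θ χ) {H : Subgroup G}
    (hNH : N ≤ H) : IsCharOver hNH θ (resChar H χ) := by
  obtain ⟨c, hc⟩ := h.2
  exact ⟨h.1.comp H.subtype, fun ψ hψ =>
    constituent_of_restrict_eq (Subgroup.inclusion hNH) hθ (χ := resChar H χ) (c := c) hc hψ⟩

end Above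

section Regular
variable {G : Type} [Group G] {N : Subgroup G} {σ : Set ℕ}

lemma isPiElt_iff [N.Normal] (hN : IsPiNumber σ (Nat.card ↥N)) (g : G) :
    IsPiElt σ g ↔ IsPiNumber σ (orderOf (g : G ⧸ N)) := by
  refine ⟨fun h q hq hd => h q hq (hd.trans (orderOf_map_dvd (QuotientGroup.mk' N) g)),
    fun h q hq hd => ?_⟩
  have h1 : g ^ orderOf (g : G ⧸ N) ∈ N := by
    rw [← QuotientGroup.eq_one_iff, QuotientGroup.mk_pow, pow_orderOf_eq_one]
  have h2 : g ^ (orderOf (g : G ⧸ N) * Nat.card ↥N) = 1 := by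
    rw [pow_mul]
    exact congr_arg Subtype.val (pow_card_eq_one' (x := (⟨_, h1⟩ : ↥N)))
  rcases hq.dvd_mul.mp (hd.trans (orderOf_dvd_of_pow_eq_one h2)) with h3 | h3
  exacts [h q hq h3, hN q hq h3]

lemma isPiElt_of_mem (hN : IsPiNumber σ (Nat.card ↥N)) {g : G} (hg : g ∈ N) : IsPiElt σ g := by
  intro q hq hd
  refine hN q hq (hd.trans ?_)
  have := orderOf_dvd_natCard (⟨g, hg⟩ : ↥N)
  rwa [← Subgroup.orderOf_coe] at this

lemma resChar_eq_of_piRestrict_eq (hN : IsPiNumber σ (Nat.card ↥N)) {χ ψ : G → ℂ}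
    (h : piRestrict σ χ = piRestrict σ ψ) : resChar N χ = resChar N ψ := by
  ext n
  have := congr_fun h n
  simp only [piRestrict, if_pos (isPiElt_of_mem hN n.2)] at this
  exact this

lemma piRestrict_add (χ ψ : G → ℂ) :
    piRestrict σ (χ + ψ) = piRestrict σ χ + piRestrict σ ψ := by
  ext g
  simp only [piRestrict, Pi.add_apply]
  split_ifs <;> simp

/-- The irreducibility of `χ^o` can be tested on characters above `θ`. -/
lemma isIPiChar_iff [Finite G] {θ : ↥N → ℂ} (hN : IsPiNumber σ (Nat.card ↥N)) (hθ : IsIrrChar ↥N θ)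
    {χ : G → ℂ} (hχ : IsCharAbove θ χ) (h0 : χ ≠ 0) : IsIPiChar σ G (piRestrict σ χ) ↔
      ¬ ∃ χ₁ χ₂, IsCharAbove θ χ₁ ∧ χ₁ ≠ 0 ∧ IsCharAbove θ χ₂ ∧ χ₂ ≠ 0 ∧
        piRestrict σ χ = piRestrict σ (χ₁ + χ₂) := by
  have hp : IsPartialChar σ G (piRestrict σ χ) := ⟨χ, hχ.1, h0, rfl⟩
  rw [IsIPiChar, and_iff_right hp, not_iff_not]
  constructor
  · rintro ⟨_, _, ⟨χ₁, h₁, h₁0, rfl⟩, ⟨χ₂, h₂, h₂0, rfl⟩, h⟩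
    rw [← piRestrict_add] at h
    obtain ⟨c, hc⟩ := hχ.2
    rw [resChar_eq_of_piRestrict_eq hN h] at hc
    exact ⟨χ₁, χ₂, .of_add hθ h₁ h₂ hc, h₁0, .of_add hθ h₂ h₁ (by rw [add_comm]; exact hc), h₂0, h⟩
  · rintro ⟨χ₁, χ₂, h₁, h₁0, h₂, h₂0, h⟩
    exact ⟨_, _, ⟨χ₁, h₁.1, h₁0, rfl⟩, ⟨χ₂, h₂.1, h₂0, rfl⟩, by rw [h, piRestrict_add]⟩

end Regular

section Corr
variable {G G' : Type} [Group G] [Group G'] {N : Subgroup G} [N.Normal] {N' : Subgroup G'}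
  [N'.Normal] (τ : (G ⧸ N) ≃* (G' ⧸ N'))

lemma mem_corrSubgroup_of_eq {H : Subgroup G} {h : G} {h' : G'} (hh : h ∈ H)
    (e : τ (h : G ⧸ N) = (h' : G' ⧸ N')) : h' ∈ corrSubgroup N N' τ H :=
  ⟨_, ⟨h, hh, rfl⟩, e⟩

lemma exists_of_mem_corrSubgroup {H : Subgroup G} {h' : G'} (hh : h' ∈ corrSubgroup N N' τ H) :
    ∃ h ∈ H, τ (h : G ⧸ N) = (h' : G' ⧸ N') := by
  obtain ⟨_, ⟨h, hh, rfl⟩, e⟩ := hh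
  exact ⟨h, hh, e⟩

lemma exists_of_eq (x' : G') : ∃ x : G, τ (x : G ⧸ N) = (x' : G' ⧸ N') := by
  obtain ⟨x, hx⟩ := QuotientGroup.mk_surjective (τ.symm (x' : G' ⧸ N'))
  exact ⟨x, by rw [hx, MulEquiv.apply_symm_apply]⟩

lemma corrSubgroup_top : corrSubgroup N N' τ ⊤ = ⊤ :=
  eq_top_iff.mpr fun x' _ => by
    obtain ⟨x, hx⟩ := exists_of_eq τ x'
    exact mem_corrSubgroup_of_eq τ trivial hx

/-- The subgroup of `G` generated by `N` and `g`. -/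
def adjoinSubgroup (N : Subgroup G) [N.Normal] (g : G) : Subgroup G :=
  (Subgroup.zpowers (g : G ⧸ N)).comap (QuotientGroup.mk' N)

lemma mem_adjoinSubgroup (N : Subgroup G) [N.Normal] (g : G) : g ∈ adjoinSubgroup N g :=
  Subgroup.mem_zpowers _

lemma le_adjoinSubgroup (N : Subgroup G) [N.Normal] (g : G) : N ≤ adjoinSubgroup N g := by
  intro n hn
  change (n : G ⧸ N) ∈ Subgroup.zpowers (g : G ⧸ N)
  rw [(QuotientGroup.eq_one_iff n).mpr hn]
  exact one_mem _

lemma corrSubgroup_adjoin_comm (hN' : N' ≤ Subgroup.center G') (g : G)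
    (c c' : ↥(corrSubgroup N N' τ (adjoinSubgroup N g))) : c * c' = c' * c := by
  obtain ⟨g', hg'⟩ := QuotientGroup.mk_surjective (τ (g : G ⧸ N))
  have key : ∀ c : ↥(corrSubgroup N N' τ (adjoinSubgroup N g)),
      ∃ k : ℤ, ∃ n ∈ Subgroup.center G', (c : G') = g' ^ k * n := fun c => by
    obtain ⟨h, ⟨k, hk⟩, e⟩ := exists_of_mem_corrSubgroup τ c.2
    refine ⟨k, (g' ^ k)⁻¹ * c, hN' (QuotientGroup.eq.mp ?_), by group⟩
    rw [← e, QuotientGroup.mk_zpow, hg', ← map_zpow]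
    exact congr_arg τ hk
  obtain ⟨k, n, hn, hc⟩ := key c
  obtain ⟨l, m, hm, hc'⟩ := key c'
  have hn' := Subgroup.mem_center_iff.mp hn
  have hm' := Subgroup.mem_center_iff.mp hm
  ext
  rw [Subgroup.coe_mul, Subgroup.coe_mul, hc, hc', mul_assoc, ← mul_assoc n, ← hn', mul_assoc,
    mul_assoc (g' ^ l), ← mul_assoc m, ← hm', ← mul_assoc, ← mul_assoc, ← mul_assoc, ← mul_assoc,
    ← zpow_add, ← zpow_add, add_comm, mul_assoc, mul_assoc, hn']

end Corr

namespace CharTripleIso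

variable {G : Type} [Group G] [Fintype G] {N : Subgroup G} [N.Normal] {θ : ↥N → ℂ}
  {G' : Type} [Group G'] [Fintype G'] {N' : Subgroup G'} [N'.Normal] {θ' : ↥N' → ℂ}
  (iso : CharTripleIso G N θ G' N' θ')

lemma mem_corr_top (x : G') : x ∈ corrSubgroup N N' iso.τ ⊤ := by
  rw [corrSubgroup_top]; trivial

/-- The map from class functions on `G` to class functions on `G'`. -/
def star (χ : G → ℂ) (x : G') : ℂ := iso.map ⊤ (resChar ⊤ χ) ⟨x, iso.mem_corr_top x⟩

lemma topCorresponds_iff {χ : G → ℂ} {χ' : G' → ℂ} :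
    TopCorresponds iso χ χ' ↔ χ' = iso.star χ :=
  ⟨fun h => funext fun x => h x (iso.mem_corr_top x), fun h _ _ => by rw [h]; rfl⟩

variable {χ ψ : G → ℂ}

lemma star_add (hθ : IsIrrChar ↥N θ) (hχ : IsCharAbove θ χ) (hψ : IsCharAbove θ ψ) :
    iso.star (χ + ψ) = iso.star χ + iso.star ψ := by
  ext x
  exact congr_fun (iso.map_add ⊤ le_top _ _ (hχ.isCharOver hθ le_top) (hψ.isCharOver hθ le_top)) _

lemma star_zero (hθ : IsIrrChar ↥N θ) : iso.star 0 = 0 := by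
  have h := iso.star_add hθ .zero .zero
  simpa using h

lemma star_apply_one (hθ : IsIrrChar ↥N θ) (hχ : IsCharAbove θ χ) :
    iso.star χ 1 * θ 1 = χ 1 * θ' 1 :=
  iso.deg_ratio ⊤ le_top _ (hχ.isCharOver hθ le_top)

lemma star_eq_map (hθ : IsIrrChar ↥N θ) (hχ : IsCharAbove θ χ) {H : Subgroup G} (hNH : N ≤ H)
    (x : ↥(corrSubgroup N N' iso.τ H)) : iso.star χ x = iso.map H (resChar H χ) x :=
  (congr_fun (iso.map_res H ⊤ hNH le_top _ (hχ.isCharOver hθ le_top)) x).symm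

/-- The equivalence of `G'` with the subgroup corresponding to `G`. -/
def corrTopEquiv : G' ≃* ↥(corrSubgroup N N' iso.τ ⊤) where
  toFun x := ⟨x, iso.mem_corr_top x⟩
  invFun x := x
  left_inv _ := rfl
  right_inv _ := rfl
  map_mul' _ _ := rfl

lemma star_bijOn : Set.BijOn iso.star {χ | IsIrrChar G χ ∧ IsConstituent θ (resChar N χ)}
    {χ' | IsIrrChar G' χ' ∧ IsConstituent θ' (resChar N' χ')} := by
  have h := iso.bijOn ⊤ le_top
  refine ⟨fun χ hχ => ?_, fun χ hχ ψ hψ e => ?_, fun χ' hχ' => ?_⟩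
  · have h1 := h.mapsTo (x := resChar ⊤ χ) ⟨hχ.1.comp_equiv Subgroup.topEquiv, hχ.2⟩
    exact ⟨h1.1.comp_equiv iso.corrTopEquiv, h1.2⟩
  · have h1 := h.injOn (x₁ := resChar ⊤ χ) ⟨hχ.1.comp_equiv Subgroup.topEquiv, hχ.2⟩
      (x₂ := resChar ⊤ ψ) ⟨hψ.1.comp_equiv Subgroup.topEquiv, hψ.2⟩
      (funext fun x => congr_fun e x)
    exact funext fun x => congr_fun h1 ⟨x, trivial⟩
  · obtain ⟨χ, hχ, e⟩ := h.surjOn (a := fun x => χ' x)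
      ⟨hχ'.1.comp_equiv iso.corrTopEquiv.symm, hχ'.2⟩
    refine ⟨fun g => χ ⟨g, trivial⟩, ⟨hχ.1.comp_equiv Subgroup.topEquiv.symm, hχ.2⟩, ?_⟩
    exact funext fun x => congr_fun e ⟨x, iso.mem_corr_top x⟩

lemma star_isCharAbove (hθ : IsIrrChar ↥N θ) (hinv' : InvariantUnder N' θ' ⊤)
    (hχ : IsCharAbove θ χ) : IsCharAbove θ' (iso.star χ) := by
  refine hχ.induction hθ (P := fun χ => IsCharAbove θ' (iso.star χ)) ?_ fun χ ψ hχ h1 h2 h => ?_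
  · rw [iso.star_zero hθ]
    exact .zero
  · rw [iso.star_add hθ h1 h2]
    have h3 := iso.star_bijOn.mapsTo
      (show χ ∈ _ from ⟨hχ, h1.isConstituent hθ hχ.apply_one_ne_zero⟩)
    exact (h3.1.isCharAbove hinv' h3.2).add h

lemma exists_star_eq (hθ : IsIrrChar ↥N θ) (hinv : InvariantUnder N θ ⊤) (hθ' : IsIrrChar ↥N' θ')
    {χ' : G' → ℂ} (hχ' : IsCharAbove θ' χ') : ∃ χ, IsCharAbove θ χ ∧ iso.star χ = χ' := by
  refine hχ'.induction hθ' (P := fun χ' => ∃ χ, IsCharAbove θ χ ∧ iso.star χ = χ') ⟨0, .zero, iso.star_zero hθ⟩ fun χ' ψ' hχ' h1 h2 ⟨ψ, h3, h4⟩ => ?_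
  obtain ⟨χ, hχ, rfl⟩ := iso.star_bijOn.surjOn
    (show χ' ∈ _ from ⟨hχ', h1.isConstituent hθ' hχ'.apply_one_ne_zero⟩)
  have h5 := hχ.1.isCharAbove hinv hχ.2
  exact ⟨χ + ψ, h5.add h3, by rw [iso.star_add hθ h5 h3, h4]⟩

lemma star_eq_zero_iff (hθ : IsIrrChar ↥N θ) (hθ' : IsIrrChar ↥N' θ')
    (hχ : IsCharAbove θ χ) : iso.star χ = 0 ↔ χ = 0 := by
  refine ⟨fun h => hχ.1.eq_zero_of_apply_one ?_, fun h => by rw [h, iso.star_zero hθ]⟩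
  have h1 := iso.star_apply_one hθ hχ
  rw [h, Pi.zero_apply, zero_mul] at h1
  exact (mul_eq_zero.mp h1.symm).resolve_right hθ'.apply_one_ne_zero

/-- On a coset of `N`, all characters above `θ` are proportional to a fixed nonzero function, and
the proportionality factors determine the corresponding characters of `G'`. -/
lemma exists_factor (hθ : IsIrrChar ↥N θ) (hinv : InvariantUnder N θ ⊤) (hθ' : IsIrrChar ↥N' θ')
    (hN' : N' ≤ Subgroup.center G') {χ₀ : G → ℂ} (hχ₀ : IsCharAbove θ χ₀) (h0 : χ₀ ≠ 0) (g : G) :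
    ∃ (η : ↥N → ℂ) (u : G' → ℂ), (∃ n, η n ≠ 0) ∧
      (∀ g' : G', iso.τ (g : G ⧸ N) = (g' : G' ⧸ N') → u g' ≠ 0) ∧
      ∀ χ, IsCharAbove θ χ → ∃ β : ℂ, (∀ n : ↥N, χ (g * n) = η n * β) ∧
        ∀ g' : G', iso.τ (g : G ⧸ N) = (g' : G' ⧸ N') → iso.star χ g' = u g' * β := by
  obtain ⟨Γ, _, _, C, _, _, M, _, ζ, hM, -, ⟨X⟩⟩ := exists_centralCover hθ hinv
  set H := adjoinSubgroup N g
  have hNH : N ≤ H := le_adjoinSubgroup N g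
  have hg : g ∈ H := mem_adjoinSubgroup N g
  have hi : ∀ m, (X.ctx H hNH).i m = ⟨m, hNH m.2⟩ := fun m => Subtype.ext (X.a_ι m)
  have hco := hχ₀.isCharOver hθ hNH
  obtain ⟨ψ₀, hψ₀⟩ := hco.1.exists_constituent fun h =>
    h0 (hχ₀.1.eq_zero_of_apply_one (congr_fun h 1))
  obtain ⟨η, hη, hηθ, hη1, hη0, hext⟩ := (X.ctx H hNH).exists_extension
    (corrSubgroup_adjoin_comm X.quotEquiv hM g) hψ₀.1 (by rw [X.ctx_i]; exact hco.2 _ hψ₀)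
  rw [X.ctx_i] at hηθ
  have hηo : IsCharOver hNH θ η := ⟨hη.1, fun ψ hψ => by rw [hψ.eq_of_irr hη]; exact hηθ⟩
  have hη' := (iso.bijOn H hNH).mapsTo (show η ∈ _ from ⟨hη, hηθ⟩)
  have hθ'1 : θ' 1 = 1 := hθ'.apply_one_of_comm fun a b =>
    Subtype.ext (Subgroup.mem_center_iff.mp (hN' b.2) a)
  have hη'1 : iso.map H η 1 = 1 := by
    have := iso.deg_ratio H hNH η hηo
    rw [hη1, hθ'1, mul_one] at this
    exact mul_right_cancel₀ hθ.apply_one_ne_zero (this.trans (one_mul _).symm)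
  refine ⟨fun n => η (⟨g, hg⟩ * (X.ctx H hNH).i n), extZero (iso.map H η), hη0 _,
    fun g' hg' => ?_, fun χ hχ => ?_⟩
  · rw [extZero_of_mem _ (mem_corrSubgroup_of_eq iso.τ hg hg')]
    exact hη'.1.1.ne_zero_of_apply_one_eq_one hη'1 _
  · have hχo := hχ.isCharOver hθ hNH
    obtain ⟨β, hβ, hβN, hχβ⟩ := hext (resChar H χ) hχo.1 fun ψ hψ => by
      rw [X.ctx_i]; exact hχo.2 ψ hψ
    have hconst : ∀ x y : ↥H, ((x : G) : G ⧸ N) = ((y : G) : G ⧸ N) → β x = β y :=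
      fun x y h => by
        have := hβN x ⟨_, QuotientGroup.eq.mp h⟩
        rw [← this, hi]
        congr 1
        ext
        simp
    choose r hrH hr using fun x' : ↥(corrSubgroup N N' iso.τ H) =>
      exists_of_mem_corrSubgroup iso.τ x'.2
    have hβ' : ∀ (x : ↥H) (x' : ↥(corrSubgroup N N' iso.τ H)),
        iso.τ ((x : G) : G ⧸ N) = ((x' : G') : G' ⧸ N') → β ⟨r x', hrH x'⟩ = β x := fun x x' h =>
      hconst _ _ (iso.τ.injective ((hr x').trans h.symm))
    have hmul := iso.map_mul H hNH η β hηo hβ (fun x n => by rw [← hi, hβN])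
      (fun x' => β ⟨r x', hrH x'⟩) hβ'
    refine ⟨β ⟨g, hg⟩, fun n => ?_, fun g' hg' => ?_⟩
    · have := congr_fun hχβ (⟨g, hg⟩ * (X.ctx H hNH).i n)
      rw [Pi.mul_apply, hβN] at this
      rw [← this, hi]
      rfl
    · have hm := mem_corrSubgroup_of_eq iso.τ hg hg'
      rw [extZero_of_mem _ hm, iso.star_eq_map hθ hχ hNH ⟨g', hm⟩, hχβ, hmul, Pi.mul_apply,
        hβ' ⟨g, hg⟩ _ hg']

variable {σ : Set ℕ}

/-- The character triple isomorphism respects equality on `σ`-elements. -/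
lemma piRestrict_star_eq_iff (hθ : IsIrrChar ↥N θ) (hinv : InvariantUnder N θ ⊤)
    (hθ' : IsIrrChar ↥N' θ') (hN' : N' ≤ Subgroup.center G') (hσ : IsPiNumber σ (Nat.card ↥N))
    (hσ' : IsPiNumber σ (Nat.card ↥N')) {χ₀ : G → ℂ} (hχ₀ : IsCharAbove θ χ₀) (h0 : χ₀ ≠ 0)
    (hχ : IsCharAbove θ χ) (hψ : IsCharAbove θ ψ) :
    piRestrict σ (iso.star χ) = piRestrict σ (iso.star ψ) ↔
      piRestrict σ χ = piRestrict σ ψ := by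
  have hpi : ∀ (g : G) (g' : G'), iso.τ (g : G ⧸ N) = (g' : G' ⧸ N') →
      (IsPiElt σ g ↔ IsPiElt σ g') := fun g g' h => by
    rw [isPiElt_iff hσ, isPiElt_iff hσ', ← h, MulEquiv.orderOf_eq]
  simp only [funext_iff, piRestrict]
  constructor
  · intro h g
    split_ifs with hg
    · obtain ⟨η, u, -, hu, hf⟩ := iso.exists_factor hθ hinv hθ' hN' hχ₀ h0 g
      obtain ⟨g', hg'⟩ := QuotientGroup.mk_surjective (iso.τ (g : G ⧸ N))
      obtain ⟨β, h1, h2⟩ := hf χ hχ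
      obtain ⟨γ, h3, h4⟩ := hf ψ hψ
      have h5 := h g'
      rw [if_pos ((hpi g g' hg'.symm).mp hg), if_pos ((hpi g g' hg'.symm).mp hg),
        h2 g' hg'.symm, h4 g' hg'.symm] at h5
      have h6 := h1 1
      rw [mul_left_cancel₀ (hu g' hg'.symm) h5, ← h3] at h6
      simpa using h6
    · rfl
  · intro h g'
    split_ifs with hg'
    · obtain ⟨g, hg⟩ := exists_of_eq iso.τ g'
      obtain ⟨η, u, ⟨n, hn⟩, -, hf⟩ := iso.exists_factor hθ hinv hθ' hN' hχ₀ h0 g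
      obtain ⟨β, h1, h2⟩ := hf χ hχ
      obtain ⟨γ, h3, h4⟩ := hf ψ hψ
      have h5 := h (g * n)
      have h6 : IsPiElt σ (g * n) := (hpi _ g' (by
        rw [← hg, QuotientGroup.mk_mul, (QuotientGroup.eq_one_iff (n : G)).mpr n.2, mul_one])).mpr hg'
      rw [if_pos h6, if_pos h6, h1, h3] at h5
      rw [h2 g' hg, h4 g' hg, mul_left_cancel₀ hn h5]
    · rfl

end CharTripleIso

namespace CharTripleIso

variable {G : Type} [Group G] [Fintype G] {N : Subgroup G} [N.Normal] {θ : ↥N → ℂ}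
  {G' : Type} [Group G'] [Fintype G'] {N' : Subgroup G'} [N'.Normal] {θ' : ↥N' → ℂ}
  (iso : CharTripleIso G N θ G' N' θ') {χ ψ : G → ℂ} {σ : Set ℕ}

lemma isLiftPi_star_iff (hθ : IsIrrChar ↥N θ) (hinv : InvariantUnder N θ ⊤)
    (hθ' : IsIrrChar ↥N' θ') (hinv' : InvariantUnder N' θ' ⊤) (hN' : N' ≤ Subgroup.center G')
    (hσ : IsPiNumber σ (Nat.card ↥N)) (hσ' : IsPiNumber σ (Nat.card ↥N')) (hχ : IsIrrChar G χ)
    (hχθ : IsConstituent θ (resChar N χ)) :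
    IsLiftPi σ G χ ↔ IsLiftPi σ G' (iso.star χ) := by
  have hχ' := (iso.star_bijOn.mapsTo (show χ ∈ _ from ⟨hχ, hχθ⟩)).1
  have ha := hχ.isCharAbove hinv hχθ
  rw [IsLiftPi, IsLiftPi, and_iff_right hχ, and_iff_right hχ', isIPiChar_iff hσ hθ ha hχ.2.1,
    isIPiChar_iff hσ' hθ' (iso.star_isCharAbove hθ hinv' ha) hχ'.2.1, not_iff_not]
  constructor
  · rintro ⟨χ₁, χ₂, h₁, h₁0, h₂, h₂0, h⟩
    refine ⟨_, _, iso.star_isCharAbove hθ hinv' h₁, (iso.star_eq_zero_iff hθ hθ' h₁).not.mpr h₁0,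
      iso.star_isCharAbove hθ hinv' h₂, (iso.star_eq_zero_iff hθ hθ' h₂).not.mpr h₂0, ?_⟩
    rwa [← iso.star_add hθ h₁ h₂,
      iso.piRestrict_star_eq_iff hθ hinv hθ' hN' hσ hσ' ha hχ.2.1 ha (h₁.add h₂)]
  · rintro ⟨_, _, h₃, h₁0, h₄, h₂0, h⟩
    obtain ⟨χ₁, h₁, rfl⟩ := iso.exists_star_eq hθ hinv hθ' h₃
    obtain ⟨χ₂, h₂, rfl⟩ := iso.exists_star_eq hθ hinv hθ' h₄
    refine ⟨_, _, h₁, (iso.star_eq_zero_iff hθ hθ' h₁).not.mp h₁0,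
      h₂, (iso.star_eq_zero_iff hθ hθ' h₂).not.mp h₂0, ?_⟩
    rwa [← iso.star_add hθ h₁ h₂,
      iso.piRestrict_star_eq_iff hθ hinv hθ' hN' hσ hσ' ha hχ.2.1 ha (h₁.add h₂)] at h

lemma card_lifts_eq (hθ : IsIrrChar ↥N θ) (hinv : InvariantUnder N θ ⊤)
    (hθ' : IsIrrChar ↥N' θ') (hN' : N' ≤ Subgroup.center G')
    (hσ : IsPiNumber σ (Nat.card ↥N)) (hσ' : IsPiNumber σ (Nat.card ↥N')) (hψ : IsIrrChar G ψ)
    (hψθ : IsConstituent θ (resChar N ψ)) :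
    Nat.card {χ : G → ℂ // IsLiftOfPi σ G χ (piRestrict σ ψ)} =
      Nat.card {χ' : G' → ℂ // IsLiftOfPi σ G' χ' (piRestrict σ (iso.star ψ))} := by
  have ha := hψ.isCharAbove hinv hψθ
  have hψ' := iso.star_bijOn.mapsTo (show ψ ∈ _ from ⟨hψ, hψθ⟩)
  have h1 : ∀ χ, IsLiftOfPi σ G χ (piRestrict σ ψ) → IsConstituent θ (resChar N χ) :=
    fun χ h => by rwa [resChar_eq_of_piRestrict_eq hσ h.2]
  refine Nat.card_congr (Set.BijOn.equiv (s := {χ | IsLiftOfPi σ G χ (piRestrict σ ψ)})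
    (t := {χ' | IsLiftOfPi σ G' χ' (piRestrict σ (iso.star ψ))}) iso.star
    ⟨fun χ h => ?_, fun χ h χ₂ h₂ e => ?_, fun χ' h => ?_⟩)
  · refine ⟨(iso.star_bijOn.mapsTo (show χ ∈ _ from ⟨h.1, h1 χ h⟩)).1, ?_⟩
    rw [iso.piRestrict_star_eq_iff hθ hinv hθ' hN' hσ hσ' ha hψ.2.1
      (h.1.isCharAbove hinv (h1 χ h)) ha]
    exact h.2
  · exact iso.star_bijOn.injOn ⟨h.1, h1 χ h⟩ ⟨h₂.1, h1 χ₂ h₂⟩ e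
  · obtain ⟨χ, hχ, rfl⟩ := iso.star_bijOn.surjOn (show χ' ∈ _ from ⟨h.1, by
      rw [resChar_eq_of_piRestrict_eq hσ' h.2]; exact hψ'.2⟩)
    refine ⟨χ, ⟨hχ.1, ?_⟩, rfl⟩
    rw [← iso.piRestrict_star_eq_iff hθ hinv hθ' hN' hσ hσ' ha hψ.2.1
      (hχ.1.isCharAbove hinv hχ.2) ha]
    exact h.2

end CharTripleIso

lemma nonempty_centralPPrimeReplacement {p : ℕ} {G : Type} [Group G] [Fintype G] {N : Subgroup G}
    [N.Normal] (hN : IsPiNumber ({p}ᶜ) (Nat.card ↥N)) {θ : ↥N → ℂ} (hθ : IsIrrChar ↥N θ)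
    (hinv : InvariantUnder N θ ⊤) : Nonempty (CentralPPrimeReplacement p G N θ) := by
  obtain ⟨Γ, _, _, G', _, _, N', _, θ', hN', hdvd, ⟨X⟩⟩ := exists_centralCover hθ hinv
  have := Fintype.ofFinite G'
  exact ⟨{
    G' := G'
    N' := N'
    central := hN'
    pprime := fun q hq h => hN q hq (hdvd q hq h)
    θ' := θ'
    irr' := X.irr'
    inv' := fun g _ x _ => congr_arg θ' (Subtype.ext
      (mul_inv_eq_of_eq_mul (Subgroup.mem_center_iff.mp (hN' x.2) g)))
    iso := X.iso }⟩

/-- **Theorem (Statement 7).** Let `G` be a finite `p`-solvable group, `N ⊴ G` a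
`p'`-subgroup and `θ ∈ Irr(N)` `G`-invariant.  Then `(G, N, θ)` is isomorphic to a
character triple `(G', N', θ')` with `N'` a central `p'`-subgroup of `G'`.  Moreover, for
any such isomorphism: if `χ ∈ Irr(G | θ)` corresponds to `χ' ∈ Irr(G' | θ')`, then `χ` is
a lift if and only if `χ'` is a lift; and if `ψ ∈ Irr(G | θ)` is a lift of `φ ∈ IBr(G)`
and `φ' = (ψ')^o`, then the number of lifts of `φ` equals the number of lifts of `φ'`. -/
theorem character_triple_central_replacement
    (p : ℕ) (hp : p.Prime)
    (G : Type) [Group G] [Fintype G] (hG : IsPSolvable p G)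
    (N : Subgroup G) [N.Normal] (hNp' : IsPiNumber ({p}ᶜ) (Nat.card ↥N))
    (θ : ↥N → ℂ) (hθ : IsIrrChar ↥N θ) (hθinv : InvariantUnder N θ ⊤) :
    Nonempty (CentralPPrimeReplacement p G N θ) ∧
    ∀ R : CentralPPrimeReplacement p G N θ,
      (∀ (χ : G → ℂ) (χ' : R.G' → ℂ),
        IsIrrChar G χ → IsConstituent θ (resChar N χ) →
        TopCorresponds R.iso χ χ' →
        (IsLiftPi ({p}ᶜ) G χ ↔ IsLiftPi ({p}ᶜ) R.G' χ')) ∧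
      ∀ (ψ : G → ℂ) (ψ' : R.G' → ℂ) (φ : G → ℂ),
        IsIrrChar G ψ → IsConstituent θ (resChar N ψ) →
        TopCorresponds R.iso ψ ψ' →
        IsIBrChar p G φ → IsLiftOfPi ({p}ᶜ) G ψ φ →
        Nat.card {χ : G → ℂ // IsLiftOfPi ({p}ᶜ) G χ φ} =
          Nat.card {χ' : R.G' → ℂ // IsLiftOfPi ({p}ᶜ) R.G' χ' (piRestrict ({p}ᶜ) ψ')} := by
  refine ⟨nonempty_centralPPrimeReplacement hNp' hθ hθinv, fun R => ⟨?_, ?_⟩⟩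
  · intro χ χ' hχ hχθ h
    rw [R.iso.topCorresponds_iff.mp h]
    exact R.iso.isLiftPi_star_iff hθ hθinv R.irr' R.inv' R.central hNp' R.pprime hχ hχθ
  · rintro ψ ψ' _ hψ hψθ h - ⟨-, rfl⟩
    rw [R.iso.topCorresponds_iff.mp h]
    exact R.iso.card_lifts_eq hθ hθinv R.irr' R.central hNp' R.pprime hψ hψθ
end
end

section
/- Let π be a set of primes with 2 ∈ π, and let G be a finite π-separable group. Let χ ∈ Irr(G) be such that χ = αβ where α is π-special and β is linear and π'-special. Suppose ψ ∈ Irr(U) is π-factored for some subgroup U ≤ G and ψ^G = χ. If δ is the π'-special factor of ψ, then β_U = δ. -/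
open scoped Classical

noncomputable section

open Module Module.End in
theorem finrank_eigenspace_eq_trace {V : Type*} [AddCommGroup V] [Module ℂ V]
    [FiniteDimensional ℂ V] (f : End ℂ V) {N : ℕ} (hN : N ≠ 0) (hf : f ^ N = 1)
    {μ : ℂ} (hμ : μ ^ N = 1) :
    (finrank ℂ (f.eigenspace μ) : ℂ) =
      (N : ℂ)⁻¹ * ∑ k ∈ Finset.range N, (μ⁻¹) ^ k * LinearMap.trace ℂ V (f ^ k) := by
  have hμ0 : μ ≠ 0 := by rintro rfl; simp [hN] at hμ
  have hN' : (N : ℂ) ≠ 0 := by exact_mod_cast hN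
  set P : End ℂ V := (N : ℂ)⁻¹ • ∑ k ∈ Finset.range N, (μ⁻¹) ^ k • f ^ k with hP
  have hfP : f * P = μ • P := by
    have h := Finset.sum_range_succ (fun k => (μ⁻¹) ^ k • f ^ k) N
    rw [Finset.sum_range_succ', hf, inv_pow μ N, hμ] at h
    simp only [inv_one, pow_zero, one_smul, add_left_inj] at h
    rw [hP, mul_smul_comm, smul_comm μ, Finset.mul_sum]
    congr 1
    rw [← h, Finset.smul_sum]
    refine Finset.sum_congr rfl fun k _ => ?_
    rw [mul_smul_comm, ← pow_succ', smul_smul, pow_succ (μ⁻¹), mul_comm _ μ⁻¹, ← mul_assoc,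
      mul_inv_cancel₀ hμ0, one_mul]
  have hproj : LinearMap.IsProj (f.eigenspace μ) P := by
    refine ⟨fun v => ?_, fun v hv => ?_⟩
    · rw [mem_eigenspace_iff]
      exact congrArg (fun g : End ℂ V => g v) hfP
    · rw [mem_eigenspace_iff] at hv
      have hk : ∀ k : ℕ, (f ^ k) v = μ ^ k • v := by
        intro k
        induction k with
        | zero => simp
        | succ k ih => rw [pow_succ', Module.End.mul_apply, ih, map_smul, hv, smul_smul, pow_succ]
      simp [hP, LinearMap.sum_apply, hk, smul_smul, hμ0, ← Nat.cast_smul_eq_nsmul ℂ, hN']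
  rw [← hproj.trace, hP]
  simp

open Module Module.End in
theorem rootMultiplicity_charpoly_of_pow_eq_one {V : Type*} [AddCommGroup V] [Module ℂ V]
    [FiniteDimensional ℂ V] (f : End ℂ V) {N : ℕ} (hN : N ≠ 0) (hf : f ^ N = 1) (μ : ℂ) :
    (f.charpoly.rootMultiplicity μ : ℂ) = if μ ^ N = 1 then
      (N : ℂ)⁻¹ * ∑ k ∈ Finset.range N, (μ⁻¹) ^ k * LinearMap.trace ℂ V (f ^ k) else 0 := by
  have hs : f.IsSemisimple := by
    refine isSemisimple_of_squarefree_aeval_eq_zero (p := Polynomial.X ^ N - 1) ?_ (by simp [hf])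
    exact (Polynomial.X_pow_sub_one_separable_iff.2 (by exact_mod_cast hN)).squarefree
  rw [← LinearMap.finrank_maxGenEigenspace_eq,
    hs.isFinitelySemisimple.maxGenEigenspace_eq_eigenspace]
  split_ifs with hμ
  · exact finrank_eigenspace_eq_trace f hN hf hμ
  · rw [Nat.cast_eq_zero, Submodule.finrank_eq_zero, Submodule.eq_bot_iff]
    intro v hv
    by_contra hv0
    have h1 := (hasEigenvector_iff.2 ⟨hv, hv0⟩).pow_apply N
    rw [hf, Module.End.one_apply] at h1
    have h2 : (μ ^ N - 1) • v = 0 := by rw [sub_smul, ← h1, one_smul, sub_self]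
    exact hμ (sub_eq_zero.1 ((smul_eq_zero.1 h2).resolve_right hv0))

open Module Module.End in
/-- Endomorphisms of finite order whose powers have equal traces have equal determinants. -/
theorem det_eq_of_trace_pow_eq {V W : Type*} [AddCommGroup V] [Module ℂ V]
    [FiniteDimensional ℂ V] [AddCommGroup W] [Module ℂ W] [FiniteDimensional ℂ W]
    (f : End ℂ V) (g : End ℂ W) {N : ℕ} (hN : N ≠ 0) (hf : f ^ N = 1) (hg : g ^ N = 1)
    (h : ∀ k, LinearMap.trace ℂ V (f ^ k) = LinearMap.trace ℂ W (g ^ k)) :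
    LinearMap.det f = LinearMap.det g := by
  rw [Module.End.det_eq_prod_roots_charpoly_of_splits (IsAlgClosed.splits _),
    Module.End.det_eq_prod_roots_charpoly_of_splits (IsAlgClosed.splits _)]
  congr 1
  ext μ
  rw [Polynomial.count_roots, Polynomial.count_roots, ← Nat.cast_inj (R := ℂ),
    rootMultiplicity_charpoly_of_pow_eq_one f hN hf, rootMultiplicity_charpoly_of_pow_eq_one g hN hg]
  simp only [h]

theorem IsPiNumber.mul {σ : Set ℕ} {a b : ℕ} (ha : IsPiNumber σ a) (hb : IsPiNumber σ b) :
    IsPiNumber σ (a * b) := fun q hq h =>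
  (hq.dvd_mul.1 h).elim (ha q hq) (hb q hq)

theorem IsPiNumber.of_dvd {σ : Set ℕ} {a b : ℕ} (hb : IsPiNumber σ b) (h : a ∣ b) :
    IsPiNumber σ a := fun q hq hqa => hb q hq (hqa.trans h)

theorem IsPiNumber.eq_one {σ : Set ℕ} {a : ℕ} (h : IsPiNumber σ a) (h' : IsPiNumber σᶜ a) :
    a = 1 := by
  by_contra ha
  obtain ⟨q, hq, hqa⟩ := Nat.exists_prime_and_dvd ha
  exact h' q hq hqa (h q hq hqa)

/-- `z` is a root of unity of order a `σ`-number. -/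
def IsPiRoot (σ : Set ℕ) (z : ℂ) : Prop :=
  ∃ N : ℕ, N ≠ 0 ∧ IsPiNumber σ N ∧ z ^ N = 1

namespace IsPiRoot

variable {σ : Set ℕ} {z w : ℂ}

theorem one : IsPiRoot σ 1 :=
  ⟨1, one_ne_zero, fun _ hq h => absurd (Nat.dvd_one.1 h) hq.ne_one, one_pow 1⟩

theorem mul (hz : IsPiRoot σ z) (hw : IsPiRoot σ w) : IsPiRoot σ (z * w) := by
  obtain ⟨N, hN0, hN, hz⟩ := hz
  obtain ⟨M, hM0, hM, hw⟩ := hw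
  refine ⟨N * M, mul_ne_zero hN0 hM0, hN.mul hM, ?_⟩
  rw [mul_pow, pow_mul, hz, mul_comm N, pow_mul, hw, one_pow, one_pow, one_mul]

theorem prod {ι : Type*} (s : Finset ι) {f : ι → ℂ} (h : ∀ i ∈ s, IsPiRoot σ (f i)) :
    IsPiRoot σ (∏ i ∈ s, f i) :=
  Finset.prod_induction f (IsPiRoot σ) (fun _ _ => mul) one h

theorem inv (hz : IsPiRoot σ z) : IsPiRoot σ z⁻¹ := by
  obtain ⟨N, hN0, hN, hz⟩ := hz
  exact ⟨N, hN0, hN, by rw [inv_pow, hz, inv_one]⟩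

theorem ne_zero (hz : IsPiRoot σ z) : z ≠ 0 := by
  rintro rfl
  obtain ⟨N, hN0, -, h⟩ := hz
  simp [hN0] at h

theorem of_mul_right (h : IsPiRoot σ (z * w)) (hw : IsPiRoot σ w) : IsPiRoot σ z := by
  simpa [mul_assoc, hw.ne_zero] using h.mul hw.inv

theorem of_pow {m : ℕ} (hm0 : m ≠ 0) (hm : IsPiNumber σ m) (h : IsPiRoot σ (z ^ m)) :
    IsPiRoot σ z := by
  obtain ⟨N, hN0, hN, h⟩ := h
  exact ⟨m * N, mul_ne_zero hm0 hN0, hm.mul hN, by rw [pow_mul, h]⟩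

theorem eq_one (h : IsPiRoot σ z) (h' : IsPiRoot σᶜ z) : z = 1 := by
  obtain ⟨N, -, hN, hz⟩ := h
  obtain ⟨M, -, hM, hz'⟩ := h'
  exact orderOf_eq_one_iff.1 ((hN.of_dvd (orderOf_dvd_of_pow_eq_one hz)).eq_one
    (hM.of_dvd (orderOf_dvd_of_pow_eq_one hz')))

end IsPiRoot

theorem IsCharacter.add_s12 {G : Type} [Group G] {χ₁ χ₂ : G → ℂ} (h₁ : IsCharacter G χ₁)
    (h₂ : IsCharacter G χ₂) : IsCharacter G (χ₁ + χ₂) := by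
  obtain ⟨V, hV⟩ := h₁
  obtain ⟨W, hW⟩ := h₂
  refine ⟨FDRep.of (Representation.prod V.ρ W.ρ), fun g => ?_⟩
  rw [Pi.add_apply, hV, hW]
  exact (LinearMap.trace_prodMap' (V.ρ g) (W.ρ g)).symm

/-- The character of a finite-dimensional representation determines its determinant. -/
theorem FDRep.det_eq_of_character_eq {G : Type} [Group G] [Finite G] {V W : FDRep ℂ G}
    (h : ∀ g, V.character g = W.character g) (g : G) :
    LinearMap.det (V.ρ g) = LinearMap.det (W.ρ g) := by
  refine det_eq_of_trace_pow_eq _ _ (orderOf_pos g).ne' ?_ ?_ fun k => ?_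
  · rw [← map_pow, pow_orderOf_eq_one, map_one]
  · rw [← map_pow, pow_orderOf_eq_one, map_one]
  · rw [← map_pow, ← map_pow]
    exact h (g ^ k)

theorem HasPiDetOrder.isPiRoot_det {σ : Set ℕ} {G : Type} [Group G] [Finite G] {θ : G → ℂ}
    (h : HasPiDetOrder σ G θ) {W : FDRep ℂ G} (hW : ∀ g, θ g = W.character g) (g : G) :
    IsPiRoot σ (LinearMap.det (W.ρ g)) := by
  obtain ⟨V, hV, hσ⟩ := h
  rw [← FDRep.det_eq_of_character_eq fun g => (hV g).symm.trans (hW g)]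
  refine ⟨_, ?_, hσ, congrFun (pow_orderOf_eq_one fun x => LinearMap.det (V.ρ x)) g⟩
  refine (orderOf_pos_iff.2 (isOfFinOrder_iff_pow_eq_one.2 ⟨Nat.card G, Nat.card_pos, ?_⟩)).ne'
  funext x
  rw [Pi.pow_apply, ← map_pow, ← map_pow, pow_card_eq_one', map_one, map_one, Pi.one_apply]

theorem FDRep.character_eq_zero_of_finrank_eq_zero {G : Type} [Group G] {V : FDRep ℂ G}
    (h : Module.finrank ℂ V = 0) (g : G) : V.character g = 0 := by
  have : Subsingleton V := Module.finrank_zero_iff.1 h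
  have h0 : V.ρ g = 0 := Subsingleton.elim _ _
  change LinearMap.trace ℂ V (V.ρ g) = 0
  rw [h0, map_zero]

/-- Every (not necessarily irreducible) summand of the restriction of a `σ`-special character to
a subnormal subgroup has determinantal order a `σ`-number. -/
theorem IsPiSpecial.isPiRoot_det {σ : Set ℕ} {G : Type} [Group G] [Finite G] {χ : G → ℂ}
    (hχ : IsPiSpecial σ G χ) {M : Subgroup G} (hM : IsSubnormalSubgroup M)
    (V : FDRep ℂ M) (ξ : M → ℂ) (hξ : ξ = 0 ∨ IsCharacter M ξ)
    (h : resChar M χ = V.character + ξ) (g : M) :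
    IsPiRoot σ (LinearMap.det (V.ρ g)) := by
  induction hd : Module.finrank ℂ V using Nat.strong_induction_on generalizing V ξ with
  | _ d ih =>
  by_cases hirr : IsIrrChar M V.character
  · exact (hχ.2.2 M hM _ ⟨hirr, ξ, hξ, h⟩).isPiRoot_det (fun _ => rfl) g
  rcases Nat.eq_zero_or_pos d with hd0 | hd0
  · rw [LinearMap.det_eq_one_of_finrank_eq_zero (hd.trans hd0)]
    exact IsPiRoot.one
  have hne : V.character ≠ 0 := fun h0 => by
    have := congrFun h0 1
    rw [FDRep.char_one, hd, Pi.zero_apply, Nat.cast_eq_zero] at this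
    exact hd0.ne' this
  have hV : IsCharacter M V.character := ⟨V, fun _ => rfl⟩
  obtain ⟨χ₁, χ₂, h₁, h₁0, h₂, h₂0, hsum⟩ : ∃ χ₁ χ₂ : M → ℂ, IsCharacter M χ₁ ∧ χ₁ ≠ 0 ∧
      IsCharacter M χ₂ ∧ χ₂ ≠ 0 ∧ V.character = χ₁ + χ₂ := by
    by_contra hcon
    exact hirr ⟨hV, hne, hcon⟩
  obtain ⟨V₁, hV₁⟩ := h₁
  obtain ⟨V₂, hV₂⟩ := h₂
  obtain rfl : χ₁ = V₁.character := funext hV₁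
  obtain rfl : χ₂ = V₂.character := funext hV₂
  have hdim : Module.finrank ℂ V = Module.finrank ℂ V₁ + Module.finrank ℂ V₂ := by
    have := congrFun hsum 1
    rw [Pi.add_apply, FDRep.char_one, FDRep.char_one, FDRep.char_one] at this
    exact_mod_cast this
  have hd₁ : Module.finrank ℂ V₁ ≠ 0 := fun h0 =>
    h₁0 (funext (FDRep.character_eq_zero_of_finrank_eq_zero h0))
  have hd₂ : Module.finrank ℂ V₂ ≠ 0 := fun h0 =>
    h₂0 (funext (FDRep.character_eq_zero_of_finrank_eq_zero h0))
  have hadd : ∀ W : FDRep ℂ M, W.character + ξ = 0 ∨ IsCharacter M (W.character + ξ) := by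
    intro W
    right
    rcases hξ with rfl | hξ
    · exact ⟨W, fun g => by rw [add_zero]⟩
    · exact IsCharacter.add_s12 ⟨W, fun _ => rfl⟩ hξ
  have r₁ := ih _ (by omega) V₁ (V₂.character + ξ) (hadd V₂) (by rw [h, hsum, add_assoc]) rfl
  have r₂ := ih _ (by omega) V₂ (V₁.character + ξ) (hadd V₁)
    (by rw [h, hsum, add_comm V₁.character, add_assoc]) rfl
  have hdet : LinearMap.det (V.ρ g) =
      LinearMap.det ((FDRep.of (Representation.prod V₁.ρ V₂.ρ)).ρ g) := by
    refine FDRep.det_eq_of_character_eq (fun x => ?_) g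
    rw [hsum]
    exact (LinearMap.trace_prodMap' (V₁.ρ x) (V₂.ρ x)).symm
  rw [hdet]
  have : LinearMap.det ((FDRep.of (Representation.prod V₁.ρ V₂.ρ)).ρ g) =
      LinearMap.det (V₁.ρ g) * LinearMap.det (V₂.ρ g) :=
    LinearMap.det_prodMap (V₁.ρ g) (V₂.ρ g)
  rw [this]
  exact r₁.mul r₂

/-- The representation on `ℂ^ι` given by a homomorphism to matrices. -/
def matrixFDRep {G ι : Type} [Group G] [Fintype ι] [DecidableEq ι] (R : G →* Matrix ι ι ℂ) : FDRep ℂ G :=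
  FDRep.of ((Matrix.toLinAlgEquiv' : Matrix ι ι ℂ ≃ₐ[ℂ] _).toMonoidHom.comp R)

theorem matrixFDRep_character {G ι : Type} [Group G] [Fintype ι] [DecidableEq ι] (R : G →* Matrix ι ι ℂ)
    (g : G) : (matrixFDRep R).character g = (R g).trace :=
  Matrix.trace_toLin'_eq (R g)

theorem matrixFDRep_det {G ι : Type} [Group G] [Fintype ι] [DecidableEq ι] (R : G →* Matrix ι ι ℂ)
    (g : G) : LinearMap.det ((matrixFDRep R).ρ g) = (R g).det :=
  LinearMap.det_toLin' (R g)

theorem IsCharacter.exists_matrix {G : Type} [Group G] {χ : G → ℂ} (h : IsCharacter G χ) :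
    ∃ (n : ℕ) (R : G →* Matrix (Fin n) (Fin n) ℂ), ∀ g, χ g = (R g).trace := by
  obtain ⟨V, hV⟩ := h
  let b := Module.finBasis ℂ V
  refine ⟨_, (LinearMap.toMatrixAlgEquiv b : _ ≃ₐ[ℂ] _).toMonoidHom.comp V.ρ, fun g => ?_⟩
  rw [hV]
  exact LinearMap.trace_eq_matrix_trace ℂ b (V.ρ g)

section BlockRep

variable {K X n : Type} [Group K] [MulAction K X] [Fintype X] [DecidableEq X] [Fintype n]
  [DecidableEq n]

/-- The block monomial representation afforded by a matrix-valued cocycle `c`. -/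
def blockRep (c : K → X → Matrix n n ℂ) (h₁ : ∀ x, c 1 x = 1)
    (hmul : ∀ g h x, c (g * h) x = c g (h • x) * c h x) : K →* Matrix (n × X) (n × X) ℂ where
  toFun k := Matrix.of fun a b => if a.2 = k • b.2 then c k b.2 a.1 b.1 else 0
  map_one' := by
    ext a b
    simp only [one_smul, h₁, Matrix.of_apply, Matrix.one_apply, Prod.ext_iff]
    split_ifs <;> simp_all
  map_mul' g h := by
    ext a b
    simp only [Matrix.mul_apply, Matrix.of_apply, Fintype.sum_prod_type_right]
    rw [Finset.sum_eq_single (h • b.2)]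
    · simp only [smul_smul, hmul, Matrix.mul_apply, if_true]
      split_ifs
      · rfl
      · simp
    · intro x _ hx
      simp [hx]
    · simp

variable (c : K → X → Matrix n n ℂ) (h₁ : ∀ x, c 1 x = 1)
  (hmul : ∀ g h x, c (g * h) x = c g (h • x) * c h x)

theorem trace_blockRep (k : K) :
    (blockRep c h₁ hmul k).trace = ∑ x : X, if k • x = x then (c k x).trace else 0 := by
  simp only [Matrix.trace, Matrix.diag_apply, Fintype.sum_prod_type_right]
  refine Finset.sum_congr rfl fun x _ => ?_
  change (∑ a, if x = k • x then c k x a a else 0) = _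
  simp only [eq_comm (a := x)]
  split_ifs <;> simp

theorem det_blockRep_sq (k : K) :
    (blockRep c h₁ hmul k).det ^ 2 = (∏ x : X, (c k x).det) ^ 2 := by
  have h : blockRep c h₁ hmul k = (Matrix.blockDiagonal (c k)).submatrix
      ((Equiv.refl n).prodCongr (MulAction.toPerm k⁻¹)) id := by
    ext a b
    change (if a.2 = k • b.2 then c k b.2 a.1 b.1 else 0) = _
    simp only [Matrix.submatrix_apply, Matrix.blockDiagonal_apply, id, Equiv.prodCongr_apply,
      Prod.map_fst, Prod.map_snd, MulAction.toPerm_apply, Equiv.refl_apply, inv_smul_eq_iff]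
    split_ifs with hab
    · rw [hab, inv_smul_smul]
    · rfl
  rw [h, Matrix.det_permute, Matrix.det_blockDiagonal, mul_pow]
  rcases Int.units_eq_one_or (Equiv.Perm.sign
    ((Equiv.refl n).prodCongr (MulAction.toPerm k⁻¹ : Equiv.Perm X))) with hs | hs <;>
  simp [hs]

end BlockRep

section Induced

variable {G n : Type} [Group G] [Fintype n] [DecidableEq n] {U : Subgroup G}

/-- The cocycle `G × G ⧸ U → U` attached to a section of `G → G ⧸ U`. -/
def sectionCocycle {s : G ⧸ U → G} (hs : ∀ x, (s x : G ⧸ U) = x) (g : G) (x : G ⧸ U) : U :=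
  ⟨(s (g • x))⁻¹ * g * s x, by
    rw [mul_assoc, ← QuotientGroup.eq, hs, ← smul_eq_mul, ← MulAction.Quotient.smul_mk, hs]⟩

variable {s : G ⧸ U → G} (hs : ∀ x, (s x : G ⧸ U) = x)

theorem sectionCocycle_one (x : G ⧸ U) : sectionCocycle hs 1 x = 1 :=
  Subtype.ext (by simp [sectionCocycle])

theorem sectionCocycle_mul (g h : G) (x : G ⧸ U) :
    sectionCocycle hs (g * h) x = sectionCocycle hs g (h • x) * sectionCocycle hs h x :=
  Subtype.ext (by simp [sectionCocycle, mul_smul, mul_assoc])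

variable [Fintype G]

theorem indChar_eq_sum {ψ : U → ℂ} (hψ : ∀ u v, ψ (u * v) = ψ (v * u)) (g : G) :
    indChar U ψ g = ∑ x : G ⧸ U, if g • x = x then ψ (sectionCocycle hs g x) else 0 := by
  have hinv : ∀ p : (G ⧸ U) × U, ((s p.1 * p.2 : G) : G ⧸ U) = p.1 := fun p => by
    rw [QuotientGroup.mk_mul_of_mem _ p.2.2, hs]
  let e : (G ⧸ U) × U ≃ G := Equiv.ofBijective (fun p => (s p.1 * p.2)⁻¹) <| by
    constructor
    · intro p q hpq
      have h := inv_injective hpq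
      have h1 : p.1 = q.1 := by rw [← hinv p, ← hinv q, h]
      refine Prod.ext h1 (Subtype.ext ?_)
      rw [h1] at h
      exact mul_left_cancel h
    · intro y
      refine ⟨⟨((y⁻¹ : G) : G ⧸ U), ⟨(s ((y⁻¹ : G) : G ⧸ U))⁻¹ * y⁻¹, ?_⟩⟩, ?_⟩
      · rw [← QuotientGroup.eq, hs]
      · simp
  have hterm : ∀ p : (G ⧸ U) × U, (if h : e p * g * (e p)⁻¹ ∈ U then ψ ⟨e p * g * (e p)⁻¹, h⟩
      else 0) = if g • p.1 = p.1 then ψ (sectionCocycle hs g p.1) else 0 := by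
    rintro ⟨x, u⟩
    have hiff : e (x, u) * g * (e (x, u))⁻¹ ∈ U ↔ g • x = x := by
      change (s x * u)⁻¹ * g * ((s x * u)⁻¹)⁻¹ ∈ U ↔ _
      rw [inv_inv, mul_assoc, ← QuotientGroup.eq, hinv ⟨x, u⟩, ← smul_eq_mul g,
        ← MulAction.Quotient.smul_mk, hinv ⟨x, u⟩, eq_comm]
    simp only [hiff]
    split_ifs with h
    · have : (⟨e (x, u) * g * (e (x, u))⁻¹, hiff.2 h⟩ : U) =
          u⁻¹ * (sectionCocycle hs g x * u) := by
        refine Subtype.ext ?_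
        change (s x * u)⁻¹ * g * ((s x * u)⁻¹)⁻¹ = (u : G)⁻¹ * ((s (g • x))⁻¹ * g * s x * u)
        rw [h]
        group
      rw [this, hψ, mul_assoc, mul_inv_cancel, mul_one]
    · rfl
  rw [indChar, ← e.sum_comp]
  simp only [hterm]
  rw [Fintype.sum_prod_type]
  simp only [Finset.sum_const, Finset.card_univ, nsmul_eq_mul]
  rw [← Finset.mul_sum, ← mul_assoc, Nat.card_eq_fintype_card, inv_mul_cancel₀, one_mul]
  exact_mod_cast Fintype.card_ne_zero

/-- The restriction to `K` of the representation induced from `R`, on the blocks lying in a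
`K`-stable set of cosets. -/
def inducedBlockRep (R : U →* Matrix n n ℂ) {K : Subgroup G} (p : SubMulAction K (G ⧸ U)) :
    K →* Matrix (n × p) (n × p) ℂ :=
  blockRep (fun (k : K) (x : p) => R (sectionCocycle hs (k : G) (x : G ⧸ U)))
    (fun x => by rw [Subgroup.coe_one, sectionCocycle_one, map_one])
    (fun g h x => by
      rw [Subgroup.coe_mul, sectionCocycle_mul, map_mul]
      rfl)

theorem trace_inducedBlockRep (R : U →* Matrix n n ℂ) {K : Subgroup G}
    (p : SubMulAction K (G ⧸ U)) (k : K) :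
    (inducedBlockRep hs R p k).trace = ∑ x : p,
      if (k : G) • (x : G ⧸ U) = x then (R (sectionCocycle hs k (x : G ⧸ U))).trace else 0 := by
  rw [inducedBlockRep, trace_blockRep]
  simp only [Subtype.ext_iff]
  rfl

/-- Let a `σ`-special character be induced from the character of `R`, where `2 ∈ σ`, and let `K` be
subnormal. The determinant of the part of the induced representation supported on a `K`-stable set
of cosets is, up to sign, a product of values of `det R`; so this product is a `σ`-root of unity. -/
theorem IsPiSpecial.isPiRoot_prod_det {σ : Set ℕ} (h2 : 2 ∈ σ) {χ : G → ℂ}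
    (hχ : IsPiSpecial σ G χ) (R : U →* Matrix n n ℂ)
    (hind : indChar U (fun u => (R u).trace) = χ) {K : Subgroup G} (hK : IsSubnormalSubgroup K)
    (p : SubMulAction K (G ⧸ U)) (k : K) :
    IsPiRoot σ (∏ x : p, (R (sectionCocycle hs k (x : G ⧸ U))).det) := by
  let q : SubMulAction K (G ⧸ U) :=
    { carrier := {x | x ∉ p}
      smul_mem' := fun k x hx hkx => hx ((SubMulAction.smul_mem_iff' p k).1 hkx) }
  have hsum : resChar K χ = (matrixFDRep (inducedBlockRep hs R p)).character +
      (matrixFDRep (inducedBlockRep hs R q)).character := by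
    funext k
    rw [Pi.add_apply, matrixFDRep_character, matrixFDRep_character, trace_inducedBlockRep,
      trace_inducedBlockRep, resChar, ← hind,
      indChar_eq_sum hs fun u v => by rw [map_mul, map_mul, Matrix.trace_mul_comm]]
    rw [← Fintype.sum_subtype_add_sum_subtype (fun x => x ∈ p)]
    congr!
  have hdet := hχ.isPiRoot_det hK _ _ (Or.inr ⟨_, fun _ => rfl⟩) hsum k
  rw [matrixFDRep_det] at hdet
  have h2' : IsPiNumber σ 2 := fun q hq hq2 => by
    rwa [(Nat.prime_dvd_prime_iff_eq hq Nat.prime_two).1 hq2]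
  refine IsPiRoot.of_pow two_ne_zero h2' ?_
  have := hdet.mul hdet
  rwa [← pow_two, inducedBlockRep, det_blockRep_sq] at this

end Induced

theorem isSubnormalSubgroup_top {G : Type} [Group G] : IsSubnormalSubgroup (⊤ : Subgroup G) :=
  ⟨0, fun _ => ⊤, rfl, rfl, fun i => i.elim0⟩

theorem IsSubnormalSubgroup.of_normal_subgroupOf {G : Type} [Group G] {K L : Subgroup G}
    (hL : IsSubnormalSubgroup L) (hKL : K ≤ L) (hn : (K.subgroupOf L).Normal) :
    IsSubnormalSubgroup K := by
  obtain ⟨n, c, rfl, hlast, hc⟩ := hL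
  refine ⟨n + 1, Fin.cons K c, rfl, ?_, Fin.cases ⟨hKL, hn⟩ fun i => ?_⟩
  · rw [← Fin.succ_last, Fin.cons_succ, hlast]
  · rw [← Fin.succ_castSucc, Fin.cons_succ, Fin.cons_succ]
    exact hc i

theorem Subgroup.index_eq_relIndex_mul_index_sup {G : Type} [Group G] [Finite G]
    (H N : Subgroup G) [N.Normal] : H.index = H.relIndex N * (H ⊔ N).index := by
  have h₁ : H.relIndex N * N.index = N.relIndex H * H.index := by
    rw [← Subgroup.inf_relIndex_right, Subgroup.relIndex_mul_index inf_le_right,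
      ← Subgroup.inf_relIndex_left H N, Subgroup.relIndex_mul_index inf_le_left]
  have h₂ := Subgroup.relIndex_mul_index (le_sup_right : N ≤ H ⊔ N)
  rw [Subgroup.relIndex_sup_right] at h₂
  have h₀ : N.relIndex H ≠ 0 := Subgroup.index_ne_zero_of_finite
  refine Nat.eq_of_mul_eq_mul_left (Nat.pos_of_ne_zero h₀) ?_
  rw [← h₁, ← h₂]
  ring

theorem IsPiRoot.det_of_index {σ : Set ℕ} {G n : Type} [Group G] [Fintype n] [DecidableEq n]
    {U M K : Subgroup G} (R : U →* Matrix n n ℂ)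
    (hn : (M.subgroupOf K).Normal) (hM0 : (M.subgroupOf K).index ≠ 0)
    (hM : IsPiNumber σ (M.subgroupOf K).index)
    (ih : ∀ u : U, (u : G) ∈ M → IsPiRoot σ (R u).det) (u : U) (hu : (u : G) ∈ K) :
    IsPiRoot σ (R u).det := by
  refine IsPiRoot.of_pow hM0 hM ?_
  rw [← Matrix.det_pow, ← map_pow]
  exact ih _ (Subgroup.pow_index_mem (M.subgroupOf K) ⟨u, hu⟩)

theorem IsPiSpecial.isPiRoot_det_step {σ : Set ℕ} (h2 : 2 ∈ σ) {G n : Type} [Group G] [Fintype G]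
    [Fintype n] [DecidableEq n] {χ : G → ℂ} (hχ : IsPiSpecial σ G χ) {U M K : Subgroup G}
    (R : U →* Matrix n n ℂ) (hind : indChar U (fun u => (R u).trace) = χ)
    (hK : IsSubnormalSubgroup K) (hUK : IsPiNumber σ (U.relIndex K))
    (hMK : M ≤ K) (hn : (M.subgroupOf K).Normal) (hM : IsPiNumber σᶜ (M.subgroupOf K).index)
    (ih : ∀ u : U, (u : G) ∈ M → IsPiRoot σ (R u).det) (u : U) (hu : (u : G) ∈ K) :
    IsPiRoot σ (R u).det := by
  have hsup : U.subgroupOf K ⊔ M.subgroupOf K = ⊤ := by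
    refine Subgroup.index_eq_one.1 (IsPiNumber.eq_one (σ := σ) ?_ ?_)
    · exact IsPiNumber.of_dvd hUK (Subgroup.index_dvd_of_le le_sup_left)
    · exact hM.of_dvd (Subgroup.index_dvd_of_le le_sup_right)
  let p : SubMulAction K (G ⧸ U) :=
    { carrier := MulAction.orbit K ((1 : G) : G ⧸ U)
      smul_mem' := fun k _ hx => MulAction.mem_orbit_of_mem_orbit k hx }
  have hrep : ∀ x : G ⧸ U, ∃ g : G, (g : G ⧸ U) = x ∧ (x ∈ p → g ∈ M) := by
    intro x
    by_cases hx : x ∈ p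
    · obtain ⟨k, rfl⟩ := hx
      have hk : k ∈ M.subgroupOf K ⊔ U.subgroupOf K := by rw [sup_comm, hsup]; trivial
      obtain ⟨m, hm, v, hv, rfl⟩ := Subgroup.mem_sup_of_normal_left.1 hk
      refine ⟨m, ?_, fun _ => hm⟩
      change _ = (((m * v : K) : G) • ((1 : G) : G ⧸ U))
      rw [MulAction.Quotient.smul_coe, smul_eq_mul, mul_one, Subgroup.coe_mul,
        QuotientGroup.mk_mul_of_mem (m : G) (Subgroup.mem_subgroupOf.1 hv)]
    · obtain ⟨g, hg⟩ := QuotientGroup.mk_surjective x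
      exact ⟨g, hg, fun h => absurd h hx⟩
  choose s hs hsM using hrep
  have hprod := hχ.isPiRoot_prod_det hs h2 R hind hK p ⟨u, hu⟩
  have hcard : Fintype.card p = U.relIndex K := by
    have hstab : MulAction.stabilizer K ((1 : G) : G ⧸ U) = U.subgroupOf K := by
      ext k
      rw [MulAction.mem_stabilizer_iff, Subgroup.mem_subgroupOf]
      change (k : G) • ((1 : G) : G ⧸ U) = _ ↔ _
      rw [MulAction.Quotient.smul_coe, smul_eq_mul, mul_one, eq_comm, QuotientGroup.eq, inv_one,
        one_mul]
    rw [Subgroup.relIndex, ← hstab, MulAction.index_stabilizer, ← Nat.card_eq_fintype_card]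
    rfl
  have hmem : ∀ x : p, ∃ w : U, (w : G) ∈ M ∧ sectionCocycle hs (u : G) (x : G ⧸ U) = u * w := by
    intro x
    refine ⟨u⁻¹ * sectionCocycle hs u (x : G ⧸ U), ?_, by rw [mul_inv_cancel_left]⟩
    have hux : (u : G) • (x : G ⧸ U) ∈ p := p.smul_mem ⟨u, hu⟩ x.2
    have hconj := hn.conj_mem ⟨(s ((u : G) • (x : G ⧸ U)))⁻¹, hMK (M.inv_mem (hsM _ hux))⟩
      (M.inv_mem (hsM _ hux)) ⟨u, hu⟩⁻¹
    have := M.mul_mem hconj (hsM x x.2)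
    simpa [sectionCocycle, mul_assoc] using this
  choose w hw hcw using hmem
  simp only [hcw, map_mul, Matrix.det_mul, Finset.prod_mul_distrib, Finset.prod_const,
    Finset.card_univ, hcard] at hprod
  exact (hprod.of_mul_right (IsPiRoot.prod _ fun x _ => ih _ (hw x))).of_pow
    (Subgroup.index_ne_zero_of_finite (H := U.subgroupOf K)) hUK

theorem IsPiSpecial.isPiRoot_det_of_indChar {σ : Set ℕ} (h2 : 2 ∈ σ) {G n : Type} [Group G]
    [Fintype G] [Fintype n] [DecidableEq n] (hG : IsPiSeparable σ G) {χ : G → ℂ}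
    (hχ : IsPiSpecial σ G χ) {U : Subgroup G} (hU : IsPiNumber σ U.index)
    (R : U →* Matrix n n ℂ) (hind : indChar U (fun u => (R u).trace) = χ) (u : U) :
    IsPiRoot σ (R u).det := by
  obtain ⟨N, c, h0, hlast, hc⟩ := hG
  have hsub : ∀ i, IsSubnormalSubgroup (c i) ∧ IsPiNumber σ (U.relIndex (c i)) := by
    intro i
    induction i using Fin.reverseInduction with
    | last => 
      rw [hlast, Subgroup.relIndex_top_right]
      exact ⟨isSubnormalSubgroup_top, hU⟩
    | cast i ih =>
      obtain ⟨hle, hn, -⟩ := hc i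
      refine ⟨ih.1.of_normal_subgroupOf hle hn, ih.2.of_dvd ?_⟩
      rw [← Subgroup.relIndex_subgroupOf hle]
      exact ⟨_, Subgroup.index_eq_relIndex_mul_index_sup _ _⟩
  have key : ∀ i, ∀ u : U, (u : G) ∈ c i → IsPiRoot σ (R u).det := by
    intro i
    induction i using Fin.induction with
    | zero =>
      intro u hu
      rw [h0, Subgroup.mem_bot, OneMemClass.coe_eq_one] at hu
      rw [hu, map_one, Matrix.det_one]
      exact IsPiRoot.one
    | succ i ih =>
      obtain ⟨hle, hn, hq | hq⟩ := hc i
      · exact IsPiRoot.det_of_index R hn Subgroup.index_ne_zero_of_finite hq ih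
      · exact hχ.isPiRoot_det_step h2 R hind (hsub _).1 (hsub _).2 hle hn hq ih
  exact key (Fin.last N) u (by rw [hlast]; trivial)

theorem indChar_one {G : Type} [Group G] [Fintype G] (U : Subgroup G) (ψ : U → ℂ) :
    indChar U ψ 1 = U.index * ψ 1 := by
  have h : ∀ x : G, (if h : x * 1 * x⁻¹ ∈ U then ψ ⟨x * 1 * x⁻¹, h⟩ else 0) = ψ 1 := fun x => by
    rw [dif_pos (by simp)]
    exact congrArg ψ (Subtype.ext (by simp))
  have h0 : (Nat.card U : ℂ) ≠ 0 := Nat.cast_ne_zero.2 Nat.card_pos.ne'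
  simp only [indChar, h, Finset.sum_const, Finset.card_univ, nsmul_eq_mul]
  rw [← Nat.card_eq_fintype_card, ← U.card_mul_index, Nat.cast_mul]
  field_simp

theorem indChar_mul_resChar {G : Type} [Group G] [Fintype G] {U : Subgroup G} (ψ : U → ℂ)
    {f : G → ℂ} (hf : ∀ x g, f (x * g * x⁻¹) = f g) :
    indChar U (ψ * resChar U f) = indChar U ψ * f := by
  funext g
  simp only [indChar, resChar, Pi.mul_apply, mul_assoc, Finset.sum_mul]
  refine congrArg _ (Finset.sum_congr rfl fun x _ => ?_)
  split_ifs <;> simp [← mul_assoc, hf]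

theorem IsPiSpecial.isPiRoot_det_matrix {σ : Set ℕ} {G n : Type} [Group G] [Finite G] [Fintype n]
    [DecidableEq n] {χ : G → ℂ} (hχ : IsPiSpecial σ G χ) (R : G →* Matrix n n ℂ)
    (hR : ∀ g, χ g = (R g).trace) (g : G) : IsPiRoot σ (R g).det := by
  have h := hχ.isPiRoot_det isSubnormalSubgroup_top
    (matrixFDRep (R.comp (⊤ : Subgroup G).subtype)) 0 (Or.inl rfl)
    (funext fun x => by
      rw [add_zero, matrixFDRep_character]
      exact hR x) ⟨g, Subgroup.mem_top g⟩
  rwa [matrixFDRep_det] at h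

theorem IsPiSpecial.exists_monoidHom {σ : Set ℕ} {G : Type} [Group G] [Finite G] {χ : G → ℂ}
    (hχ : IsPiSpecial σ G χ) (h1 : χ 1 = 1) :
    ∃ f : G →* ℂ, (∀ g, χ g = f g) ∧ ∀ g, IsPiRoot σ (f g) := by
  obtain ⟨n, R, hR⟩ := hχ.1.1.exists_matrix
  obtain rfl : n = 1 := by
    rw [hR, map_one, Matrix.trace_one, Fintype.card_fin] at h1
    exact_mod_cast h1
  exact ⟨Matrix.detMonoidHom.comp R, fun g => by simp [hR, Matrix.trace_fin_one],
    hχ.isPiRoot_det_matrix R hR⟩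

/-- **Theorem (Statement 12).** Let `π` be a set of primes with `2 ∈ π` and let `G` be a
finite `π`-separable group.  Let `χ = αβ ∈ Irr(G)` with `α` `π`-special and `β` linear
and `π'`-special.  If `ψ ∈ Irr(U)` is `π`-factored and induces `χ`, and `δ` is the
`π'`-special factor of `ψ`, then `β_U = δ`. -/
theorem piPrime_factor_of_induced
    (π : Set ℕ) (h2 : 2 ∈ π)
    (G : Type) [Group G] [Fintype G] (hG : IsPiSeparable π G)
    (χ : G → ℂ) (hχ : IsIrrChar G χ)
    (α β : G → ℂ) (hα : IsPiSpecial π G α) (hβ : IsPiSpecial πᶜ G β)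
    (hβlin : β 1 = 1) (hχfac : χ = α * β)
    (U : Subgroup G) (ψ : ↥U → ℂ) (hψirr : IsIrrChar ↥U ψ)
    (γ δ : ↥U → ℂ) (hγ : IsPiSpecial π ↥U γ) (hδ : IsPiSpecial πᶜ ↥U δ)
    (hψfac : ψ = γ * δ) (hind : indChar U ψ = χ) :
    resChar U β = δ := by
  obtain ⟨b, hb, hbroot⟩ := hβ.exists_monoidHom hβlin
  obtain ⟨a, ha, haπ⟩ := hα.2.1
  obtain ⟨c, hc, hcπ⟩ := hγ.2.1
  obtain ⟨d, hd, hdπ⟩ := hδ.2.1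
  have hdeg : U.index * (c * d) = a := by
    have h := congrFun hind 1
    rw [indChar_one, hψfac, hχfac, Pi.mul_apply, Pi.mul_apply, hβlin, ha, hc, hd, mul_one] at h
    exact_mod_cast h
  have hU : IsPiNumber π U.index := haπ.of_dvd ⟨_, hdeg.symm⟩
  obtain rfl : d = 1 := (haπ.of_dvd ⟨U.index * c, by rw [← hdeg]; ring⟩).eq_one hdπ
  obtain ⟨e, he, heroot⟩ := hδ.exists_monoidHom (by rw [hd, Nat.cast_one])
  obtain ⟨n, ρ, hρ⟩ := hγ.1.1.exists_matrix
  obtain rfl : n = c := by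
    rw [hρ, map_one, Matrix.trace_one, Fintype.card_fin] at hc
    exact_mod_cast hc
  have hn0 : n ≠ 0 := by
    rintro rfl
    exact hγ.1.2.1 (funext fun u => by simp [hρ, Matrix.trace])
  have hb0 : ∀ g, b g ≠ 0 := fun g => (hbroot g).ne_zero
  let ε : U →* ℂ :=
    { toFun := fun u => e u * (b u)⁻¹
      map_one' := by simp
      map_mul' := fun u v => by simp only [Subgroup.coe_mul, map_mul, mul_inv]; ring }
  let R : U →* Matrix (Fin n) (Fin n) ℂ :=
    { toFun := fun u => ε u • ρ u
      map_one' := by simp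
      map_mul' := fun u v => by rw [map_mul, map_mul, smul_mul_smul_comm] }
  have hR : indChar U (fun u => (R u).trace) = α := by
    have htr : (fun u => (R u).trace) = ψ * resChar U fun g => (b g)⁻¹ := by
      funext u
      change (ε u • ρ u).trace = ψ u * (b u)⁻¹
      rw [Matrix.trace_smul, ← hρ, hψfac, Pi.mul_apply, he, smul_eq_mul]
      change e u * (b u)⁻¹ * γ u = _
      ring
    rw [htr, indChar_mul_resChar _ fun x g => congrArg (·⁻¹) <| by
      rw [map_mul, map_mul, mul_right_comm, ← map_mul, mul_inv_cancel, map_one, one_mul],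
      hind, hχfac]
    funext g
    simp [hb, hb0]
  have hε : ∀ u, ε u = 1 := fun u => by
    have hdet := hα.isPiRoot_det_of_indChar h2 hG hU R hR u
    change IsPiRoot π (ε u • ρ u).det at hdet
    rw [Matrix.det_smul, Fintype.card_fin] at hdet
    exact ((hdet.of_mul_right (hγ.isPiRoot_det_matrix ρ hρ u)).of_pow hn0 hcπ).eq_one
      ((heroot u).mul (hbroot u).inv)
  funext u
  have h := hε u
  change e u * (b u)⁻¹ = 1 at h
  rw [resChar, hb, he, eq_comm, ← div_eq_one_iff_eq (hb0 u), div_eq_mul_inv, h]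
end
end
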